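/- Let g be a Riemannian metric on T² whose geodesic flow has zero topological entropy. Then the asymptotic direction δ: ST² → S¹, v ↦ δ(c_v⁺), and the rotation number ρ: ST² → ℝ ∪ {∞}, v ↦ ρ(c_v⁺), are well-defined, surjective, continuous functions which are invariant under the geodesic flow, i.e. δ(φ^t v) = δ(v) and ρ(φ^t v) = ρ(v) for all v ∈ ST² and t ∈ ℝ. -/

import Mathlib

open Filter Topology Set
open scoped ENNReal

noncomputable section

/-- The Euclidean norm of a point of `ℝ × ℝ` (the universal covering of `T²`). -/
def norm2 (p : ℝ × ℝ) : ℝ := Real.sqrt (p.1 ^ 2 + p.2 ^ 2)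

/-- The translation vector of the covering transformation `τ_{(m,n)}` of `T² = ℝ²/ℤ²`. -/
def lat (k : ℤ × ℤ) : ℝ × ℝ := ((k.1 : ℝ), (k.2 : ℝ))

/-- The transl of a curve in `ℝ²` by the covering transformation `τ_k`. -/
def transl (k : ℤ × ℤ) (c : ℝ → ℝ × ℝ) : ℝ → ℝ × ℝ := fun t => c t + lat k

/-- The asymptotic direction `δ(τ_k)` of the axes of the translation element `τ_k`. -/
def latDir (k : ℤ × ℤ) : ℝ × ℝ := (norm2 (lat k))⁻¹ • lat k

/-- A smooth Riemannian metric on the torus `T² = ℝ²/ℤ²`, described through its lift to the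
universal covering `ℝ²`: a smooth family of positive definite symmetric bilinear forms on the
tangent spaces of `ℝ²`, invariant under the deck transformation group `ℤ²`. -/
structure TorusMetric where
  g : (ℝ × ℝ) → (ℝ × ℝ) → (ℝ × ℝ) → ℝ
  smooth : ContDiff ℝ (⊤ : ℕ∞) fun p : (ℝ × ℝ) × (ℝ × ℝ) × (ℝ × ℝ) => g p.1 p.2.1 p.2.2
  symm : ∀ x v w, g x v w = g x w v
  linear : ∀ x w, IsLinearMap ℝ fun v => g x v w
  posdef : ∀ x v, v ≠ 0 → 0 < g x v v
  periodic : ∀ (k : ℤ × ℤ) (x v w : ℝ × ℝ), g (x + lat k) v w = g x v w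

namespace TorusMetric

/-- The Riemannian length of the curve `c` between the parameters `a` and `b`. -/
def length (M : TorusMetric) (c : ℝ → ℝ × ℝ) (a b : ℝ) : ℝ :=
  ∫ t in a..b, Real.sqrt (M.g (c t) (deriv c t) (deriv c t))

/-- The Riemannian distance on the universal covering `ℝ²` (hence also on `T²`). -/
def dist (M : TorusMetric) (x y : ℝ × ℝ) : ℝ :=
  sInf {L | ∃ c : ℝ → ℝ × ℝ, ContDiff ℝ 1 c ∧ c 0 = x ∧ c 1 = y ∧ L = M.length c 0 1}

/-- A (complete, unit speed) geodesic of the lifted metric on the universal covering `ℝ²`: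
a smooth curve with constant unit speed which is locally length minimizing. -/
def IsGeodesic (M : TorusMetric) (c : ℝ → ℝ × ℝ) : Prop :=
  ContDiff ℝ (⊤ : ℕ∞) c ∧ (∀ t, M.g (c t) (deriv c t) (deriv c t) = 1) ∧
    ∀ t : ℝ, ∃ ε > 0, ∀ s₁ s₂, t - ε ≤ s₁ → s₁ ≤ s₂ → s₂ ≤ t + ε →
      M.dist (c s₁) (c s₂) = M.length c s₁ s₂

end TorusMetric

/-- The distance between two points of the unit tangent bundle `ST²` of the torus; points of
`ST²` are represented by points of the tangent bundle `ℝ² × ℝ²` of the universal covering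
(the deck transformations act trivially on the vector component). -/
def phaseDist (p q : (ℝ × ℝ) × (ℝ × ℝ)) : ℝ :=
  sInf {r : ℝ | ∃ k : ℤ × ℤ, r = norm2 (p.1 - (q.1 + lat k)) + norm2 (p.2 - q.2)}

/-- A `(φ,ε)`-separated set with respect to time `T` for the geodesic flow `φ` of `M` on
`ST²`: a finite family of geodesics (each geodesic `c` representing the phase point
`(c 0, ċ 0) ∈ ST²`, of which `t ↦ (c t, ċ t)` is the flow orbit) such that any two distinct
members satisfy `max_{0 ≤ t ≤ T} d(φᵗ v, φᵗ w) > ε`. -/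
def IsSeparated (M : TorusMetric) (ε T : ℝ) (F : Finset (ℝ → ℝ × ℝ)) : Prop :=
  (∀ c ∈ F, M.IsGeodesic c) ∧
    ∀ c₁ ∈ F, ∀ c₂ ∈ F, c₁ ≠ c₂ →
      ∃ t ∈ Set.Icc (0 : ℝ) T, ε < phaseDist (c₁ t, deriv c₁ t) (c₂ t, deriv c₂ t)

/-- `r_T(φ, ε)`: the maximal cardinality of `(φ,ε)`-separated sets with respect to `T`. -/
def sepCount (M : TorusMetric) (ε T : ℝ) : ℝ≥0∞ :=
  ⨆ (F : Finset (ℝ → ℝ × ℝ)) (_ : IsSeparated M ε T F), (F.card : ℝ≥0∞)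

/-- Extended real logarithm of an extended nonnegative real. -/
def elog (x : ℝ≥0∞) : EReal :=
  if x = 0 then ⊥ else if x = ⊤ then ⊤ else ((Real.log x.toReal : ℝ) : EReal)

/-- Bowen's topological entropy `h_top(g)` of the geodesic flow of `g` on `ST²`:
`lim_{ε → 0} limsup_{T → ∞} (1/T) log r_T(φ,ε)`; since `r_T(φ,ε)` is monotone in `ε`,
the limit `ε → 0` is realized as the supremum over `ε > 0`. -/
def topEnt (M : TorusMetric) : EReal :=
  ⨆ (ε : ℝ) (_ : 0 < ε),
    Filter.limsup (fun T : ℝ => ((T⁻¹ : ℝ) : EReal) * elog (sepCount M ε T)) Filter.atTop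

/-- The forward ray `c⁺` of `c` is escaping: `‖c(t)‖ → ∞` as `t → ∞`. -/
def EscapesForward (c : ℝ → ℝ × ℝ) : Prop :=
  Filter.Tendsto (fun t => norm2 (c t)) Filter.atTop Filter.atTop

/-- The backward ray `c⁻` of `c` is escaping: `‖c(-t)‖ → ∞` as `t → ∞`. -/
def EscapesBackward (c : ℝ → ℝ × ℝ) : Prop :=
  Filter.Tendsto (fun t => norm2 (c (-t))) Filter.atTop Filter.atTop

/-- `z ∈ S¹` is the asymptotic direction `δ(c⁺) = lim_{t → ∞} c(t)/‖c(t)‖` of the forward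
ray of `c`. -/
def HasDirection (c : ℝ → ℝ × ℝ) (z : ℝ × ℝ) : Prop :=
  norm2 z = 1 ∧ Filter.Tendsto (fun t => (norm2 (c t))⁻¹ • c t) Filter.atTop (nhds z)

/-- The canonical projection `π : S¹ → P¹(ℝ) ≅ ℝ ∪ {∞}`, sending `(x, y)` to `y/x` if
`x ≠ 0` and to `∞` otherwise; `ℝ ∪ {∞}` is the one-point compactification of `ℝ`. -/
def projPt (z : ℝ × ℝ) : OnePoint ℝ :=
  if z.1 = 0 then OnePoint.infty else ((z.2 / z.1 : ℝ) : OnePoint ℝ)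

/-- `crossDet v w ≠ 0` expresses transversality of two directions in `ℝ²`. -/
def crossDet (v w : ℝ × ℝ) : ℝ := v.1 * w.2 - v.2 * w.1

/-- The set of points at which the curve `c₁` (restricted to parameters in `D₁`) and the
curve `c₂` (restricted to parameters in `D₂`) intersect transversally. -/
def transInter (c₁ c₂ : ℝ → ℝ × ℝ) (D₁ D₂ : Set ℝ) : Set (ℝ × ℝ) :=
  {x | ∃ s ∈ D₁, ∃ t ∈ D₂, c₁ s = x ∧ c₂ t = x ∧ crossDet (deriv c₁ s) (deriv c₂ t) ≠ 0}

/-- The geodesic `c` is an axis of the (nontrivial) translation element `τ_k`: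
`τ_k c(t) = c(t + ℓ)` for some `ℓ` and all `t`. -/
def IsAxisOf (M : TorusMetric) (c : ℝ → ℝ × ℝ) (k : ℤ × ℤ) : Prop :=
  M.IsGeodesic c ∧ k ≠ 0 ∧ ∃ ℓ : ℝ, ∀ t, c (t + ℓ) = c t + lat k

/-- The geodesic `c` is an axis of some nontrivial translation element. -/
def IsAxis (M : TorusMetric) (c : ℝ → ℝ × ℝ) : Prop := ∃ k : ℤ × ℤ, IsAxisOf M c k

/-- The curve `c` is minimal: each of its segments minimizes the Riemannian length between
its endpoints. -/
def IsMinimal (M : TorusMetric) (c : ℝ → ℝ × ℝ) : Prop :=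
  ∀ s t : ℝ, s ≤ t → M.dist (c s) (c t) = M.length c s t

/-- Equivalence of translation elements: `τ₁^a = τ₂^b` for some nonzero integers `a, b`. -/
def TransEquiv (k₁ k₂ : ℤ × ℤ) : Prop := ∃ a b : ℤ, a ≠ 0 ∧ b ≠ 0 ∧ a • k₁ = b • k₂

/-- A translation element is primitive if it is not a nontrivial power of another
translation element. -/
def IsPrimitive (k : ℤ × ℤ) : Prop := k ≠ 0 ∧ ∀ (j : ℤ × ℤ) (n : ℤ), k = n • j → IsUnit n

/-- The metric `g` on `T²` is flat, i.e. its Gaussian curvature vanishes identically;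
equivalently (by the theorems of Myers–Steenrod and Cartan–Hadamard), the universal covering
`ℝ²` with the induced Riemannian distance is isometric to the Euclidean plane. -/
def IsFlat (M : TorusMetric) : Prop :=
  ∃ F : (ℝ × ℝ) ≃ (ℝ × ℝ), ∀ x y, M.dist x y = norm2 (F x - F y)

lemma mem_Icc_zero_pi_of_sin_nonneg {u : ℝ → ℝ} (hu : Continuous u)
    (h : ∀ t, 0 ≤ Real.sin (u t)) {a b : ℝ} (ha : u a ∈ Icc 0 Real.pi) :
    u b ∈ Icc 0 Real.pi := by
  have hpi := Real.pi_pos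
  have key : ∀ y, y ∈ uIcc (u a) (u b) → 0 ≤ Real.sin y := by
    intro y hy
    obtain ⟨t, -, rfl⟩ := intermediate_value_uIcc (a := a) (b := b) hu.continuousOn hy
    exact h t
  by_contra hb
  rw [mem_Icc, not_and_or, not_le, not_le] at hb
  rcases hb with hb | hb
  · have h1 := key (max (u b) (-(Real.pi / 2)))
      (by rw [mem_uIcc]; right; exact ⟨le_max_left _ _, max_le (by linarith [ha.1]) (by linarith [ha.1])⟩)
    have h2 : Real.sin (max (u b) (-(Real.pi / 2))) < 0 :=
      Real.sin_neg_of_neg_of_neg_pi_lt (max_lt hb (by linarith))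
        (lt_of_lt_of_le (by linarith) (le_max_right _ _))
    linarith
  · have h1 := key (min (u b) (3 * Real.pi / 2))
      (by rw [mem_uIcc]; left; exact ⟨le_min (by linarith [ha.2]) (by linarith [ha.2]), min_le_left _ _⟩)
    have h2 : 0 < Real.sin (min (u b) (3 * Real.pi / 2) - Real.pi) :=
      Real.sin_pos_of_pos_of_lt_pi (by linarith [lt_min hb (by linarith : Real.pi < 3 * Real.pi / 2)])
        (by linarith [min_le_right (u b) (3 * Real.pi / 2)])
    rw [Real.sin_sub_pi] at h2
    linarith

lemma half_pi_le_of_cos_nonpos {u : ℝ} (h : u ∈ Icc 0 Real.pi) (hc : Real.cos u ≤ 0) :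
    Real.pi / 2 ≤ u := by
  by_contra hu
  push Not at hu
  have := Real.cos_pos_of_mem_Ioo (x := u) ⟨by linarith [h.1, Real.pi_pos], hu⟩
  linarith

/-- The Poincaré–Miranda theorem on a rectangle of the plane. -/
theorem poincare_miranda {a b c d : ℝ} (hab : a ≤ b) (hcd : c ≤ d) {F G : ℝ × ℝ → ℝ}
    (hF : ContinuousOn F (Icc a b ×ˢ Icc c d)) (hG : ContinuousOn G (Icc a b ×ˢ Icc c d))
    (hleft : ∀ t ∈ Icc c d, F (a, t) ≤ 0) (hright : ∀ t ∈ Icc c d, 0 ≤ F (b, t))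
    (hbot : ∀ s ∈ Icc a b, G (s, c) ≤ 0) (htop : ∀ s ∈ Icc a b, 0 ≤ G (s, d)) :
    ∃ s ∈ Icc a b, ∃ t ∈ Icc c d, F (s, t) = 0 ∧ G (s, t) = 0 := by
  by_contra hne
  push Not at hne
  let σ : ℝ → ℝ := fun s => max a (min b s)
  let τ : ℝ → ℝ := fun t => max c (min d t)
  have hσ : ∀ s, σ s ∈ Icc a b := fun s => ⟨le_max_left _ _, max_le hab (min_le_left _ _)⟩
  have hτ : ∀ t, τ t ∈ Icc c d := fun s => ⟨le_max_left _ _, max_le hcd (min_le_left _ _)⟩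
  have hcl : Continuous fun p : ℝ × ℝ => (σ p.1, τ p.2) := by fun_prop
  have hF' : Continuous fun p : ℝ × ℝ => F (σ p.1, τ p.2) :=
    hF.comp_continuous hcl fun p => ⟨hσ _, hτ _⟩
  have hG' : Continuous fun p : ℝ × ℝ => G (σ p.1, τ p.2) :=
    hG.comp_continuous hcl fun p => ⟨hσ _, hτ _⟩
  have hσa : σ a = a := by simp [σ, hab]
  have hσb : σ b = b := by simp [σ, hab]
  have hτc : τ c = c := by simp [τ, hcd]
  have hτd : τ d = d := by simp [τ, hcd]
  let Z : C(ℝ × ℝ, ℂ) :=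
    ⟨fun p => (F (σ p.1, τ p.2) : ℂ) + (G (σ p.1, τ p.2) : ℂ) * Complex.I,
      (Complex.continuous_ofReal.comp hF').add
        ((Complex.continuous_ofReal.comp hG').mul continuous_const)⟩
  have hZre : ∀ p, (Z p).re = F (σ p.1, τ p.2) := fun p => by simp [Z]
  have hZim : ∀ p, (Z p).im = G (σ p.1, τ p.2) := fun p => by simp [Z]
  have hZ : ∀ p, Z p ≠ 0 := by
    intro p h0
    have h1 := congrArg Complex.re h0
    have h2 := congrArg Complex.im h0
    rw [hZre, Complex.zero_re] at h1
    rw [hZim, Complex.zero_im] at h2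
    exact hne _ (hσ p.1) _ (hτ p.2) h1 h2
  have he : Complex.exp (Complex.log (-(Z (a, c))) + Real.pi * Complex.I) = Z (a, c) := by
    rw [Complex.exp_add, Complex.exp_log (neg_ne_zero.2 (hZ _)), Complex.exp_pi_mul_I]
    ring
  obtain ⟨φ, ⟨hφ0, hφ⟩, -⟩ := Complex.isCoveringMapOn_exp.existsUnique_continuousMap_lifts Z
    (a₀ := (a, c)) he (fun p => hZ p)
  have hφ' : ∀ p, Complex.exp (φ p) = Z p := fun p => congrFun hφ p
  let θ : ℝ × ℝ → ℝ := fun p => (φ p).im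
  have hθ : Continuous θ := by fun_prop
  have hcos : ∀ p, Real.exp (φ p).re * Real.cos (θ p) = F (σ p.1, τ p.2) := by
    intro p; rw [← hZre, ← hφ', Complex.exp_re]
  have hsin : ∀ p, Real.exp (φ p).re * Real.sin (θ p) = G (σ p.1, τ p.2) := by
    intro p; rw [← hZim, ← hφ', Complex.exp_im]
  have hcos0 : ∀ p, 0 ≤ F (σ p.1, τ p.2) → 0 ≤ Real.cos (θ p) := fun p h => by
    rw [← hcos] at h; exact nonneg_of_mul_nonneg_right h (Real.exp_pos _)
  have hcos1 : ∀ p, F (σ p.1, τ p.2) ≤ 0 → Real.cos (θ p) ≤ 0 := fun p h => by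
    rw [← hcos] at h; exact nonpos_of_mul_nonpos_right h (Real.exp_pos _)
  have hsin0 : ∀ p, 0 ≤ G (σ p.1, τ p.2) → 0 ≤ Real.sin (θ p) := fun p h => by
    rw [← hsin] at h; exact nonneg_of_mul_nonneg_right h (Real.exp_pos _)
  have hsin1 : ∀ p, G (σ p.1, τ p.2) ≤ 0 → Real.sin (θ p) ≤ 0 := fun p h => by
    rw [← hsin] at h; exact nonpos_of_mul_nonpos_right h (Real.exp_pos _)
  have hpi := Real.pi_pos
  -- the four edges
  have eb : ∀ s, Real.sin (θ (s, c)) ≤ 0 := fun s => hsin1 _ (by simpa [hτc] using hbot _ (hσ s))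
  have et : ∀ s, 0 ≤ Real.sin (θ (s, d)) := fun s => hsin0 _ (by simpa [hτd] using htop _ (hσ s))
  have el : ∀ t, Real.cos (θ (a, t)) ≤ 0 := fun t => hcos1 _ (by simpa [hσa] using hleft _ (hτ t))
  have er : ∀ t, 0 ≤ Real.cos (θ (b, t)) := fun t => hcos0 _ (by simpa [hσb] using hright _ (hτ t))
  have h0 : θ (a, c) = Complex.arg (-(Z (a, c))) + Real.pi := by
    simp [θ, hφ0, Complex.log_im]
  have h0' : Complex.arg (-(Z (a, c))) ∈ Icc 0 (Real.pi / 2) := by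
    refine ⟨Complex.arg_nonneg_iff.2 ?_, ?_⟩
    · rw [Complex.neg_im, hZim, hσa, hτc]; simpa using hbot a ⟨le_rfl, hab⟩
    · refine (abs_le.1 (Complex.abs_arg_le_pi_div_two_iff.2 ?_)).2
      rw [Complex.neg_re, hZre, hσa, hτc]; simpa using hleft c ⟨le_rfl, hcd⟩
  have s1 := mem_Icc_zero_pi_of_sin_nonneg (u := fun s => θ (s, c) - Real.pi) (by fun_prop)
    (fun t => by rw [Real.sin_sub_pi]; linarith [eb t]) (a := a) (b := b)
    (by rw [h0]; constructor <;> linarith [h0'.1, h0'.2])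
  have s1' := half_pi_le_of_cos_nonpos s1 (by rw [Real.cos_sub_pi]; linarith [er c])
  have s2 := mem_Icc_zero_pi_of_sin_nonneg (u := fun t => θ (b, t) - Real.pi - Real.pi / 2)
    (by fun_prop)
    (fun t => by rw [Real.sin_sub_pi_div_two, Real.cos_sub_pi]; linarith [er t]) (a := c) (b := d)
    (by constructor <;> linarith [s1.2])
  have s2' := half_pi_le_of_cos_nonpos s2
    (by rw [Real.cos_sub_pi_div_two, Real.sin_sub_pi]; linarith [et b])
  have s3 := mem_Icc_zero_pi_of_sin_nonneg (u := fun s => θ (s, d) - 2 * Real.pi)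
    (by fun_prop) (fun t => by rw [Real.sin_sub_two_pi]; linarith [et t]) (a := b) (b := a)
    (by constructor <;> linarith [s2.2])
  have s3' := half_pi_le_of_cos_nonpos s3 (by rw [Real.cos_sub_two_pi]; linarith [el d])
  have s4 := mem_Icc_zero_pi_of_sin_nonneg (u := fun t => θ (a, t) - 2 * Real.pi - Real.pi / 2)
    (by fun_prop)
    (fun t => by rw [Real.sin_sub_pi_div_two, Real.cos_sub_two_pi]; linarith [el t])
    (a := d) (b := c) (by constructor <;> linarith [s3.2])
  have := s4.1
  linarith [h0'.2]

/-- Two paths crossing a common box in transversal directions intersect: `π` runs from the left of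
the path `ζ` to its right, and `ζ` runs from below `π` to above `π`, as measured by two
linear coordinates. -/
theorem exists_crossing {ξ h : ℝ × ℝ →L[ℝ] ℝ} (hinj : ∀ x, ξ x = 0 → h x = 0 → x = 0)
    {a b c d : ℝ} (hab : a ≤ b) (hcd : c ≤ d) {π ζ : ℝ → ℝ × ℝ}
    (hπ : ContinuousOn π (Icc a b)) (hζ : ContinuousOn ζ (Icc c d))
    (hl : ∀ t ∈ Icc c d, ξ (π a) ≤ ξ (ζ t)) (hr : ∀ t ∈ Icc c d, ξ (ζ t) ≤ ξ (π b))
    (hb : ∀ s ∈ Icc a b, h (ζ c) ≤ h (π s)) (ht : ∀ s ∈ Icc a b, h (π s) ≤ h (ζ d)) :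
    ∃ s ∈ Icc a b, ∃ t ∈ Icc c d, π s = ζ t := by
  have c1 : ContinuousOn (fun p : ℝ × ℝ => π p.1) (Icc a b ×ˢ Icc c d) :=
    hπ.comp continuousOn_fst fun p hp => hp.1
  have c2 : ContinuousOn (fun p : ℝ × ℝ => ζ p.2) (Icc a b ×ˢ Icc c d) :=
    hζ.comp continuousOn_snd fun p hp => hp.2
  obtain ⟨s, hs, t, ht', e1, e2⟩ := poincare_miranda hab hcd
    (F := fun p => ξ (π p.1) - ξ (ζ p.2)) (G := fun p => h (ζ p.2) - h (π p.1))
    ((ξ.continuous.comp_continuousOn c1).sub (ξ.continuous.comp_continuousOn c2))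
    ((h.continuous.comp_continuousOn c2).sub (h.continuous.comp_continuousOn c1))
    (fun t ht => sub_nonpos.2 (hl t ht)) (fun t ht => sub_nonneg.2 (hr t ht))
    (fun s hs => sub_nonpos.2 (hb s hs)) (fun s hs => sub_nonneg.2 (ht s hs))
  refine ⟨s, hs, t, ht', sub_eq_zero.1 (hinj _ ?_ ?_)⟩
  · simpa using e1
  · rw [map_sub]; simp only at e2; linarith

/-- A bounded globally Lipschitz vector field has complete integral curves. -/
lemma exists_global_solution {V : Type*} [NormedAddCommGroup V] [NormedSpace ℝ V] [CompleteSpace V]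
    {X : V → V} {K B : NNReal} (hK : LipschitzWith K X) (hB : ∀ x, ‖X x‖ ≤ B) (x : V) :
    ∃ γ : ℝ → V, γ 0 = x ∧ ∀ t, HasDerivAt γ (X (γ t)) t := by
  have loc : ∀ n : ℕ, ∃ γ : ℝ → V, γ 0 = x ∧
      ∀ t ∈ Icc (-(n + 1 : ℝ)) (n + 1), HasDerivWithinAt γ (X (γ t)) (Icc (-(n + 1 : ℝ)) (n + 1)) t := by
    intro n
    have h0 : (0 : ℝ) ∈ Icc (-(n + 1 : ℝ)) (n + 1) := ⟨by linarith [n.cast_nonneg (α := ℝ)], by positivity⟩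
    have hp : IsPicardLindelof (fun _ => X) (⟨0, h0⟩ : Icc (-(n + 1 : ℝ)) (n + 1)) x
        (B * (n + 1)) 0 B K :=
      { lipschitzOnWith := fun t _ => hK.lipschitzOnWith
        continuousOn := fun x _ => continuousOn_const
        norm_le := fun t _ x _ => hB x
        mul_max_le := by simp }
    exact hp.exists_eq_forall_mem_Icc_hasDerivWithinAt₀
  choose γ hγ0 hγ using loc
  have hd : ∀ n : ℕ, ∀ t ∈ Ioo (-(n + 1 : ℝ)) (n + 1), HasDerivAt (γ n) (X (γ n t)) t :=
    fun n t ht => (hγ n t (Ioo_subset_Icc_self ht)).hasDerivAt (Icc_mem_nhds ht.1 ht.2)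
  have agree : ∀ n m : ℕ, n ≤ m → EqOn (γ n) (γ m) (Ioo (-(n + 1 : ℝ)) (n + 1)) := by
    intro n m hnm
    have hnm' : (n : ℝ) ≤ m := by exact_mod_cast hnm
    refine ODE_solution_unique_of_mem_Ioo (v := fun _ => X) (s := fun _ => univ) (K := K) (t₀ := 0)
      (fun t _ => hK.lipschitzOnWith) ⟨by linarith [n.cast_nonneg (α := ℝ)], by positivity⟩
      (fun t ht => ⟨hd n t ht, trivial⟩) (fun t ht => ⟨hd m t ⟨?_, ?_⟩, trivial⟩) (by rw [hγ0, hγ0])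
    · linarith [ht.1]
    · linarith [ht.2]
  refine ⟨fun t => γ ⌈|t|⌉₊ t, by simp [hγ0], fun t => ?_⟩
  have ht : t ∈ Ioo (-((⌈|t|⌉₊ : ℝ) + 1)) (⌈|t|⌉₊ + 1) := by
    have := Nat.le_ceil |t|
    have := neg_abs_le t
    have := le_abs_self t
    constructor <;> linarith
  refine (hd _ t ht).congr_of_eventuallyEq ?_
  filter_upwards [isOpen_Ioo.mem_nhds ht] with s hs
  have hs' : s ∈ Ioo (-((⌈|s|⌉₊ : ℝ) + 1)) (⌈|s|⌉₊ + 1) := by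
    have := Nat.le_ceil |s|
    have := neg_abs_le s
    have := le_abs_self s
    constructor <;> linarith
  rcases le_total ⌈|s|⌉₊ ⌈|t|⌉₊ with h | h
  · exact agree _ _ h hs'
  · exact (agree _ _ h hs).symm

lemma solution_dist_le {V : Type*} [NormedAddCommGroup V] [NormedSpace ℝ V]
    {X : V → V} {K : NNReal} (hK : LipschitzWith K X) {γ γ' : ℝ → V}
    (h : ∀ t, HasDerivAt γ (X (γ t)) t) (h' : ∀ t, HasDerivAt γ' (X (γ' t)) t) (t : ℝ) :
    dist (γ t) (γ' t) ≤ dist (γ 0) (γ' 0) * Real.exp (K * |t|) := by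
  rcases le_total 0 t with ht | ht
  · have := dist_le_of_trajectories_ODE (v := fun _ => X) (K := K) (fun _ => hK)
      (fun s _ => (h s).continuousAt.continuousWithinAt) (fun s _ => (h s).hasDerivWithinAt)
      (fun s _ => (h' s).continuousAt.continuousWithinAt) (fun s _ => (h' s).hasDerivWithinAt)
      le_rfl t (right_mem_Icc.2 ht)
    simpa [abs_of_nonneg ht] using this
  · have hn : ∀ {δ : ℝ → V}, (∀ t, HasDerivAt δ (X (δ t)) t) →
        ∀ s, HasDerivAt (fun s => δ (-s)) (-X (δ (-s))) s := by
      intro δ hδ s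
      have := (hδ (-s)).scomp s (hasDerivAt_neg s)
      rw [neg_one_smul] at this
      exact this
    have := dist_le_of_trajectories_ODE (v := fun _ x => -X x) (K := K) (fun _ => hK.neg)
      (fun s _ => (hn h s).continuousAt.continuousWithinAt) (fun s _ => (hn h s).hasDerivWithinAt)
      (fun s _ => (hn h' s).continuousAt.continuousWithinAt) (fun s _ => (hn h' s).hasDerivWithinAt)
      le_rfl (-t) (right_mem_Icc.2 (neg_nonneg.2 ht))
    simpa [abs_of_nonpos ht] using this

lemma solution_unique {V : Type*} [NormedAddCommGroup V] [NormedSpace ℝ V]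
    {X : V → V} {K : NNReal} (hK : LipschitzWith K X) {γ γ' : ℝ → V}
    (h : ∀ t, HasDerivAt γ (X (γ t)) t) (h' : ∀ t, HasDerivAt γ' (X (γ' t)) t) {s : ℝ}
    (e : γ s = γ' s) : γ = γ' :=
  ODE_solution_unique_univ (v := fun _ => X) (s := fun _ => univ) (K := K) (t₀ := s)
    (fun _ => hK.lipschitzOnWith) (fun t => ⟨h t, trivial⟩) (fun t => ⟨h' t, trivial⟩) e

lemma exists_lat_add (x : ℝ × ℝ) :
    ∃ (k : ℤ × ℤ) (y : ℝ × ℝ), y ∈ Icc (0 : ℝ × ℝ) 1 ∧ x = y + lat k := by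
  refine ⟨(⌊x.1⌋, ⌊x.2⌋), (Int.fract x.1, Int.fract x.2),
    ⟨⟨Int.fract_nonneg _, Int.fract_nonneg _⟩, ⟨(Int.fract_lt_one _).le, (Int.fract_lt_one _).le⟩⟩, ?_⟩
  ext <;> simp [lat]

lemma lat_add (j k : ℤ × ℤ) : lat (j + k) = lat j + lat k := by ext <;> simp [lat]
lemma lat_neg (k : ℤ × ℤ) : lat (-k) = -lat k := by ext <;> simp [lat]
@[simp] lemma lat_zero : lat 0 = 0 := by ext <;> simp [lat]
lemma lat_zsmul (n : ℤ) (k : ℤ × ℤ) : lat (n • k) = (n : ℝ) • lat k := by ext <;> simp [lat]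

/-- A continuous function on `ℝ² × F`, periodic in the first variable and vanishing outside
a compact set of the second one, is bounded. -/
lemma exists_bound_of_periodic {F G : Type*} [TopologicalSpace F] [NormedAddCommGroup G]
    {f : (ℝ × ℝ) × F → G} (hf : Continuous f)
    (hper : ∀ (k : ℤ × ℤ) x p, f (x + lat k, p) = f (x, p)) {S : Set F} (hS : IsCompact S)
    (h0 : ∀ x p, p ∉ S → f (x, p) = 0) : ∃ C : NNReal, ∀ z, ‖f z‖ ≤ C := by
  obtain ⟨C, hC⟩ := ((isCompact_Icc (a := (0 : ℝ × ℝ)) (b := 1)).prod hS).exists_bound_of_continuousOn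
    hf.continuousOn
  refine ⟨C.toNNReal, fun z => ?_⟩
  obtain ⟨x, p⟩ := z
  by_cases hp : p ∈ S
  · obtain ⟨k, y, hy, rfl⟩ := exists_lat_add x
    rw [hper]
    exact (hC (y, p) ⟨hy, hp⟩).trans (Real.le_coe_toNNReal _)
  · rw [h0 x p hp]; simp

lemma exists_bound_of_periodic' {G : Type*} [NormedAddCommGroup G]
    {f : ℝ × ℝ → G} (hf : Continuous f) (hper : ∀ (k : ℤ × ℤ) x, f (x + lat k) = f x) :
    ∃ C : NNReal, ∀ z, ‖f z‖ ≤ C := by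
  obtain ⟨C, hC⟩ := exists_bound_of_periodic (F := Unit) (f := fun z => f z.1) (by fun_prop)
    (fun k x _ => hper k x) isCompact_univ (by simp)
  exact ⟨C, fun z => hC (z, ())⟩

lemma fderiv_periodic {G : Type*} [NormedAddCommGroup G] [NormedSpace ℝ G]
    {f : ℝ × ℝ → G} (hper : ∀ (k : ℤ × ℤ) x, f (x + lat k) = f x) (k : ℤ × ℤ) (x : ℝ × ℝ) :
    fderiv ℝ f (x + lat k) = fderiv ℝ f x := by
  rw [← fderiv_comp_add_right]
  congr 1
  funext y
  exact hper k y

/-- Periodic smooth functions are bounded with bounded derivative and satisfy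
a uniform second order Taylor estimate. -/
lemma periodic_bounds {f : ℝ × ℝ → ℝ} (hf : ContDiff ℝ 2 f)
    (hper : ∀ (k : ℤ × ℤ) x, f (x + lat k) = f x) :
    ∃ C : ℝ, 0 ≤ C ∧ (∀ x, |f x| ≤ C) ∧ (∀ x, ‖fderiv ℝ f x‖ ≤ C) ∧
      ∀ x y, |f (x + y) - f x - fderiv ℝ f x y| ≤ C * ‖y‖ ^ 2 := by
  have hd : ContDiff ℝ 1 (fderiv ℝ f) := hf.fderiv_right (by norm_num)
  obtain ⟨C0, h0⟩ := exists_bound_of_periodic' hf.continuous hper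
  obtain ⟨C1, h1⟩ := exists_bound_of_periodic' hd.continuous (fderiv_periodic hper)
  obtain ⟨C2, h2⟩ := exists_bound_of_periodic' (hd.continuous_fderiv (by norm_num))
    (fderiv_periodic (fderiv_periodic hper))
  refine ⟨C0 + C1 + C2, by positivity, fun x => (h0 x).trans ?_, fun x => (h1 x).trans ?_,
    fun x y => ?_⟩
  · linarith [C1.2, C2.2]
  · linarith [C0.2, C2.2]
  have hlip : LipschitzWith C2 (fderiv ℝ f) :=
    lipschitzWith_of_nnnorm_fderiv_le (hd.differentiable (by norm_num)) fun x => h2 x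
  have := (convex_segment (𝕜 := ℝ) x (x + y)).norm_image_sub_le_of_norm_fderiv_le' (f := f) (𝕜 := ℝ)
    (φ := fderiv ℝ f x) (C := C2 * ‖y‖) (fun z _ => hf.differentiable (by norm_num) z)
    (fun z hz => by
      refine (hlip.norm_sub_le z x).trans ?_
      gcongr
      rw [segment_eq_image'] at hz
      obtain ⟨θ, hθ, rfl⟩ := hz
      simp only [add_sub_cancel_left, norm_smul]
      rw [Real.norm_of_nonneg hθ.1]
      exact mul_le_of_le_one_left (norm_nonneg _) hθ.2)
    (left_mem_segment ℝ x (x + y)) (right_mem_segment ℝ x (x + y))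
  rw [add_sub_cancel_left] at this
  refine this.trans ?_
  nlinarith [C0.2, C1.2, C2.2, sq_nonneg ‖y‖, mul_nonneg C0.2 (sq_nonneg ‖y‖), mul_nonneg C1.2 (sq_nonneg ‖y‖)]

lemma hasDerivAt_fst_comp {F G : Type*} [NormedAddCommGroup F] [NormedSpace ℝ F]
    [NormedAddCommGroup G] [NormedSpace ℝ G] {c : ℝ → F × G} {c' : F × G} {t : ℝ}
    (h : HasDerivAt c c' t) : HasDerivAt (fun t => (c t).1) c'.1 t :=
  (ContinuousLinearMap.fst ℝ F G).hasFDerivAt.comp_hasDerivAt t h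

lemma hasDerivAt_snd_comp {F G : Type*} [NormedAddCommGroup F] [NormedSpace ℝ F]
    [NormedAddCommGroup G] [NormedSpace ℝ G] {c : ℝ → F × G} {c' : F × G} {t : ℝ}
    (h : HasDerivAt c c' t) : HasDerivAt (fun t => (c t).2) c'.2 t :=
  (ContinuousLinearMap.snd ℝ F G).hasFDerivAt.comp_hasDerivAt t h

namespace TorusMetric

variable (M : TorusMetric)

/-- The entries of the Gram matrix of the metric. -/
def ga (x : ℝ × ℝ) : ℝ := M.g x (1, 0) (1, 0)
/-- The off-diagonal entry of the Gram matrix of the metric. -/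
def gb (x : ℝ × ℝ) : ℝ := M.g x (1, 0) (0, 1)
/-- The second diagonal entry of the Gram matrix of the metric. -/
def gd (x : ℝ × ℝ) : ℝ := M.g x (0, 1) (0, 1)

lemma g_eq (x v w : ℝ × ℝ) : M.g x v w =
    M.ga x * (v.1 * w.1) + M.gb x * (v.1 * w.2 + v.2 * w.1) + M.gd x * (v.2 * w.2) := by
  have key : ∀ u w : ℝ × ℝ, M.g x u w = u.1 * M.g x (1, 0) w + u.2 * M.g x (0, 1) w := by
    intro u w
    have h1 : u = u.1 • (1, 0) + u.2 • ((0, 1) : ℝ × ℝ) := by ext <;> simp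
    conv_lhs => rw [h1, (M.linear x w).map_add, (M.linear x w).map_smul, (M.linear x w).map_smul]
    simp
  rw [key, M.symm x (1, 0) w, M.symm x (0, 1) w, key w, key w, M.symm x (0, 1) (1, 0)]
  simp only [ga, gb, gd]
  ring

lemma contDiff_g (v w : ℝ × ℝ) : ContDiff ℝ (⊤ : ℕ∞) fun x => M.g x v w :=
  M.smooth.comp (contDiff_id.prodMk (contDiff_const (c := (v, w))))

lemma contDiff_ga : ContDiff ℝ (⊤ : ℕ∞) M.ga := M.contDiff_g _ _
lemma contDiff_gb : ContDiff ℝ (⊤ : ℕ∞) M.gb := M.contDiff_g _ _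
lemma contDiff_gd : ContDiff ℝ (⊤ : ℕ∞) M.gd := M.contDiff_g _ _

lemma ga_per (k : ℤ × ℤ) (x : ℝ × ℝ) : M.ga (x + lat k) = M.ga x := M.periodic _ _ _ _
lemma gb_per (k : ℤ × ℤ) (x : ℝ × ℝ) : M.gb (x + lat k) = M.gb x := M.periodic _ _ _ _
lemma gd_per (k : ℤ × ℤ) (x : ℝ × ℝ) : M.gd (x + lat k) = M.gd x := M.periodic _ _ _ _

lemma ga_pos (x : ℝ × ℝ) : 0 < M.ga x := M.posdef x _ (by simp)

/-- The Gram determinant. -/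
def gΔ (x : ℝ × ℝ) : ℝ := M.ga x * M.gd x - M.gb x ^ 2

lemma gΔ_pos (x : ℝ × ℝ) : 0 < M.gΔ x := by
  have h := M.posdef x (-M.gb x, M.ga x) (by simp [(M.ga_pos x).ne'])
  rw [g_eq] at h
  have : 0 < M.ga x * M.gΔ x := by unfold gΔ; simp only at h; nlinarith
  exact pos_of_mul_pos_right this (M.ga_pos x).le

/-- The derivative of the metric in the direction `η`. -/
def Dg (x η v w : ℝ × ℝ) : ℝ :=
  fderiv ℝ M.ga x η * (v.1 * w.1) + fderiv ℝ M.gb x η * (v.1 * w.2 + v.2 * w.1) +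
    fderiv ℝ M.gd x η * (v.2 * w.2)

/-- The momentum of a tangent vector. -/
def mom (x v : ℝ × ℝ) : ℝ × ℝ :=
  (M.ga x * v.1 + M.gb x * v.2, M.gb x * v.1 + M.gd x * v.2)

/-- The velocity of a covector. -/
def vel (z : (ℝ × ℝ) × (ℝ × ℝ)) : ℝ × ℝ :=
  ((M.gd z.1 * z.2.1 - M.gb z.1 * z.2.2) / M.gΔ z.1,
    (M.ga z.1 * z.2.2 - M.gb z.1 * z.2.1) / M.gΔ z.1)

/-- The force term of the Hamiltonian system. -/
def force (z : (ℝ × ℝ) × (ℝ × ℝ)) : ℝ × ℝ :=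
  (M.Dg z.1 (1, 0) (M.vel z) (M.vel z) / 2, M.Dg z.1 (0, 1) (M.vel z) (M.vel z) / 2)

/-- Twice the kinetic energy. -/
def en (z : (ℝ × ℝ) × (ℝ × ℝ)) : ℝ := z.2.1 * (M.vel z).1 + z.2.2 * (M.vel z).2

/-- The Hamiltonian vector field of the geodesic flow. -/
def ham (z : (ℝ × ℝ) × (ℝ × ℝ)) : (ℝ × ℝ) × (ℝ × ℝ) := (M.vel z, M.force z)

lemma vel_mom (x v : ℝ × ℝ) : M.vel (x, M.mom x v) = v := by
  have := (M.gΔ_pos x).ne'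
  ext
  · simp only [vel, mom]; field_simp; unfold gΔ; ring
  · simp only [vel, mom]; field_simp; unfold gΔ; ring

lemma mom_vel (z : (ℝ × ℝ) × (ℝ × ℝ)) : M.mom z.1 (M.vel z) = z.2 := by
  have := (M.gΔ_pos z.1).ne'
  ext
  · simp only [vel, mom]; field_simp; unfold gΔ; ring
  · simp only [vel, mom]; field_simp; unfold gΔ; ring

lemma g_eq_mom (x v w : ℝ × ℝ) : M.g x v w = (M.mom x v).1 * w.1 + (M.mom x v).2 * w.2 := by
  rw [g_eq]; simp only [mom]; ring

lemma en_eq (z : (ℝ × ℝ) × (ℝ × ℝ)) : M.en z = M.g z.1 (M.vel z) (M.vel z) := by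
  rw [g_eq_mom, mom_vel]; rfl

lemma en_mom (x v : ℝ × ℝ) : M.en (x, M.mom x v) = M.g x v v := by
  rw [en_eq, vel_mom]

lemma contDiff_gΔ : ContDiff ℝ (⊤ : ℕ∞) M.gΔ := by
  unfold gΔ
  exact (M.contDiff_ga.mul M.contDiff_gd).sub (M.contDiff_gb.pow 2)

lemma contDiff_vel : ContDiff ℝ (⊤ : ℕ∞) M.vel := by
  have h1 := M.contDiff_ga.comp (contDiff_fst (𝕜 := ℝ) (E := ℝ × ℝ) (F := ℝ × ℝ))
  have h2 := M.contDiff_gb.comp (contDiff_fst (𝕜 := ℝ) (E := ℝ × ℝ) (F := ℝ × ℝ))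
  have h3 := M.contDiff_gd.comp (contDiff_fst (𝕜 := ℝ) (E := ℝ × ℝ) (F := ℝ × ℝ))
  have h4 := M.contDiff_gΔ.comp (contDiff_fst (𝕜 := ℝ) (E := ℝ × ℝ) (F := ℝ × ℝ))
  have p1 : ContDiff ℝ (⊤ : ℕ∞) fun z : (ℝ × ℝ) × (ℝ × ℝ) => z.2.1 := by fun_prop
  have p2 : ContDiff ℝ (⊤ : ℕ∞) fun z : (ℝ × ℝ) × (ℝ × ℝ) => z.2.2 := by fun_prop
  exact (((h3.mul p1).sub (h2.mul p2)).div h4 fun z => (M.gΔ_pos z.1).ne').prodMk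
    (((h1.mul p2).sub (h2.mul p1)).div h4 fun z => (M.gΔ_pos z.1).ne')

lemma contDiff_Dg (η : ℝ × ℝ) : ContDiff ℝ (⊤ : ℕ∞)
    fun z : (ℝ × ℝ) × (ℝ × ℝ) => M.Dg z.1 η z.2 z.2 := by
  have d : ∀ {f : ℝ × ℝ → ℝ}, ContDiff ℝ (⊤ : ℕ∞) f →
      ContDiff ℝ (⊤ : ℕ∞) fun z : (ℝ × ℝ) × (ℝ × ℝ) => fderiv ℝ f z.1 η := by
    intro f hf
    exact ((hf.fderiv_right (m := (⊤ : ℕ∞)) (by norm_cast)).clm_apply contDiff_const).comp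
      contDiff_fst
  have h1 := d M.contDiff_ga
  have h2 := d M.contDiff_gb
  have h3 := d M.contDiff_gd
  unfold Dg
  exact ((h1.mul (by fun_prop)).add (h2.mul (by fun_prop))).add (h3.mul (by fun_prop))

lemma contDiff_force : ContDiff ℝ (⊤ : ℕ∞) M.force :=
  (((M.contDiff_Dg (1, 0)).comp (contDiff_fst.prodMk M.contDiff_vel)).div_const 2).prodMk
    (((M.contDiff_Dg (0, 1)).comp (contDiff_fst.prodMk M.contDiff_vel)).div_const 2)

lemma contDiff_ham : ContDiff ℝ (⊤ : ℕ∞) M.ham := M.contDiff_vel.prodMk M.contDiff_force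

lemma contDiff_en : ContDiff ℝ (⊤ : ℕ∞) M.en := by
  have h1 := contDiff_fst.comp M.contDiff_vel
  have h2 := contDiff_snd.comp M.contDiff_vel
  have p1 : ContDiff ℝ (⊤ : ℕ∞) fun z : (ℝ × ℝ) × (ℝ × ℝ) => z.2.1 := by fun_prop
  have p2 : ContDiff ℝ (⊤ : ℕ∞) fun z : (ℝ × ℝ) × (ℝ × ℝ) => z.2.2 := by fun_prop
  exact (p1.mul h1).add (p2.mul h2)

lemma gΔ_per (k : ℤ × ℤ) (x : ℝ × ℝ) : M.gΔ (x + lat k) = M.gΔ x := by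
  simp [gΔ, ga_per, gb_per, gd_per]

lemma vel_per (k : ℤ × ℤ) (x p : ℝ × ℝ) : M.vel (x + lat k, p) = M.vel (x, p) := by
  simp [vel, ga_per, gb_per, gd_per, gΔ_per]

lemma en_per (k : ℤ × ℤ) (x p : ℝ × ℝ) : M.en (x + lat k, p) = M.en (x, p) := by
  simp [en, vel_per]

lemma Dg_per (k : ℤ × ℤ) (x η v w : ℝ × ℝ) : M.Dg (x + lat k) η v w = M.Dg x η v w := by
  simp [Dg, fderiv_periodic M.ga_per, fderiv_periodic M.gb_per, fderiv_periodic M.gd_per]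

lemma ham_per (k : ℤ × ℤ) (x p : ℝ × ℝ) : M.ham (x + lat k, p) = M.ham (x, p) := by
  simp [ham, force, vel_per, Dg_per]

lemma hasDerivAt_g {q v w : ℝ → ℝ × ℝ} {q' v' w' : ℝ × ℝ} {t : ℝ} (hq : HasDerivAt q q' t)
    (hv : HasDerivAt v v' t) (hw : HasDerivAt w w' t) :
    HasDerivAt (fun t => M.g (q t) (v t) (w t))
      (M.Dg (q t) q' (v t) (w t) + M.g (q t) v' (w t) + M.g (q t) (v t) w') t := by
  have d : ∀ {f : ℝ × ℝ → ℝ}, ContDiff ℝ (⊤ : ℕ∞) f →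
      HasDerivAt (fun t => f (q t)) (fderiv ℝ f (q t) q') t := fun hf =>
    ((hf.differentiable (by simp)) (q t)).hasFDerivAt.comp_hasDerivAt t hq
  have h1 := d M.contDiff_ga
  have h2 := d M.contDiff_gb
  have h3 := d M.contDiff_gd
  have v1 : HasDerivAt (fun t => (v t).1) v'.1 t := hasDerivAt_fst_comp hv
  have v2 : HasDerivAt (fun t => (v t).2) v'.2 t := hasDerivAt_snd_comp hv
  have w1 : HasDerivAt (fun t => (w t).1) w'.1 t := hasDerivAt_fst_comp hw
  have w2 : HasDerivAt (fun t => (w t).2) w'.2 t := hasDerivAt_snd_comp hw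
  have := ((h1.mul (v1.mul w1)).add (h2.mul ((v1.mul w2).add (v2.mul w1)))).add (h3.mul (v2.mul w2))
  refine (this.congr_deriv ?_).congr_of_eventuallyEq (Eventually.of_forall fun s => ?_)
  · simp only [g_eq, Dg, Pi.mul_apply, Pi.add_apply]
    ring
  · simp only [g_eq, Pi.mul_apply, Pi.add_apply]

lemma Dg_eq_force (z : (ℝ × ℝ) × (ℝ × ℝ)) (η : ℝ × ℝ) :
    M.Dg z.1 η (M.vel z) (M.vel z) = 2 * ((M.force z).1 * η.1 + (M.force z).2 * η.2) := by
  have key : ∀ L : ℝ × ℝ →L[ℝ] ℝ, L η = L (1, 0) * η.1 + L (0, 1) * η.2 := by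
    intro L
    have h1 : η = η.1 • (1, 0) + η.2 • ((0, 1) : ℝ × ℝ) := by ext <;> simp
    conv_lhs => rw [h1, map_add, map_smul, map_smul]
    simp [mul_comm]
  simp only [force, Dg]
  rw [key (fderiv ℝ M.ga z.1), key (fderiv ℝ M.gb z.1), key (fderiv ℝ M.gd z.1)]
  ring

/-- The derivative of the energy along an arbitrary curve. -/
lemma hasDerivAt_en {z : ℝ → (ℝ × ℝ) × (ℝ × ℝ)} {z' : (ℝ × ℝ) × (ℝ × ℝ)} {t : ℝ}
    (hz : HasDerivAt z z' t) :
    HasDerivAt (fun t => M.en (z t)) (2 * (z'.2.1 * (M.vel (z t)).1 + z'.2.2 * (M.vel (z t)).2) -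
      2 * ((M.force (z t)).1 * z'.1.1 + (M.force (z t)).2 * z'.1.2)) t := by
  have hv : HasDerivAt (fun t => M.vel (z t)) (fderiv ℝ M.vel (z t) z') t :=
    ((M.contDiff_vel.differentiable (by simp)) (z t)).hasFDerivAt.comp_hasDerivAt t hz
  set v' := fderiv ℝ M.vel (z t) z'
  have hq : HasDerivAt (fun t => (z t).1) z'.1 t := hasDerivAt_fst_comp hz
  have hp : HasDerivAt (fun t => (z t).2) z'.2 t := hasDerivAt_snd_comp hz
  have p1 : HasDerivAt (fun t => (z t).2.1) z'.2.1 t := hasDerivAt_fst_comp hp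
  have p2 : HasDerivAt (fun t => (z t).2.2) z'.2.2 t := hasDerivAt_snd_comp hp
  have v1 : HasDerivAt (fun t => (M.vel (z t)).1) v'.1 t := hasDerivAt_fst_comp hv
  have v2 : HasDerivAt (fun t => (M.vel (z t)).2) v'.2 t := hasDerivAt_snd_comp hv
  have e1 := (p1.mul v1).add (p2.mul v2)
  have e2 := M.hasDerivAt_g hq hv hv
  have e1' : HasDerivAt (fun t => M.en (z t)) _ t := e1
  have e2' : HasDerivAt (fun t => M.en (z t)) _ t :=
    e2.congr_of_eventuallyEq (Eventually.of_forall fun s => M.en_eq (z s))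
  have e3 := e1'.unique e2'
  refine e1'.congr_deriv ?_
  rw [M.symm _ v', g_eq_mom, mom_vel, Dg_eq_force] at e3
  linarith

end TorusMetric

namespace TorusMetric

variable (M : TorusMetric)

lemma continuous_g : Continuous fun p : (ℝ × ℝ) × (ℝ × ℝ) × (ℝ × ℝ) => M.g p.1 p.2.1 p.2.2 :=
  M.smooth.continuous

@[simp] lemma g_smul_smul (x v w : ℝ × ℝ) (r s : ℝ) : M.g x (r • v) (s • w) = r * s * M.g x v w := by
  simp only [g_eq, Prod.smul_fst, Prod.smul_snd, smul_eq_mul]; ring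

lemma g_add_add (x v w : ℝ × ℝ) :
    M.g x (v + w) (v + w) = M.g x v v + 2 * M.g x v w + M.g x w w := by
  simp only [g_eq, Prod.fst_add, Prod.snd_add]; ring

lemma g_self_nonneg (x v : ℝ × ℝ) : 0 ≤ M.g x v v := by
  rcases eq_or_ne v 0 with rfl | h
  · simp [g_eq]
  · exact (M.posdef x v h).le

lemma exists_lower : ∃ c : ℝ, 0 < c ∧ ∀ x v : ℝ × ℝ, c * ‖v‖ ^ 2 ≤ M.g x v v := by
  have hcont : Continuous fun p : (ℝ × ℝ) × (ℝ × ℝ) => M.g p.1 p.2 p.2 :=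
    M.continuous_g.comp (continuous_fst.prodMk (continuous_snd.prodMk continuous_snd))
  have hK : IsCompact (Icc (0 : ℝ × ℝ) 1 ×ˢ Metric.sphere (0 : ℝ × ℝ) 1) :=
    isCompact_Icc.prod (isCompact_sphere _ _)
  obtain ⟨⟨x0, v0⟩, ⟨hx0, hv0⟩, hmin⟩ := hK.exists_isMinOn
    ⟨(0, (1, 0)), ⟨left_mem_Icc.2 zero_le_one, by simp [Prod.norm_def]⟩⟩ hcont.continuousOn
  have hv0' : v0 ≠ 0 := by
    rintro rfl; simp at hv0
  refine ⟨M.g x0 v0 v0, M.posdef _ _ hv0', fun x v => ?_⟩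
  rcases eq_or_ne v 0 with rfl | hv
  · simp [g_eq]
  obtain ⟨k, y, hy, rfl⟩ := exists_lat_add x
  rw [M.periodic]
  have hn := norm_pos_iff.2 hv
  have h1 : M.g x0 v0 v0 ≤ M.g y (‖v‖⁻¹ • v) (‖v‖⁻¹ • v) := by
    have hm : (y, ‖v‖⁻¹ • v) ∈ Icc (0 : ℝ × ℝ) 1 ×ˢ Metric.sphere (0 : ℝ × ℝ) 1 :=
      ⟨hy, by simp [norm_smul, hn.ne']⟩
    exact hmin hm
  rw [g_smul_smul] at h1
  calc M.g x0 v0 v0 * ‖v‖ ^ 2 ≤ ‖v‖⁻¹ * ‖v‖⁻¹ * M.g y v v * ‖v‖ ^ 2 := by gcongr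
    _ = M.g y v v := by field_simp

lemma quad_bound {C a b d : ℝ} (ha : |a| ≤ C) (hb : |b| ≤ C) (hd : |d| ≤ C) (v w : ℝ × ℝ) :
    |a * (v.1 * w.1) + b * (v.1 * w.2 + v.2 * w.1) + d * (v.2 * w.2)| ≤ 4 * C * (‖v‖ * ‖w‖) := by
  have hC : 0 ≤ C := (abs_nonneg a).trans ha
  have n1 : ∀ u : ℝ × ℝ, |u.1| ≤ ‖u‖ := fun u => norm_fst_le u
  have n2 : ∀ u : ℝ × ℝ, |u.2| ≤ ‖u‖ := fun u => norm_snd_le u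
  have m : ∀ {x y e : ℝ}, |e| ≤ C → |x| ≤ ‖v‖ → |y| ≤ ‖w‖ → |e * (x * y)| ≤ C * (‖v‖ * ‖w‖) := by
    intro x y e he hx hy
    rw [abs_mul, abs_mul]
    gcongr
  have h1 := m ha (n1 v) (n1 w)
  have h2 := m hb (n1 v) (n2 w)
  have h3 := m hb (n2 v) (n1 w)
  have h4 := m hd (n2 v) (n2 w)
  rw [abs_le] at *
  constructor <;> nlinarith

lemma exists_consts : ∃ c C : ℝ, 0 < c ∧ c ≤ 1 ∧ 1 ≤ C ∧
    (∀ x v : ℝ × ℝ, c * ‖v‖ ^ 2 ≤ M.g x v v) ∧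
    (∀ x v w : ℝ × ℝ, |M.g x v w| ≤ C * (‖v‖ * ‖w‖)) ∧
    (∀ x η v w : ℝ × ℝ, |M.Dg x η v w| ≤ C * ‖η‖ * (‖v‖ * ‖w‖)) ∧
    (∀ x η v : ℝ × ℝ, |M.g (x + η) v v - M.g x v v - M.Dg x η v v| ≤ C * ‖η‖ ^ 2 * ‖v‖ ^ 2) := by
  obtain ⟨c, hc, hlow⟩ := M.exists_lower
  obtain ⟨C1, h1, a1, b1, d1⟩ := periodic_bounds (M.contDiff_ga.of_le (by norm_cast)) M.ga_per
  obtain ⟨C2, h2, a2, b2, d2⟩ := periodic_bounds (M.contDiff_gb.of_le (by norm_cast)) M.gb_per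
  obtain ⟨C3, h3, a3, b3, d3⟩ := periodic_bounds (M.contDiff_gd.of_le (by norm_cast)) M.gd_per
  set S := C1 + C2 + C3
  have s1 : C1 ≤ S := by simp only [S]; linarith
  have s2 : C2 ≤ S := by simp only [S]; linarith
  have s3 : C3 ≤ S := by simp only [S]; linarith
  have hS : 0 ≤ S := by simp only [S]; linarith
  refine ⟨min c 1, 4 * S + 1, by positivity, min_le_right _ _, by linarith, ?_, ?_, ?_, ?_⟩
  · intro x v
    exact (mul_le_mul_of_nonneg_right (min_le_left _ _) (by positivity)).trans (hlow x v)
  · intro x v w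
    rw [g_eq]
    refine (quad_bound ((a1 x).trans s1) ((a2 x).trans s2) ((a3 x).trans s3) v w).trans ?_
    gcongr; linarith
  · intro x η v w
    have l : ∀ {f : ℝ × ℝ → ℝ} {C : ℝ}, ‖fderiv ℝ f x‖ ≤ C → C ≤ S →
        |fderiv ℝ f x η| ≤ S * ‖η‖ := fun h h' =>
      ((fderiv ℝ _ x).le_opNorm η).trans (mul_le_mul_of_nonneg_right (h.trans h') (norm_nonneg _))
    refine (quad_bound (l (b1 x) s1) (l (b2 x) s2) (l (b3 x) s3) v w).trans ?_
    have : 0 ≤ ‖η‖ * (‖v‖ * ‖w‖) := by positivity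
    nlinarith
  · intro x η v
    have l : ∀ {r C : ℝ}, |r| ≤ C * ‖η‖ ^ 2 → C ≤ S → |r| ≤ S * ‖η‖ ^ 2 := fun h h' =>
      h.trans (by gcongr)
    have := quad_bound (l (d1 x η) s1) (l (d2 x η) s2) (l (d3 x η) s3) v v
    have e : M.g (x + η) v v - M.g x v v - M.Dg x η v v =
      (M.ga (x + η) - M.ga x - fderiv ℝ M.ga x η) * (v.1 * v.1) +
      (M.gb (x + η) - M.gb x - fderiv ℝ M.gb x η) * (v.1 * v.2 + v.2 * v.1) +
      (M.gd (x + η) - M.gd x - fderiv ℝ M.gd x η) * (v.2 * v.2) := by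
      simp only [g_eq, Dg]; ring
    rw [e]
    refine this.trans ?_
    have : 0 ≤ ‖η‖ ^ 2 * ‖v‖ ^ 2 := by positivity
    nlinarith

/-- A lower ellipticity constant of the metric. -/
def cl : ℝ := M.exists_consts.choose
/-- A common upper bound for the metric and its derivatives. -/
def cu : ℝ := M.exists_consts.choose_spec.choose

lemma cl_pos : 0 < M.cl := M.exists_consts.choose_spec.choose_spec.1
lemma cl_le_one : M.cl ≤ 1 := M.exists_consts.choose_spec.choose_spec.2.1
lemma one_le_cu : 1 ≤ M.cu := M.exists_consts.choose_spec.choose_spec.2.2.1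
lemma cu_pos : 0 < M.cu := zero_lt_one.trans_le M.one_le_cu
lemma cl_le_g : ∀ x v : ℝ × ℝ, M.cl * ‖v‖ ^ 2 ≤ M.g x v v :=
  M.exists_consts.choose_spec.choose_spec.2.2.2.1
lemma abs_g_le : ∀ x v w : ℝ × ℝ, |M.g x v w| ≤ M.cu * (‖v‖ * ‖w‖) :=
  M.exists_consts.choose_spec.choose_spec.2.2.2.2.1
lemma abs_Dg_le : ∀ x η v w : ℝ × ℝ, |M.Dg x η v w| ≤ M.cu * ‖η‖ * (‖v‖ * ‖w‖) :=
  M.exists_consts.choose_spec.choose_spec.2.2.2.2.2.1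
lemma abs_g_taylor_le : ∀ x η v : ℝ × ℝ,
    |M.g (x + η) v v - M.g x v v - M.Dg x η v v| ≤ M.cu * ‖η‖ ^ 2 * ‖v‖ ^ 2 :=
  M.exists_consts.choose_spec.choose_spec.2.2.2.2.2.2

lemma norm_mom_le (x v : ℝ × ℝ) : ‖M.mom x v‖ ≤ M.cu * ‖v‖ := by
  have h1 := M.abs_g_le x v (1, 0)
  have h2 := M.abs_g_le x v (0, 1)
  rw [g_eq_mom] at h1 h2
  simp [Prod.norm_def] at h1 h2
  simp only [Prod.norm_def, Real.norm_eq_abs]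
  exact max_le h1 h2

lemma norm_vel_sq_le (z : (ℝ × ℝ) × (ℝ × ℝ)) : M.cl * ‖M.vel z‖ ^ 2 ≤ M.en z := by
  rw [en_eq]; exact M.cl_le_g _ _

lemma norm_snd_sq_le (z : (ℝ × ℝ) × (ℝ × ℝ)) : M.cl * ‖z.2‖ ^ 2 ≤ M.cu ^ 2 * M.en z := by
  have h1 : ‖z.2‖ ≤ M.cu * ‖M.vel z‖ := by
    have := M.norm_mom_le z.1 (M.vel z)
    rwa [mom_vel] at this
  have h2 := M.norm_vel_sq_le z
  have := M.cl_pos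
  calc M.cl * ‖z.2‖ ^ 2 ≤ M.cl * (M.cu * ‖M.vel z‖) ^ 2 := by gcongr
    _ = M.cu ^ 2 * (M.cl * ‖M.vel z‖ ^ 2) := by ring
    _ ≤ _ := by gcongr

/-- The Hamiltonian vector field, cut off at high energies. -/
def cham (z : (ℝ × ℝ) × (ℝ × ℝ)) : (ℝ × ℝ) × (ℝ × ℝ) :=
  Real.smoothTransition (5 - M.en z) • M.ham z

lemma contDiff_cham : ContDiff ℝ (⊤ : ℕ∞) M.cham :=
  (Real.smoothTransition.contDiff.comp (contDiff_const.sub M.contDiff_en)).smul M.contDiff_ham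

lemma cham_per (k : ℤ × ℤ) (x p : ℝ × ℝ) : M.cham (x + lat k, p) = M.cham (x, p) := by
  simp [cham, en_per, ham_per]

lemma cham_eq_ham {z : (ℝ × ℝ) × (ℝ × ℝ)} (h : M.en z ≤ 4) : M.cham z = M.ham z := by
  rw [cham, Real.smoothTransition.one_of_one_le (by linarith), one_smul]

lemma cham_eq_zero {z : (ℝ × ℝ) × (ℝ × ℝ)} (h : 5 ≤ M.en z) : M.cham z = 0 := by
  rw [cham, Real.smoothTransition.zero_of_nonpos (by linarith), zero_smul]

/-- A radius in momentum space beyond which the cut off vector field vanishes. -/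
def prad : ℝ := 5 * M.cu ^ 2 / M.cl

lemma cham_eq_zero_of_prad {x p : ℝ × ℝ} (h : M.prad ≤ ‖p‖) : M.cham (x, p) = 0 := by
  apply cham_eq_zero
  have h1 := M.norm_snd_sq_le (x, p)
  have h0 := M.cl_pos
  have hc := M.one_le_cu
  have h2 : 5 * M.cu ^ 2 ≤ ‖p‖ * M.cl := (div_le_iff₀ h0).1 h
  have h3 : 1 ≤ ‖p‖ := by
    nlinarith [mul_le_mul_of_nonneg_left M.cl_le_one (norm_nonneg p)]
  have : M.cu ^ 2 * 5 ≤ M.cu ^ 2 * M.en (x, p) := by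
    calc M.cu ^ 2 * 5 ≤ ‖p‖ * M.cl := by linarith
      _ ≤ M.cl * ‖p‖ ^ 2 := by nlinarith [mul_nonneg h0.le (norm_nonneg p)]
      _ ≤ _ := h1
  exact le_of_mul_le_mul_left this (by positivity)

lemma fderiv_cham_bounded : ∃ K : NNReal, ∀ z, ‖fderiv ℝ M.cham z‖ ≤ K := by
  refine exists_bound_of_periodic (M.contDiff_cham.continuous_fderiv (by simp)) ?_
    (isCompact_closedBall (0 : ℝ × ℝ) M.prad) ?_
  · intro k x p
    have := fderiv_comp_add_right (𝕜 := ℝ) (f := M.cham) (x := (x, p)) (lat k, 0)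
    rw [Prod.mk_add_mk, add_zero] at this
    rw [← this]
    congr 1
    funext y
    obtain ⟨y1, y2⟩ := y
    simp [cham_per]
  · intro x p hp
    have hp' : M.prad < ‖p‖ := by simpa using hp
    have : M.cham =ᶠ[𝓝 (x, p)] fun _ => 0 := by
      have : ∀ᶠ z : (ℝ × ℝ) × (ℝ × ℝ) in 𝓝 (x, p), M.prad < ‖z.2‖ :=
        (continuous_snd.norm.tendsto (x, p)).eventually (lt_mem_nhds hp')
      filter_upwards [this] with z hz
      exact M.cham_eq_zero_of_prad (x := z.1) hz.le
    rw [this.fderiv_eq]; simp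

/-- A Lipschitz constant for the cut off vector field. -/
def lipK : NNReal := M.fderiv_cham_bounded.choose

lemma norm_fderiv_cham_le (z) : ‖fderiv ℝ M.cham z‖ ≤ M.lipK := M.fderiv_cham_bounded.choose_spec z

lemma lipschitz_cham : LipschitzWith M.lipK M.cham :=
  lipschitzWith_of_nnnorm_fderiv_le (M.contDiff_cham.differentiable (by simp))
    fun z => M.norm_fderiv_cham_le z

lemma cham_bounded : ∃ B : NNReal, ∀ z, ‖M.cham z‖ ≤ B :=
  exists_bound_of_periodic M.contDiff_cham.continuous M.cham_per
    (isCompact_closedBall (0 : ℝ × ℝ) M.prad)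
    fun x p hp => M.cham_eq_zero_of_prad (le_of_lt (by simpa using hp))

/-- The flow of the cut off Hamiltonian vector field. -/
def flow (z : (ℝ × ℝ) × (ℝ × ℝ)) : ℝ → (ℝ × ℝ) × (ℝ × ℝ) :=
  (exists_global_solution M.lipschitz_cham M.cham_bounded.choose_spec z).choose

@[simp] lemma flow_zero (z) : M.flow z 0 = z :=
  (exists_global_solution M.lipschitz_cham M.cham_bounded.choose_spec z).choose_spec.1

lemma hasDerivAt_flow (z t) : HasDerivAt (M.flow z) (M.cham (M.flow z t)) t :=
  (exists_global_solution M.lipschitz_cham M.cham_bounded.choose_spec z).choose_spec.2 t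

lemma dist_flow_le (z z' t) :
    Dist.dist (M.flow z t) (M.flow z' t) ≤ Dist.dist z z' * Real.exp (M.lipK * |t|) := by
  simpa using solution_dist_le M.lipschitz_cham (M.hasDerivAt_flow z) (M.hasDerivAt_flow z') t

lemma eq_flow {γ : ℝ → (ℝ × ℝ) × (ℝ × ℝ)} (h : ∀ t, HasDerivAt γ (M.cham (γ t)) t) :
    γ = M.flow (γ 0) :=
  solution_unique M.lipschitz_cham h (M.hasDerivAt_flow _) (s := 0) (by simp)

lemma flow_add (z s t) : M.flow z (s + t) = M.flow (M.flow z s) t := by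
  have := M.eq_flow (γ := fun t => M.flow z (s + t)) fun t => by
    simpa using (M.hasDerivAt_flow z (s + t)).comp_const_add s t
  simpa using congrFun this t

lemma flow_per (k : ℤ × ℤ) (z t) : M.flow (z + (lat k, 0)) t = M.flow z t + (lat k, 0) := by
  have := M.eq_flow (γ := fun t => M.flow z t + (lat k, 0)) fun t => by
    have h := (M.hasDerivAt_flow z t).add_const (lat k, (0 : ℝ × ℝ))
    refine h.congr_deriv ?_
    obtain ⟨a, b⟩ := M.flow z t
    simp [cham_per]
  simpa using (congrFun this t).symm

lemma en_flow (z t) : M.en (M.flow z t) = M.en z := by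
  have h : ∀ t, HasDerivAt (fun t => M.en (M.flow z t)) 0 t := fun t => by
    refine (M.hasDerivAt_en (M.hasDerivAt_flow z t)).congr_deriv ?_
    simp only [cham, ham, Prod.smul_fst, Prod.smul_snd, smul_eq_mul]
    ring
  have := is_const_of_deriv_eq_zero (fun t => (h t).differentiableAt) (fun t => (h t).deriv) t 0
  simpa using this

end TorusMetric

namespace TorusMetric

variable {M : TorusMetric}

lemma hasDerivAt_flow_ham {z : (ℝ × ℝ) × (ℝ × ℝ)} (h : M.en z ≤ 4) (t : ℝ) :
    HasDerivAt (M.flow z) (M.ham (M.flow z t)) t := by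
  have := M.hasDerivAt_flow z t
  rwa [cham_eq_ham] at this
  rwa [en_flow]

lemma en_eq_of_sol {γ : ℝ → (ℝ × ℝ) × (ℝ × ℝ)} (h : ∀ t, HasDerivAt γ (M.ham (γ t)) t) (t : ℝ) :
    M.en (γ t) = M.en (γ 0) := by
  have h' : ∀ t, HasDerivAt (fun t => M.en (γ t)) 0 t := fun t => by
    refine (M.hasDerivAt_en (h t)).congr_deriv ?_
    simp only [ham]; ring
  exact is_const_of_deriv_eq_zero (fun t => (h' t).differentiableAt) (fun t => (h' t).deriv) t 0

lemma eq_flow_of_sol {γ : ℝ → (ℝ × ℝ) × (ℝ × ℝ)} (h : ∀ t, HasDerivAt γ (M.ham (γ t)) t)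
    (h0 : M.en (γ 0) ≤ 4) : γ = M.flow (γ 0) := by
  refine M.eq_flow fun t => ?_
  rw [cham_eq_ham]
  · exact h t
  · rwa [en_eq_of_sol h]

lemma vel_smul (x p : ℝ × ℝ) (s : ℝ) : M.vel (x, s • p) = s • M.vel (x, p) := by
  ext <;> simp only [vel, Prod.smul_fst, Prod.smul_snd, smul_eq_mul] <;> ring

lemma en_smul (x p : ℝ × ℝ) (s : ℝ) : M.en (x, s • p) = s ^ 2 * M.en (x, p) := by
  simp only [en, vel_smul, Prod.smul_fst, Prod.smul_snd, smul_eq_mul]; ring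

lemma force_smul (x p : ℝ × ℝ) (s : ℝ) : M.force (x, s • p) = s ^ 2 • M.force (x, p) := by
  ext <;> simp only [force, Dg, vel_smul, Prod.smul_fst, Prod.smul_snd, smul_eq_mul] <;> ring

lemma sol_scale {γ : ℝ → (ℝ × ℝ) × (ℝ × ℝ)} (h : ∀ t, HasDerivAt γ (M.ham (γ t)) t) (s t : ℝ) :
    HasDerivAt (fun t => ((γ (s * t)).1, s • (γ (s * t)).2))
      (M.ham ((γ (s * t)).1, s • (γ (s * t)).2)) t := by
  have h1 : HasDerivAt (fun t => γ (s * t)) (s • M.ham (γ (s * t))) t := by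
    have := (h (s * t)).scomp t ((hasDerivAt_id t).const_mul s)
    simpa [Function.comp_def] using this
  have h2 := (hasDerivAt_fst_comp h1).prodMk ((hasDerivAt_snd_comp h1).const_smul s)
  refine h2.congr_deriv ?_
  simp only [ham, vel_smul, force_smul, Prod.smul_mk]
  rw [smul_smul, sq]

/-- Complete unit speed geodesics, as projections of orbits of the Hamiltonian flow. -/
def UG (M : TorusMetric) (c : ℝ → ℝ × ℝ) : Prop :=
  ∃ z : (ℝ × ℝ) × (ℝ × ℝ), M.en z = 1 ∧ ∀ t, c t = (M.flow z t).1

/-- The phase curve of a curve. -/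
def ph (M : TorusMetric) (c : ℝ → ℝ × ℝ) (t : ℝ) : (ℝ × ℝ) × (ℝ × ℝ) :=
  (c t, M.mom (c t) (deriv c t))

lemma ph_of_hasDerivAt {z : ℝ → (ℝ × ℝ) × (ℝ × ℝ)} {c : ℝ → ℝ × ℝ} {t : ℝ}
    (h : HasDerivAt z (M.ham (z t)) t) (hc : ∀ t, c t = (z t).1) : M.ph c t = z t := by
  obtain rfl : c = fun t => (z t).1 := funext hc
  have := (hasDerivAt_fst_comp h).deriv
  simp only [ph, this, ham, mom_vel]

lemma UG.ph_eq {c : ℝ → ℝ × ℝ} (hc : M.UG c) (t : ℝ) : M.ph c t = M.flow (M.ph c 0) t := by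
  obtain ⟨z, hz, h⟩ := hc
  have := fun t => ph_of_hasDerivAt (hasDerivAt_flow_ham (by linarith) t) h
  simp only [this, flow_zero]

lemma UG.en_ph {c : ℝ → ℝ × ℝ} (hc : M.UG c) (t : ℝ) : M.en (M.ph c t) = 1 := by
  obtain ⟨z, hz, h⟩ := hc
  rw [ph_of_hasDerivAt (hasDerivAt_flow_ham (by linarith) t) h, en_flow, hz]

lemma UG.ph_add {c : ℝ → ℝ × ℝ} (hc : M.UG c) (s t : ℝ) :
    M.ph c (s + t) = M.flow (M.ph c s) t := by
  rw [hc.ph_eq, flow_add, ← hc.ph_eq]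

lemma UG.hasDerivAt_ph {c : ℝ → ℝ × ℝ} (hc : M.UG c) (t : ℝ) :
    HasDerivAt (M.ph c) (M.ham (M.ph c t)) t := by
  have : M.ph c = M.flow (M.ph c 0) := funext hc.ph_eq
  rw [this]
  exact hasDerivAt_flow_ham (by rw [hc.en_ph]; norm_num) t

lemma vel_ph (c : ℝ → ℝ × ℝ) (t : ℝ) : M.vel (M.ph c t) = deriv c t := M.vel_mom _ _

lemma UG.hasDerivAt {c : ℝ → ℝ × ℝ} (hc : M.UG c) (t : ℝ) : HasDerivAt c (deriv c t) t := by
  have := hasDerivAt_fst_comp (hc.hasDerivAt_ph t)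
  rw [← vel_ph (M := M)]
  exact this

lemma UG.g_deriv {c : ℝ → ℝ × ℝ} (hc : M.UG c) (t : ℝ) : M.g (c t) (deriv c t) (deriv c t) = 1 := by
  rw [← en_mom]; exact hc.en_ph t

lemma ug_of_sol {z : ℝ → (ℝ × ℝ) × (ℝ × ℝ)} (h : ∀ t, HasDerivAt z (M.ham (z t)) t)
    (h0 : M.en (z 0) = 1) : M.UG fun t => (z t).1 :=
  ⟨z 0, h0, fun t => by rw [← eq_flow_of_sol h (by rw [h0]; norm_num)]⟩

lemma ug_flow {z : (ℝ × ℝ) × (ℝ × ℝ)} (h : M.en z = 1) : M.UG fun t => (M.flow z t).1 :=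
  ⟨z, h, fun _ => rfl⟩

lemma ph_flow {z : (ℝ × ℝ) × (ℝ × ℝ)} (h : M.en z = 1) (t : ℝ) :
    M.ph (fun t => (M.flow z t).1) t = M.flow z t :=
  ph_of_hasDerivAt (hasDerivAt_flow_ham (by rw [h]; norm_num) t) fun _ => rfl

lemma exists_ug {x v : ℝ × ℝ} (h : M.g x v v = 1) : ∃ c, M.UG c ∧ c 0 = x ∧ deriv c 0 = v := by
  have h1 : M.en (x, M.mom x v) = 1 := by rw [en_mom, h]
  refine ⟨_, ug_flow h1, by simp, ?_⟩
  rw [← vel_ph (M := M), ph_flow h1, flow_zero, vel_mom]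

lemma exists_ug_at (x : ℝ × ℝ) : ∃ c, M.UG c ∧ c 0 = x := by
  have h := M.ga_pos x
  obtain ⟨c, hc, h0, -⟩ := exists_ug (M := M) (x := x) (v := (Real.sqrt (M.ga x))⁻¹ • (1, 0)) (by
    rw [g_smul_smul, ← mul_inv, Real.mul_self_sqrt h.le]
    exact inv_mul_cancel₀ h.ne')
  exact ⟨c, hc, h0⟩

lemma UG.eq_of {c c' : ℝ → ℝ × ℝ} (hc : M.UG c) (hc' : M.UG c') {s s' : ℝ} (h : c s = c' s')
    (hd : deriv c s = deriv c' s') (t : ℝ) : c (s + t) = c' (s' + t) := by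
  have : M.ph c s = M.ph c' s' := by simp [ph, h, hd]
  have h1 := hc.ph_add s t
  rw [this, ← hc'.ph_add] at h1
  exact congrArg Prod.fst h1

lemma UG.shift {c : ℝ → ℝ × ℝ} (hc : M.UG c) (s : ℝ) : M.UG fun t => c (s + t) :=
  ⟨M.ph c s, hc.en_ph s, fun t => by rw [← hc.ph_add]; rfl⟩

lemma UG.rev {c : ℝ → ℝ × ℝ} (hc : M.UG c) : M.UG fun t => c (-t) := by
  have h := ug_of_sol (sol_scale hc.hasDerivAt_ph (-1)) (by
    rw [en_smul, show ∀ z : (ℝ × ℝ) × (ℝ × ℝ), (z.1, z.2) = z from fun _ => rfl, hc.en_ph]; norm_num)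
  simpa [ph] using h

lemma UG.trans {c : ℝ → ℝ × ℝ} (hc : M.UG c) (k : ℤ × ℤ) : M.UG fun t => c t + lat k := by
  obtain ⟨z, hz, h⟩ := hc
  refine ⟨z + (lat k, 0), ?_, fun t => ?_⟩
  · obtain ⟨x, p⟩ := z
    simpa [en_per] using hz
  · change c t + lat k = _
    rw [flow_per, h]; rfl

lemma UG.continuous {c : ℝ → ℝ × ℝ} (hc : M.UG c) : Continuous c :=
  continuous_iff_continuousAt.2 fun t => (hc.hasDerivAt t).continuousAt

/-- Speeds of geodesics are bounded. -/
lemma UG.norm_deriv_le {c : ℝ → ℝ × ℝ} (hc : M.UG c) (t : ℝ) : ‖deriv c t‖ ≤ 1 / M.cl := by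
  have h := M.cl_le_g (c t) (deriv c t)
  rw [hc.g_deriv] at h
  have h0 := M.cl_pos
  have h1 := M.cl_le_one
  rw [le_div_iff₀ h0]
  have := norm_nonneg (deriv c t)
  nlinarith [mul_nonneg this h0.le]

lemma UG.le_norm_deriv {c : ℝ → ℝ × ℝ} (hc : M.UG c) (t : ℝ) : 1 / M.cu ≤ ‖deriv c t‖ := by
  have h := (le_abs_self _).trans (M.abs_g_le (c t) (deriv c t) (deriv c t))
  rw [hc.g_deriv] at h
  have h0 := M.cu_pos
  have h1 := M.one_le_cu
  rw [div_le_iff₀ h0]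
  have := norm_nonneg (deriv c t)
  nlinarith [mul_nonneg this h0.le]

lemma UG.norm_sub_le {c : ℝ → ℝ × ℝ} (hc : M.UG c) (s t : ℝ) :
    ‖c t - c s‖ ≤ 1 / M.cl * |t - s| :=
  Convex.norm_image_sub_le_of_norm_hasDerivWithin_le
    (fun x _ => (hc.hasDerivAt x).hasDerivWithinAt) (fun x _ => hc.norm_deriv_le x) convex_univ
    (mem_univ s) (mem_univ t)

lemma UG.deriv_eq_cham {c : ℝ → ℝ × ℝ} (hc : M.UG c) (t : ℝ) :
    deriv c t = (M.cham (M.ph c t)).1 := by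
  rw [M.cham_eq_ham (by rw [hc.en_ph]; norm_num), ← vel_ph (M := M)]; rfl

/-- Velocities of geodesics are uniformly Lipschitz. -/
lemma exists_deriv_lip (M : TorusMetric) : ∃ C : ℝ, 0 < C ∧ ∀ c, M.UG c → ∀ s t,
    ‖deriv c t - deriv c s‖ ≤ C * |t - s| := by
  obtain ⟨B, hB⟩ := M.cham_bounded
  refine ⟨M.lipK * B + 1, by positivity, fun c hc s t => ?_⟩
  have h1 : ‖M.ph c t - M.ph c s‖ ≤ B * |t - s| :=
    Convex.norm_image_sub_le_of_norm_hasDerivWithin_le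
    (fun x _ => (hc.hasDerivAt_ph x).hasDerivWithinAt) (fun x _ => by
      rw [← M.cham_eq_ham (by rw [hc.en_ph]; norm_num)]; exact hB _) convex_univ
    (mem_univ s) (mem_univ t)
  have h2 := M.lipschitz_cham.dist_le_mul (M.ph c t) (M.ph c s)
  rw [dist_eq_norm, dist_eq_norm] at h2
  rw [hc.deriv_eq_cham, hc.deriv_eq_cham, ← Prod.fst_sub]
  refine (norm_fst_le _).trans (h2.trans ?_)
  calc (M.lipK : ℝ) * ‖M.ph c t - M.ph c s‖ ≤ M.lipK * (B * |t - s|) := by gcongr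
    _ ≤ _ := by nlinarith [abs_nonneg (t - s)]

/-- A Lipschitz constant for the velocities of geodesics. -/
def cd (M : TorusMetric) : ℝ := M.exists_deriv_lip.choose
lemma cd_pos (M : TorusMetric) : 0 < M.cd := M.exists_deriv_lip.choose_spec.1
lemma UG.norm_deriv_sub_le {c : ℝ → ℝ × ℝ} (hc : M.UG c) (s t : ℝ) :
    ‖deriv c t - deriv c s‖ ≤ M.cd * |t - s| := M.exists_deriv_lip.choose_spec.2 c hc s t

lemma UG.norm_taylor_le {c : ℝ → ℝ × ℝ} (hc : M.UG c) (s t : ℝ) :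
    ‖c t - c s - (t - s) • deriv c s‖ ≤ M.cd * |t - s| ^ 2 := by
  have hd : ∀ x, HasDerivAt (fun x => c x - (x - s) • deriv c s) (deriv c x - deriv c s) x :=
    fun x => by
      have := (hc.hasDerivAt x).sub (((hasDerivAt_id x).sub_const s).smul_const (deriv c s))
      simpa [Pi.sub_def] using this
  have := Convex.norm_image_sub_le_of_norm_hasDerivWithin_le (C := M.cd * |t - s|)
    (fun x (_ : x ∈ uIcc s t) => (hd x).hasDerivWithinAt) (fun x hx => by
      refine (hc.norm_deriv_sub_le s x).trans ?_
      have := M.cd_pos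
      have := abs_sub_left_of_mem_uIcc hx
      gcongr) (convex_uIcc s t)
    left_mem_uIcc right_mem_uIcc
  simp only [sub_self, zero_smul, sub_zero] at this
  rw [sub_right_comm, sq, ← mul_assoc]
  simpa using this

lemma contDiff_flow (z : (ℝ × ℝ) × (ℝ × ℝ)) : ContDiff ℝ (⊤ : ℕ∞) (M.flow z) := by
  rw [contDiff_infty]
  intro n
  induction n with
  | zero =>
    exact contDiff_zero.2 (continuous_iff_continuousAt.2
      fun t => (M.hasDerivAt_flow z t).continuousAt)
  | succ n ih =>
    push_cast
    rw [contDiff_succ_iff_deriv]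
    refine ⟨fun t => (M.hasDerivAt_flow z t).differentiableAt, by simp, ?_⟩
    have : deriv (M.flow z) = M.cham ∘ M.flow z := funext fun t => (M.hasDerivAt_flow z t).deriv
    rw [this]
    exact (M.contDiff_cham.of_le (by exact_mod_cast le_top)).comp ih

lemma UG.contDiff {c : ℝ → ℝ × ℝ} (hc : M.UG c) : ContDiff ℝ (⊤ : ℕ∞) c := by
  obtain ⟨z, hz, h⟩ := hc
  rw [show c = fun t => (M.flow z t).1 from funext h]
  exact contDiff_fst.comp (contDiff_flow z)

lemma isCompact_unit {K : Set (ℝ × ℝ)} (hK : IsCompact K) :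
    IsCompact {z : (ℝ × ℝ) × (ℝ × ℝ) | M.en z = 1 ∧ z.1 ∈ K} := by
  refine (hK.prod (isCompact_closedBall (0 : ℝ × ℝ) (M.cu / M.cl))).of_isClosed_subset ?_ ?_
  · exact (isClosed_eq M.contDiff_en.continuous continuous_const).inter
      (hK.isClosed.preimage continuous_fst)
  · rintro z ⟨h1, h2⟩
    refine ⟨h2, ?_⟩
    have h := M.norm_snd_sq_le z
    rw [h1] at h
    have h0 := M.cl_pos
    have h3 := M.cl_le_one
    have h4 := M.cu_pos
    rw [mem_closedBall_zero_iff, le_div_iff₀ h0]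
    have : (‖z.2‖ * M.cl) ^ 2 ≤ M.cu ^ 2 := by nlinarith [norm_nonneg z.2, sq_nonneg ‖z.2‖]
    exact (pow_le_pow_iff_left₀ (by positivity) h4.le two_ne_zero).1 this

/-- Sequences of geodesics with convergent initial phase points converge pointwise, together with
their velocities. -/
lemma tendsto_flow {z : ℕ → (ℝ × ℝ) × (ℝ × ℝ)} {z0 : (ℝ × ℝ) × (ℝ × ℝ)}
    (h : Tendsto z atTop (𝓝 z0)) (t : ℝ) :
    Tendsto (fun n => M.flow (z n) t) atTop (𝓝 (M.flow z0 t)) := by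
  rw [tendsto_iff_dist_tendsto_zero] at h ⊢
  have := h.mul_const (Real.exp (M.lipK * |t|))
  rw [zero_mul] at this
  exact squeeze_zero (fun _ => dist_nonneg) (fun n => M.dist_flow_le _ _ _) this

lemma continuous_flow (t : ℝ) : Continuous fun z => M.flow z t := by
  refine continuous_iff_seqContinuous.2 fun z z0 h => tendsto_flow h t

end TorusMetric

namespace TorusMetric

variable {M : TorusMetric}

lemma continuous_speed {c : ℝ → ℝ × ℝ} (hc : ContDiff ℝ 1 c) :
    Continuous fun t => M.g (c t) (deriv c t) (deriv c t) :=
  M.continuous_g.comp (hc.continuous.prodMk ((hc.continuous_deriv le_rfl).prodMk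
    (hc.continuous_deriv le_rfl)))

lemma length_nonneg (c : ℝ → ℝ × ℝ) {a b : ℝ} (h : a ≤ b) : 0 ≤ M.length c a b :=
  intervalIntegral.integral_nonneg h fun _ _ => Real.sqrt_nonneg _

lemma length_comp {c : ℝ → ℝ × ℝ} (hc : ContDiff ℝ 1 c) {φ : ℝ → ℝ} (hφ : ContDiff ℝ 1 φ)
    (h : ∀ t, 0 ≤ deriv φ t) (a b : ℝ) : M.length (c ∘ φ) a b = M.length c (φ a) (φ b) := by
  have e := intervalIntegral.integral_comp_mul_deriv (a := a) (b := b) (f := φ) (f' := deriv φ)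
    (g := fun t => Real.sqrt (M.g (c t) (deriv c t) (deriv c t)))
    (fun t _ => (hφ.differentiable one_ne_zero t).hasDerivAt)
    (hφ.continuous_deriv le_rfl).continuousOn (continuous_speed hc).sqrt
  rw [length, length, ← e]
  congr 1
  funext t
  have h1 : deriv (c ∘ φ) t = deriv φ t • deriv c (φ t) :=
    ((hc.differentiable one_ne_zero _).hasDerivAt.scomp t
      (hφ.differentiable one_ne_zero t).hasDerivAt).deriv
  simp only [h1, Function.comp, g_smul_smul]
  rw [Real.sqrt_mul (mul_self_nonneg _), Real.sqrt_mul_self (h t), mul_comm]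

lemma dist_le_length01 {c : ℝ → ℝ × ℝ} (hc : ContDiff ℝ 1 c) :
    M.dist (c 0) (c 1) ≤ M.length c 0 1 :=
  csInf_le ⟨0, by rintro _ ⟨c, -, -, -, rfl⟩; exact length_nonneg c zero_le_one⟩
    ⟨c, hc, rfl, rfl, rfl⟩

lemma dist_le_length {c : ℝ → ℝ × ℝ} (hc : ContDiff ℝ 1 c) {a b : ℝ} (h : a ≤ b) :
    M.dist (c a) (c b) ≤ M.length c a b := by
  have hφ : ContDiff ℝ 1 fun t : ℝ => a + (b - a) * t := by fun_prop
  have := dist_le_length01 (M := M) (hc.comp hφ)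
  rw [length_comp hc hφ (fun t => by
    have : HasDerivAt (fun t : ℝ => a + (b - a) * t) (b - a) t := by
      simpa using ((hasDerivAt_id t).const_mul (b - a)).const_add a
    rw [this.deriv]; linarith)] at this
  simpa using this

lemma exists_length_lt (x y : ℝ × ℝ) {ε : ℝ} (hε : 0 < ε) : ∃ c : ℝ → ℝ × ℝ, ContDiff ℝ 1 c ∧
    c 0 = x ∧ c 1 = y ∧ M.length c 0 1 < M.dist x y + ε := by
  have hne : {L | ∃ c : ℝ → ℝ × ℝ, ContDiff ℝ 1 c ∧ c 0 = x ∧ c 1 = y ∧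
      L = M.length c 0 1}.Nonempty :=
    ⟨_, fun t => x + t • (y - x), by fun_prop, by simp, by simp, rfl⟩
  obtain ⟨_, ⟨c, h1, h2, h3, rfl⟩, h⟩ := exists_lt_of_csInf_lt hne (lt_add_of_pos_right _ hε)
  exact ⟨c, h1, h2, h3, h⟩

lemma dist_le (x y : ℝ × ℝ) : M.dist x y ≤ M.cu * ‖x - y‖ := by
  have hd : ∀ t : ℝ, HasDerivAt (fun t : ℝ => x + t • (y - x)) (y - x) t := fun t => by
    simpa using ((hasDerivAt_id t).smul_const (y - x)).const_add x
  have := dist_le_length01 (M := M) (c := fun t : ℝ => x + t • (y - x)) (by fun_prop)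
  simp only [zero_smul, add_zero, one_smul, add_sub_cancel] at this
  refine this.trans ?_
  have h2 : M.length (fun t : ℝ => x + t • (y - x)) 0 1 ≤ ∫ t in (0 : ℝ)..1, M.cu * ‖x - y‖ := by
    refine intervalIntegral.integral_mono_on zero_le_one
      (continuous_speed (by fun_prop)).sqrt.continuousOn.intervalIntegrable (by simp) fun t _ => ?_
    rw [(hd t).deriv]
    have h := (le_abs_self _).trans (M.abs_g_le (x + t • (y - x)) (y - x) (y - x))
    have h0 := M.one_le_cu
    rw [norm_sub_rev x y]
    refine Real.sqrt_le_iff.2 ⟨by positivity, h.trans ?_⟩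
    rw [mul_pow, ← sq]
    gcongr
    nlinarith
  simpa using h2

lemma le_length {c : ℝ → ℝ × ℝ} (hc : ContDiff ℝ 1 c) {a b : ℝ} (h : a ≤ b) :
    M.cl * ‖c a - c b‖ ≤ M.length c a b := by
  have hcl := M.cl_pos
  have h1 : ‖c b - c a‖ ≤ ∫ t in a..b, ‖deriv c t‖ := by
    rw [← intervalIntegral.integral_deriv_eq_sub
      (fun t _ => hc.differentiable one_ne_zero t)
      ((hc.continuous_deriv le_rfl).intervalIntegrable _ _)]
    exact intervalIntegral.norm_integral_le_integral_norm h
  rw [norm_sub_rev]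
  refine (mul_le_mul_of_nonneg_left h1 hcl.le).trans ?_
  rw [← intervalIntegral.integral_const_mul]
  refine intervalIntegral.integral_mono_on h
    (continuous_const.mul (hc.continuous_deriv le_rfl).norm).continuousOn.intervalIntegrable
    (continuous_speed hc).sqrt.continuousOn.intervalIntegrable fun t _ => ?_
  refine Real.le_sqrt_of_sq_le (le_trans ?_ (M.cl_le_g _ _))
  rw [mul_pow]
  gcongr
  nlinarith [M.cl_le_one]

lemma le_dist (x y : ℝ × ℝ) : M.cl * ‖x - y‖ ≤ M.dist x y := by
  refine le_of_forall_pos_lt_add fun ε hε => ?_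
  obtain ⟨c, h1, rfl, rfl, h⟩ := exists_length_lt (M := M) x y hε
  exact (le_length h1 zero_le_one).trans_lt h

lemma dist_nonneg' (x y : ℝ × ℝ) : 0 ≤ M.dist x y :=
  (mul_nonneg M.cl_pos.le (norm_nonneg _)).trans (le_dist x y)

@[simp] lemma dist_self' (x : ℝ × ℝ) : M.dist x x = 0 :=
  le_antisymm (by simpa using M.dist_le x x) (dist_nonneg' _ _)

lemma eq_of_dist {x y : ℝ × ℝ} (h : M.dist x y ≤ 0) : x = y := by
  have := (le_dist (M := M) x y).trans h
  have h2 : ‖x - y‖ ≤ 0 := by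
    by_contra h3
    exact absurd this (not_le.2 (mul_pos M.cl_pos (not_le.1 h3)))
  exact sub_eq_zero.1 (norm_le_zero_iff.1 h2)

lemma deriv_smoothTransition (t : ℝ) : 0 ≤ deriv Real.smoothTransition t :=
  Real.smoothTransition.monotone.deriv_nonneg

lemma contDiff_smoothTransition : ContDiff ℝ 1 Real.smoothTransition :=
  Real.smoothTransition.contDiff

lemma deriv_smoothTransition_of_nonpos {t : ℝ} (h : t ≤ 0) : deriv Real.smoothTransition t = 0 := by
  refine IsLocalMin.deriv_eq_zero (Eventually.of_forall fun s => ?_)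
  rw [Real.smoothTransition.zero_of_nonpos h]
  exact Real.smoothTransition.nonneg s

lemma deriv_smoothTransition_of_one_le {t : ℝ} (h : 1 ≤ t) : deriv Real.smoothTransition t = 0 := by
  refine IsLocalMax.deriv_eq_zero (Eventually.of_forall fun s => ?_)
  rw [Real.smoothTransition.one_of_one_le h]
  exact Real.smoothTransition.le_one s

lemma exists_concat {c₁ c₂ : ℝ → ℝ × ℝ} (h₁ : ContDiff ℝ 1 c₁) (h₂ : ContDiff ℝ 1 c₂)
    (h : c₁ 1 = c₂ 0) : ∃ c : ℝ → ℝ × ℝ, ContDiff ℝ 1 c ∧ c 0 = c₁ 0 ∧ c 1 = c₂ 1 ∧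
      c (1 / 2) = c₁ 1 ∧ M.length c 0 1 = M.length c₁ 0 1 + M.length c₂ 0 1 := by
  set φ₁ : ℝ → ℝ := fun t => Real.smoothTransition (2 * t)
  set φ₂ : ℝ → ℝ := fun t => Real.smoothTransition (2 * t - 1)
  have hφ₁ : ContDiff ℝ 1 φ₁ := contDiff_smoothTransition.comp (by fun_prop)
  have hφ₂ : ContDiff ℝ 1 φ₂ := contDiff_smoothTransition.comp (by fun_prop)
  have d₁ : ∀ t, HasDerivAt φ₁ (deriv Real.smoothTransition (2 * t) * 2) t := fun t =>
    (contDiff_smoothTransition.differentiable one_ne_zero _).hasDerivAt.comp t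
      (by simpa using (hasDerivAt_id t).const_mul 2)
  have d₂ : ∀ t, HasDerivAt φ₂ (deriv Real.smoothTransition (2 * t - 1) * 2) t := fun t =>
    (contDiff_smoothTransition.differentiable one_ne_zero _).hasDerivAt.comp t
      (by simpa using ((hasDerivAt_id t).const_mul 2).sub_const 1)
  have p₁ : ∀ t, 0 ≤ deriv φ₁ t := fun t => by
    rw [(d₁ t).deriv]; have := deriv_smoothTransition (2 * t); positivity
  have p₂ : ∀ t, 0 ≤ deriv φ₂ t := fun t => by
    rw [(d₂ t).deriv]; have := deriv_smoothTransition (2 * t - 1); positivity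
  set c : ℝ → ℝ × ℝ := fun t => (c₁ ∘ φ₁) t + (c₂ ∘ φ₂) t - c₁ 1 with hcdef
  have k₁ := h₁.comp hφ₁
  have k₂ := h₂.comp hφ₂
  have hc : ContDiff ℝ 1 c := (k₁.add k₂).sub contDiff_const
  have e₁ : ∀ t, deriv (c₁ ∘ φ₁) t = deriv φ₁ t • deriv c₁ (φ₁ t) := fun t =>
    ((h₁.differentiable one_ne_zero _).hasDerivAt.scomp t
      (hφ₁.differentiable one_ne_zero t).hasDerivAt).deriv
  have e₂ : ∀ t, deriv (c₂ ∘ φ₂) t = deriv φ₂ t • deriv c₂ (φ₂ t) := fun t =>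
    ((h₂.differentiable one_ne_zero _).hasDerivAt.scomp t
      (hφ₂.differentiable one_ne_zero t).hasDerivAt).deriv
  have hd : ∀ t, deriv c t = deriv (c₁ ∘ φ₁) t + deriv (c₂ ∘ φ₂) t := fun t =>
    (((k₁.differentiable one_ne_zero t).hasDerivAt.add
      (k₂.differentiable one_ne_zero t).hasDerivAt).sub_const _).deriv
  have z₁ : ∀ t, t ≤ 1 / 2 → c t = (c₁ ∘ φ₁) t ∧ deriv c t = deriv (c₁ ∘ φ₁) t := fun t ht => by
    constructor
    · simp only [hcdef, Function.comp, φ₂]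
      rw [Real.smoothTransition.zero_of_nonpos (by linarith), h]; simp
    · rw [hd, e₂, (d₂ t).deriv, deriv_smoothTransition_of_nonpos (by linarith)]; simp
  have z₂ : ∀ t, 1 / 2 ≤ t → c t = (c₂ ∘ φ₂) t ∧ deriv c t = deriv (c₂ ∘ φ₂) t := fun t ht => by
    constructor
    · simp only [hcdef, Function.comp, φ₁]
      rw [Real.smoothTransition.one_of_one_le (by linarith)]; simp
    · rw [hd, e₁, (d₁ t).deriv, deriv_smoothTransition_of_one_le (by linarith)]; simp
  refine ⟨c, hc, ?_, ?_, ?_, ?_⟩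
  · rw [(z₁ 0 (by norm_num)).1]; simp [φ₁]
  · rw [(z₂ 1 (by norm_num)).1]; simp only [Function.comp, φ₂]; norm_num
  · rw [(z₁ _ le_rfl).1]; simp [φ₁]
  · have i := (continuous_speed (M := M) hc).sqrt
    have l₁ := length_comp (M := M) h₁ hφ₁ p₁ 0 (1 / 2)
    have l₂ := length_comp (M := M) h₂ hφ₂ p₂ (1 / 2) 1
    have f₁ : φ₁ 0 = 0 := by simp [φ₁]
    have f₂ : φ₁ (1 / 2) = 1 := by simp [φ₁]
    have f₃ : φ₂ (1 / 2) = 0 := by simp [φ₂]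
    have f₄ : φ₂ 1 = 1 := by simp only [φ₂]; norm_num
    rw [f₁, f₂] at l₁
    rw [f₃, f₄] at l₂
    rw [← l₁, ← l₂, length, ← intervalIntegral.integral_add_adjacent_intervals
      (i.intervalIntegrable 0 (1 / 2)) (i.intervalIntegrable (1 / 2) 1)]
    congr 1
    · refine intervalIntegral.integral_congr fun t ht => ?_
      rw [uIcc_of_le (by norm_num)] at ht
      simp only [z₁ t ht.2]
    · refine intervalIntegral.integral_congr fun t ht => ?_
      rw [uIcc_of_le (by norm_num)] at ht
      simp only [z₂ t ht.1]

lemma dist_triangle' (x y z : ℝ × ℝ) : M.dist x z ≤ M.dist x y + M.dist y z := by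
  refine le_of_forall_pos_lt_add fun ε hε => ?_
  obtain ⟨c₁, h1, rfl, rfl, h⟩ := exists_length_lt (M := M) x y (half_pos hε)
  obtain ⟨c₂, h1', h2, rfl, h'⟩ := exists_length_lt (M := M) (c₁ 1) z (half_pos hε)
  obtain ⟨c, hc, h3, h4, -, h5⟩ := exists_concat (M := M) h1 h1' h2.symm
  have := dist_le_length01 (M := M) hc
  rw [h3, h4] at this
  linarith

lemma dist_comm_le (x y : ℝ × ℝ) : M.dist y x ≤ M.dist x y := by
  refine le_of_forall_pos_lt_add fun ε hε => ?_
  obtain ⟨c, h1, rfl, rfl, h⟩ := exists_length_lt (M := M) x y hε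
  have hd : ∀ t, deriv (fun t => c (1 - t)) t = - deriv c (1 - t) := fun t => by
    have := ((h1.differentiable one_ne_zero _).hasDerivAt.scomp t
      ((hasDerivAt_id t).const_sub (1 : ℝ))).deriv
    simpa [Function.comp_def] using this
  have := dist_le_length01 (M := M) (c := fun t => c (1 - t)) (h1.comp (by fun_prop))
  have e : M.length (fun t => c (1 - t)) 0 1 = M.length c 0 1 := by
    have := intervalIntegral.integral_comp_sub_left (a := 0) (b := 1)
      (fun t => Real.sqrt (M.g (c t) (deriv c t) (deriv c t))) (1 : ℝ)
    simp only [sub_zero, sub_self] at this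
    rw [length, length, ← this]
    congr 1
    funext t
    rw [hd, ← neg_one_smul ℝ, g_smul_smul]; simp
  rw [e] at this
  simp only [sub_zero, sub_self] at this
  linarith

lemma dist_comm' (x y : ℝ × ℝ) : M.dist x y = M.dist y x :=
  le_antisymm (dist_comm_le _ _) (dist_comm_le _ _)

lemma dist_add_lat_le (k : ℤ × ℤ) (x y : ℝ × ℝ) :
    M.dist (x + lat k) (y + lat k) ≤ M.dist x y := by
  refine le_of_forall_pos_lt_add fun ε hε => ?_
  obtain ⟨c, h1, rfl, rfl, h⟩ := exists_length_lt (M := M) x y hε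
  have := dist_le_length01 (M := M) (c := fun t => c t + lat k) (h1.add contDiff_const)
  have e : M.length (fun t => c t + lat k) 0 1 = M.length c 0 1 := by
    simp only [length, deriv_add_const, M.periodic]
  rw [e] at this
  linarith

lemma dist_add_lat (k : ℤ × ℤ) (x y : ℝ × ℝ) :
    M.dist (x + lat k) (y + lat k) = M.dist x y := by
  refine le_antisymm (dist_add_lat_le _ _ _) ?_
  have := dist_add_lat_le (M := M) (-k) (x + lat k) (y + lat k)
  simpa [lat_neg] using this

lemma abs_dist_sub_le (x y z : ℝ × ℝ) : |M.dist x y - M.dist x z| ≤ M.cu * ‖y - z‖ := by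
  have h1 := dist_triangle' (M := M) x y z
  have h2 := dist_triangle' (M := M) x z y
  have h3 := M.dist_le y z
  rw [dist_comm' z y] at h2
  rw [abs_le]; constructor <;> linarith

lemma continuous_dist : Continuous fun p : (ℝ × ℝ) × (ℝ × ℝ) => M.dist p.1 p.2 := by
  have : LipschitzWith (Real.toNNReal M.cu * 2) fun p : (ℝ × ℝ) × (ℝ × ℝ) => M.dist p.1 p.2 := by
    refine LipschitzWith.of_dist_le_mul fun p p' => ?_
    have h1 := abs_dist_sub_le (M := M) p.1 p.2 p'.2
    have h2 := abs_dist_sub_le (M := M) p'.2 p.1 p'.1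
    rw [dist_comm' p'.2 p.1, dist_comm' p'.2 p'.1] at h2
    have h3 := norm_fst_le (p - p')
    have h4 := norm_snd_le (p - p')
    rw [Prod.fst_sub] at h3
    rw [Prod.snd_sub] at h4
    have := M.cu_pos
    rw [Real.dist_eq, dist_eq_norm]
    push_cast
    rw [Real.coe_toNNReal _ this.le]
    rw [abs_le] at *
    have h5 := mul_le_mul_of_nonneg_left h3 this.le
    have h6 := mul_le_mul_of_nonneg_left h4 this.le
    constructor <;> linarith
  exact this.continuous

end TorusMetric

/-- A `C¹` function with positive derivative bounded below has a `C¹` inverse. -/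
lemma exists_inverse {f f' : ℝ → ℝ} (hf : ∀ t, HasDerivAt f (f' t) t) (hf' : Continuous f')
    {ε : ℝ} (hε : 0 < ε) (h : ∀ t, ε ≤ f' t) :
    ∃ φ : ℝ → ℝ, (∀ t, f (φ t) = t) ∧ (∀ t, φ (f t) = t) ∧ ContDiff ℝ 1 φ ∧
      ∀ t, HasDerivAt φ (f' (φ t))⁻¹ t := by
  have hpos : ∀ t, 0 < f' t := fun t => hε.trans_le (h t)
  have hmono : StrictMono f := strictMono_of_hasDerivAt_pos hf hpos
  have hcont : Continuous f := continuous_iff_continuousAt.2 fun t => (hf t).continuousAt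
  have hm : Monotone fun t => f t - ε * t := by
    refine monotone_of_hasDerivAt_nonneg (f' := fun t => f' t - ε) (fun t => ?_) fun t => ?_
    · simpa [Pi.sub_def] using (hf t).sub ((hasDerivAt_id t).const_mul ε)
    · simpa using h t
  have hsurj : Function.Surjective f := by
    refine hcont.surjective ?_ ?_
    · refine tendsto_atTop_mono' _ ?_ (tendsto_atTop_add_const_right _ (f 0)
        (tendsto_id.const_mul_atTop hε))
      filter_upwards [eventually_ge_atTop 0] with t ht
      have := hm ht
      simp at this ⊢; linarith
    · refine tendsto_atBot_mono' _ ?_ (tendsto_atBot_add_const_right _ (f 0)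
        (tendsto_id.const_mul_atBot hε))
      filter_upwards [eventually_le_atBot 0] with t ht
      have := hm ht
      simp at this ⊢; linarith
  set e := (hmono.orderIsoOfSurjective f hsurj)
  have h1 : ∀ t, f (e.symm t) = t := fun t => e.apply_symm_apply t
  have h2 : ∀ t, e.symm (f t) = t := fun t => e.symm_apply_apply t
  have hc : Continuous e.symm := e.symm.continuous
  have hd : ∀ t, HasDerivAt e.symm (f' (e.symm t))⁻¹ t := fun t =>
    HasDerivAt.of_local_left_inverse hc.continuousAt (hf _) (hpos _).ne' (Eventually.of_forall h1)
  refine ⟨e.symm, h1, h2, ?_, hd⟩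
  refine contDiff_one_iff_deriv.2 ⟨fun t => (hd t).differentiableAt, ?_⟩
  rw [show deriv e.symm = fun t => (f' (e.symm t))⁻¹ from funext fun t => (hd t).deriv]
  exact (hf'.comp hc).inv₀ fun t => (hpos _).ne'

namespace TorusMetric

variable {M : TorusMetric}

/-- The energy of a curve on the unit interval. -/
def energy (M : TorusMetric) (c : ℝ → ℝ × ℝ) : ℝ :=
  ∫ t in (0 : ℝ)..1, M.g (c t) (deriv c t) (deriv c t)

lemma exists_energy_le {c : ℝ → ℝ × ℝ} (hc : ContDiff ℝ 1 c) {ε : ℝ} (hε : 0 < ε) {t₀ : ℝ}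
    (ht₀ : t₀ ∈ Icc (0 : ℝ) 1) : ∃ γ : ℝ → ℝ × ℝ, ContDiff ℝ 1 γ ∧ γ 0 = c 0 ∧ γ 1 = c 1 ∧
      (∃ t ∈ Icc (0 : ℝ) 1, γ t = c t₀) ∧ M.energy γ ≤ (M.length c 0 1 + ε) ^ 2 := by
  set s : ℝ → ℝ := fun t => Real.sqrt (M.g (c t) (deriv c t) (deriv c t)) with hs
  have hsc : Continuous s := (continuous_speed hc).sqrt
  set L := M.length c 0 1
  have hL : 0 ≤ L := length_nonneg c zero_le_one
  set f : ℝ → ℝ := fun t => (∫ u in (0 : ℝ)..t, (s u + ε)) / (L + ε)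
  have hf : ∀ t, HasDerivAt f ((s t + ε) / (L + ε)) t := fun t =>
    ((hsc.add continuous_const).integral_hasStrictDerivAt 0 t).hasDerivAt.div_const _
  have hsn : ∀ t, 0 ≤ s t := fun t => Real.sqrt_nonneg _
  obtain ⟨φ, h1, h2, h3, h4⟩ := exists_inverse hf (by fun_prop) (ε := ε / (L + ε)) (by positivity)
    (fun t => by have := hsn t; gcongr; linarith)
  have f0 : f 0 = 0 := by simp [f]
  have f1 : f 1 = 1 := by
    simp only [f]
    rw [intervalIntegral.integral_add (hsc.intervalIntegrable _ _) (by simp)]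
    have : (∫ u in (0 : ℝ)..1, s u) = L := rfl
    have : 0 < L + ε := by positivity
    simp only [*, intervalIntegral.integral_const, sub_zero, one_smul]
    exact div_self this.ne'
  have fm : Monotone f := monotone_of_hasDerivAt_nonneg hf fun t => by
    have := hsn t; simp only [Pi.zero_apply]; positivity
  refine ⟨c ∘ φ, hc.comp h3, ?_, ?_, ⟨f t₀, ⟨?_, ?_⟩, ?_⟩, ?_⟩
  · have := h2 0; rw [f0] at this; simp [this]
  · have := h2 1; rw [f1] at this; simp [this]
  · rw [← f0]; exact fm ht₀.1
  · rw [← f1]; exact fm ht₀.2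
  · simp [h2]
  · have hle : ∀ t, M.g ((c ∘ φ) t) (deriv (c ∘ φ) t) (deriv (c ∘ φ) t) ≤ (L + ε) ^ 2 := fun t => by
      have e : deriv (c ∘ φ) t = ((s (φ t) + ε) / (L + ε))⁻¹ • deriv c (φ t) :=
        ((hc.differentiable one_ne_zero _).hasDerivAt.scomp t (h4 t)).deriv
      have e2 : M.g (c (φ t)) (deriv c (φ t)) (deriv c (φ t)) = s (φ t) ^ 2 :=
        (Real.sq_sqrt (g_self_nonneg _ _ _)).symm
      rw [e, g_smul_smul, Function.comp, e2]
      have := hsn (φ t)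
      have h5 : s (φ t) / (s (φ t) + ε) ≤ 1 := by
        rw [div_le_one (by positivity)]; linarith
      have h6 : 0 ≤ s (φ t) / (s (φ t) + ε) := by positivity
      calc _ = (L + ε) ^ 2 * (s (φ t) / (s (φ t) + ε)) ^ 2 := by field_simp
        _ ≤ (L + ε) ^ 2 * 1 ^ 2 := by gcongr
        _ = _ := by ring
    have := intervalIntegral.integral_mono_on (μ := MeasureTheory.volume) zero_le_one
      (continuous_speed (M := M) (hc.comp h3)).continuousOn.intervalIntegrable
      (continuous_const (y := (L + ε) ^ 2)).continuousOn.intervalIntegrable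
      (a := 0) (b := 1) fun t _ => hle t
    simpa [energy] using this

lemma abs_g_sub_le (x η v w : ℝ × ℝ) :
    |M.g (x + η) v w - M.g x v w| ≤ M.cu * ‖η‖ * (‖v‖ * ‖w‖) := by
  have hd : ∀ s : ℝ, HasDerivAt (fun s : ℝ => M.g (x + s • η) v w) (M.Dg (x + s • η) η v w) s :=
    fun s => by
      have h : HasDerivAt (fun s : ℝ => x + s • η) η s := by
        simpa using ((hasDerivAt_id s).smul_const η).const_add x
      refine (M.hasDerivAt_g h (hasDerivAt_const s v) (hasDerivAt_const s w)).congr_deriv ?_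
      simp [g_eq]
  have := Convex.norm_image_sub_le_of_norm_hasDerivWithin_le (C := M.cu * ‖η‖ * (‖v‖ * ‖w‖))
    (fun s (_ : s ∈ univ) => (hd s).hasDerivWithinAt) (fun s _ => M.abs_Dg_le _ _ _ _) convex_univ
    (mem_univ 0) (mem_univ 1)
  simpa using this

lemma g_ge_pointwise (z : (ℝ × ℝ) × (ℝ × ℝ)) (η w : ℝ × ℝ) :
    M.en z + 2 * ((M.force z).1 * η.1 + (M.force z).2 * η.2 + (z.2.1 * w.1 + z.2.2 * w.2)) +
      M.cl / 2 * ‖w‖ ^ 2 - 3 * M.cu ^ 2 / M.cl * (‖η‖ ^ 2 * ‖M.vel z‖ ^ 2) ≤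
      M.g (z.1 + η) (M.vel z + w) (M.vel z + w) := by
  have h0 := M.cl_pos
  have h1 := M.cl_le_one
  have h2 := M.one_le_cu
  set v := M.vel z
  have a1 := neg_le_of_abs_le (M.abs_g_taylor_le z.1 η v)
  have a2 := neg_le_of_abs_le (M.abs_g_sub_le z.1 η v w)
  have a3 := M.cl_le_g (z.1 + η) w
  have a4 : M.g z.1 v w = z.2.1 * w.1 + z.2.2 * w.2 := by rw [g_eq_mom, mom_vel]
  have a5 := M.Dg_eq_force z η
  have a6 : M.en z = M.g z.1 v v := M.en_eq z
  rw [g_add_add]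
  have a7 : 2 * (M.cu * ‖η‖ * (‖v‖ * ‖w‖)) ≤
      M.cl / 2 * ‖w‖ ^ 2 + 2 * M.cu ^ 2 / M.cl * (‖η‖ ^ 2 * ‖v‖ ^ 2) := by
    have : 0 ≤ (M.cl * ‖w‖ - 2 * M.cu * ‖η‖ * ‖v‖) ^ 2 / (2 * M.cl) := by positivity
    have e : (M.cl * ‖w‖ - 2 * M.cu * ‖η‖ * ‖v‖) ^ 2 / (2 * M.cl) =
      M.cl / 2 * ‖w‖ ^ 2 + 2 * M.cu ^ 2 / M.cl * (‖η‖ ^ 2 * ‖v‖ ^ 2) -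
        2 * (M.cu * ‖η‖ * (‖v‖ * ‖w‖)) := by field_simp; ring
    linarith
  have a8 : M.cu * ‖η‖ ^ 2 * ‖v‖ ^ 2 ≤ M.cu ^ 2 / M.cl * (‖η‖ ^ 2 * ‖v‖ ^ 2) := by
    rw [mul_assoc]
    gcongr
    rw [le_div_iff₀ h0]; nlinarith
  have e : 3 * M.cu ^ 2 / M.cl * (‖η‖ ^ 2 * ‖v‖ ^ 2) =
    M.cu ^ 2 / M.cl * (‖η‖ ^ 2 * ‖v‖ ^ 2) + 2 * M.cu ^ 2 / M.cl * (‖η‖ ^ 2 * ‖v‖ ^ 2) := by ring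
  rw [a5] at a1
  linarith

lemma sq_integral_le {f : ℝ → ℝ} (hf : Continuous f) :
    (∫ t in (0 : ℝ)..1, f t) ^ 2 ≤ ∫ t in (0 : ℝ)..1, f t ^ 2 := by
  set m := ∫ t in (0 : ℝ)..1, f t
  have h : 0 ≤ ∫ t in (0 : ℝ)..1, (f t ^ 2 - 2 * m * f t + m ^ 2) :=
    intervalIntegral.integral_nonneg zero_le_one fun t _ => by nlinarith [sq_nonneg (f t - m)]
  rw [intervalIntegral.integral_add (Continuous.intervalIntegrable (by fun_prop) _ _)
    (Continuous.intervalIntegrable (by fun_prop) _ _),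
    intervalIntegral.integral_sub (Continuous.intervalIntegrable (by fun_prop) _ _)
    (Continuous.intervalIntegrable (by fun_prop) _ _), intervalIntegral.integral_const_mul] at h
  simp only [intervalIntegral.integral_const, sub_zero, one_smul] at h
  have : m = ∫ t in (0 : ℝ)..1, f t := rfl
  rw [← this] at h
  nlinarith

lemma norm_sq_le_integral {η : ℝ → ℝ × ℝ} (hη : ContDiff ℝ 1 η) (h0 : η 0 = 0) {t : ℝ}
    (ht : t ∈ Icc (0 : ℝ) 1) : ‖η t‖ ^ 2 ≤ ∫ t in (0 : ℝ)..1, ‖deriv η t‖ ^ 2 := by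
  have hc := (hη.continuous_deriv le_rfl).norm
  refine le_trans ?_ (sq_integral_le hc)
  have h1 : ‖η t - η 0‖ ≤ ∫ t in (0 : ℝ)..t, ‖deriv η t‖ := by
    rw [← intervalIntegral.integral_deriv_eq_sub
      (fun t _ => hη.differentiable one_ne_zero t)
      ((hη.continuous_deriv le_rfl).intervalIntegrable _ _)]
    exact intervalIntegral.norm_integral_le_integral_norm ht.1
  rw [h0, sub_zero] at h1
  have h2 : ∫ t in (0 : ℝ)..t, ‖deriv η t‖ ≤ ∫ t in (0 : ℝ)..1, ‖deriv η t‖ :=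
    intervalIntegral.integral_mono_interval le_rfl ht.1 ht.2
      (Eventually.of_forall fun _ => norm_nonneg _) (hc.intervalIntegrable _ _)
  have := norm_nonneg (η t)
  gcongr
  exact h1.trans h2

/-- Short solutions of the geodesic equation minimize the energy strictly. -/
lemma energy_ge {z : ℝ → (ℝ × ℝ) × (ℝ × ℝ)} (hz : ∀ t, HasDerivAt z (M.ham (z t)) t)
    (hen : 12 * M.cu ^ 2 * M.en (z 0) ≤ M.cl ^ 3) {γ : ℝ → ℝ × ℝ} (hγ : ContDiff ℝ 1 γ)
    (h0 : γ 0 = (z 0).1) (h1 : γ 1 = (z 1).1) {t : ℝ} (ht : t ∈ Icc (0 : ℝ) 1) :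
    M.en (z 0) + M.cl / 4 * ‖γ t - (z t).1‖ ^ 2 ≤ M.energy γ := by
  have hcl := M.cl_pos
  have hq : ∀ t, HasDerivAt (fun t => (z t).1) (M.vel (z t)) t := fun t =>
    hasDerivAt_fst_comp (hz t)
  have hp : ∀ t, HasDerivAt (fun t => (z t).2) (M.force (z t)) t := fun t =>
    hasDerivAt_snd_comp (hz t)
  have hzc : Continuous z := continuous_iff_continuousAt.2 fun t => (hz t).continuousAt
  have hqC : ContDiff ℝ 1 fun t => (z t).1 := by
    refine contDiff_one_iff_deriv.2 ⟨fun t => (hq t).differentiableAt, ?_⟩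
    rw [show deriv (fun t => (z t).1) = fun t => M.vel (z t) from funext fun t => (hq t).deriv]
    exact M.contDiff_vel.continuous.comp hzc
  set η : ℝ → ℝ × ℝ := fun t => γ t - (z t).1 with hη
  have hηC : ContDiff ℝ 1 η := hγ.sub hqC
  have hηd : ∀ t, HasDerivAt η (deriv η t) t := fun t =>
    (hηC.differentiable one_ne_zero t).hasDerivAt
  have hγd : ∀ t, deriv γ t = M.vel (z t) + deriv η t := fun t => by
    have : deriv η t = deriv γ t - M.vel (z t) :=
      ((hγ.differentiable one_ne_zero t).hasDerivAt.sub (hq t)).deriv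
    rw [this]; abel
  set Y := ∫ t in (0 : ℝ)..1, ‖deriv η t‖ ^ 2
  have η0 : η 0 = 0 := by simp [hη, h0]
  have η1 : η 1 = 0 := by simp [hη, h1]
  have hY : ∀ t ∈ Icc (0 : ℝ) 1, ‖η t‖ ^ 2 ≤ Y := fun t ht => norm_sq_le_integral hηC η0 ht
  have hYt := hY t ht
  set F : ℝ → ℝ := fun t => (z t).2.1 * (η t).1 + (z t).2.2 * (η t).2
  set F' : ℝ → ℝ := fun t => (M.force (z t)).1 * (η t).1 + (M.force (z t)).2 * (η t).2 +
    ((z t).2.1 * (deriv η t).1 + (z t).2.2 * (deriv η t).2)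
  have hF : ∀ t, HasDerivAt F (F' t) t := fun t => by
    have := ((hasDerivAt_fst_comp (hp t)).mul (hasDerivAt_fst_comp (hηd t))).add
      ((hasDerivAt_snd_comp (hp t)).mul (hasDerivAt_snd_comp (hηd t)))
    refine this.congr_deriv ?_
    simp only [F']; ring
  have hfc : Continuous fun t => M.force (z t) := M.contDiff_force.continuous.comp hzc
  have hηc := hηC.continuous
  have hηdc := hηC.continuous_deriv le_rfl
  have hF'c : Continuous F' :=
    ((hfc.fst.mul hηc.fst).add (hfc.snd.mul hηc.snd)).add
      ((hzc.snd.fst.mul hηdc.fst).add (hzc.snd.snd.mul hηdc.snd))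
  have hFint : ∫ t in (0 : ℝ)..1, F' t = 0 := by
    rw [intervalIntegral.integral_eq_sub_of_hasDerivAt (fun t _ => hF t)
      (hF'c.intervalIntegrable _ _)]
    simp [F, η0, η1]
  have hpt : ∀ t ∈ Icc (0 : ℝ) 1, M.en (z 0) + 2 * F' t + M.cl / 2 * ‖deriv η t‖ ^ 2 -
      M.cl / 4 * Y ≤ M.g (γ t) (deriv γ t) (deriv γ t) := fun t ht => by
    have h := M.g_ge_pointwise (z t) (η t) (deriv η t)
    have hv := M.norm_vel_sq_le (z t)
    rw [en_eq_of_sol hz] at h hv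
    rw [hγd, show γ t = (z t).1 + η t by simp [hη]]
    refine le_trans ?_ h
    have h5 := hY t ht
    have h6 : 3 * M.cu ^ 2 / M.cl * (‖η t‖ ^ 2 * ‖M.vel (z t)‖ ^ 2) ≤ M.cl / 4 * Y := by
      have h7 : ‖M.vel (z t)‖ ^ 2 ≤ M.en (z 0) / M.cl := by
        rw [le_div_iff₀ hcl]; linarith
      have h8 : 3 * M.cu ^ 2 / M.cl * (M.en (z 0) / M.cl) ≤ M.cl / 4 := by
        rw [div_mul_div_comm, div_le_iff₀ (by positivity)]; nlinarith
      have hY0 : 0 ≤ Y := (sq_nonneg _).trans h5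
      calc _ ≤ 3 * M.cu ^ 2 / M.cl * (Y * (M.en (z 0) / M.cl)) := by gcongr
        _ = 3 * M.cu ^ 2 / M.cl * (M.en (z 0) / M.cl) * Y := by ring
        _ ≤ _ := by gcongr
    simp only [F']
    linarith
  have key := intervalIntegral.integral_mono_on (μ := MeasureTheory.volume) zero_le_one
    (Continuous.intervalIntegrable (by fun_prop) _ _)
    ((continuous_speed (M := M) hγ).continuousOn.intervalIntegrable) hpt
  rw [intervalIntegral.integral_sub (Continuous.intervalIntegrable (by fun_prop) _ _)
    (Continuous.intervalIntegrable (by fun_prop) _ _),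
    intervalIntegral.integral_add (Continuous.intervalIntegrable (by fun_prop) _ _)
    (Continuous.intervalIntegrable (by fun_prop) _ _),
    intervalIntegral.integral_add (Continuous.intervalIntegrable (by fun_prop) _ _)
    (Continuous.intervalIntegrable (by fun_prop) _ _), intervalIntegral.integral_const_mul,
    intervalIntegral.integral_const_mul, hFint] at key
  simp only [intervalIntegral.integral_const, sub_zero, one_smul] at key
  change _ ≤ M.energy γ at key
  have : ∫ t in (0 : ℝ)..1, ‖deriv η t‖ ^ 2 = Y := rfl
  rw [this] at key
  have : M.cl / 4 * ‖γ t - (z t).1‖ ^ 2 ≤ M.cl / 4 * Y := by gcongr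
  linarith

end TorusMetric

namespace TorusMetric

variable {M : TorusMetric}

lemma UG.length_eq {c : ℝ → ℝ × ℝ} (hc : M.UG c) (a b : ℝ) : M.length c a b = b - a := by
  simp [length, hc.g_deriv]

lemma UG.contDiff_one {c : ℝ → ℝ × ℝ} (hc : M.UG c) : ContDiff ℝ 1 c :=
  hc.contDiff.of_le (by exact_mod_cast le_top)

lemma UG.dist_le {c : ℝ → ℝ × ℝ} (hc : M.UG c) (s t : ℝ) : M.dist (c s) (c t) ≤ |t - s| := by
  rcases le_total s t with h | h
  · rw [abs_of_nonneg (sub_nonneg.2 h), ← hc.length_eq]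
    exact dist_le_length hc.contDiff_one h
  · rw [abs_sub_comm, abs_of_nonneg (sub_nonneg.2 h), ← hc.length_eq, dist_comm']
    exact dist_le_length hc.contDiff_one h

/-- Geodesics of length at most `rs` are minimizing. -/
def rs (M : TorusMetric) : ℝ := M.cl ^ 2 / (4 * M.cu)

lemma rs_pos (M : TorusMetric) : 0 < M.rs := by
  have := M.cl_pos; have := M.cu_pos; unfold rs; positivity

lemma rs_spec {l : ℝ} (h0 : 0 ≤ l) (h : l ≤ M.rs) : 12 * M.cu ^ 2 * l ^ 2 ≤ M.cl ^ 3 := by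
  have h1 := M.cl_pos
  have h2 := M.cu_pos
  have h3 := M.cl_le_one
  have : l ^ 2 ≤ M.rs ^ 2 := by gcongr
  calc 12 * M.cu ^ 2 * l ^ 2 ≤ 12 * M.cu ^ 2 * M.rs ^ 2 := by gcongr
    _ = 12 / 16 * M.cl * M.cl ^ 3 := by unfold rs; field_simp; ring
    _ ≤ 1 * M.cl ^ 3 := by gcongr; linarith
    _ = _ := one_mul _

lemma UG.energy_ge {c : ℝ → ℝ × ℝ} (hc : M.UG c) {s l : ℝ} (hl : 0 ≤ l) (hl' : l ≤ M.rs)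
    {γ : ℝ → ℝ × ℝ} (hγ : ContDiff ℝ 1 γ) (h0 : γ 0 = c s) (h1 : γ 1 = c (s + l)) {t : ℝ}
    (ht : t ∈ Icc (0 : ℝ) 1) :
    l ^ 2 + M.cl / 4 * ‖γ t - c (s + l * t)‖ ^ 2 ≤ M.energy γ := by
  have h := sol_scale (hc.shift s).hasDerivAt_ph l
  have e : M.en ((M.ph (fun t => c (s + t)) (l * 0)).1,
      l • (M.ph (fun t => c (s + t)) (l * 0)).2) = l ^ 2 := by
    rw [en_smul, show ∀ z : (ℝ × ℝ) × (ℝ × ℝ), (z.1, z.2) = z from fun _ => rfl,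
      (hc.shift s).en_ph, mul_one]
  have := TorusMetric.energy_ge h (by rw [e]; exact rs_spec hl hl') hγ (by simp [ph, h0])
    (by simp [ph, h1]) ht
  rw [e] at this
  exact this

lemma UG.le_dist_add {c : ℝ → ℝ × ℝ} (hc : M.UG c) {s l : ℝ} (hl : 0 ≤ l) (hl' : l ≤ M.rs) :
    M.dist (c s) (c (s + l)) = l := by
  refine le_antisymm ((hc.dist_le _ _).trans (by simp [abs_of_nonneg hl])) ?_
  refine le_of_forall_pos_lt_add fun ε hε => ?_
  obtain ⟨γ, h1, h2, h3, h4⟩ := exists_length_lt (M := M) (c s) (c (s + l)) (half_pos hε)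
  obtain ⟨γ', h5, h6, h7, -, h8⟩ := exists_energy_le (M := M) h1 (half_pos hε)
    (left_mem_Icc.2 zero_le_one)
  have := hc.energy_ge hl hl' h5 (h6.trans h2) (h7.trans h3) (left_mem_Icc.2 zero_le_one)
  have h9 := length_nonneg (M := M) γ zero_le_one
  have hcl := M.cl_pos
  have : l ^ 2 ≤ (M.length γ 0 1 + ε / 2) ^ 2 := by
    refine le_trans ?_ (this.trans h8)
    have : 0 ≤ M.cl / 4 * ‖γ' 0 - c (s + l * 0)‖ ^ 2 := by positivity
    linarith
  have := (pow_le_pow_iff_left₀ hl (by positivity) two_ne_zero).1 this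
  linarith

lemma UG.dist_eq {c : ℝ → ℝ × ℝ} (hc : M.UG c) {s t : ℝ} (h : |t - s| ≤ M.rs) :
    M.dist (c s) (c t) = |t - s| := by
  rcases le_total s t with h1 | h1
  · have h2 : |t - s| = t - s := abs_of_nonneg (sub_nonneg.2 h1)
    rw [h2] at h ⊢
    have := hc.le_dist_add (s := s) (sub_nonneg.2 h1) h
    simpa using this
  · have h2 : |t - s| = s - t := by rw [abs_sub_comm]; exact abs_of_nonneg (sub_nonneg.2 h1)
    rw [h2] at h ⊢
    have := hc.le_dist_add (s := t) (sub_nonneg.2 h1) h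
    rw [dist_comm']
    simpa using this

/-- A point through which there is a shortest path between the endpoints of a short geodesic lies
on this geodesic. -/
lemma UG.eq_of_dist_add_le {c : ℝ → ℝ × ℝ} (hc : M.UG c) {s l : ℝ} (hl : 0 ≤ l) (hl' : l ≤ M.rs)
    {m : ℝ × ℝ} (hm : M.dist (c s) m + M.dist m (c (s + l)) ≤ l) :
    m = c (s + M.dist (c s) m) := by
  have hcl := M.cl_pos
  have hcu := M.cu_pos
  set D := M.dist (c s) m with hD
  set K := 1 + 1 / M.cl * M.cu with hK
  have key : ∀ ε : ℝ, 0 < ε →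
      M.cl / 4 * ‖m - c (s + D)‖ ^ 2 ≤ K ^ 2 * ((l + 3 * ε) ^ 2 - l ^ 2) := by
    intro ε hε
    obtain ⟨c₁, h1, h2, h3, h4⟩ := exists_length_lt (M := M) (c s) m hε
    obtain ⟨c₂, h1', h2', h3', h4'⟩ := exists_length_lt (M := M) m (c (s + l)) hε
    obtain ⟨c₃, k1, k2, k3, k4, k5⟩ := exists_concat (M := M) h1 h1' (h3.trans h2'.symm)
    obtain ⟨γ, a1, a2, a3, ⟨t, ht, a4⟩, a5⟩ := exists_energy_le (M := M) (t₀ := 1 / 2) k1 hε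
      ⟨by norm_num, by norm_num⟩
    have b := hc.energy_ge hl hl' a1 (a2.trans (k2.trans h2)) (a3.trans (k3.trans h3')) ht
    rw [a4, k4, h3] at b
    have hlen : M.length c₃ 0 1 ≤ l + 2 * ε := by rw [k5]; linarith
    have hlen0 := length_nonneg (M := M) c₃ zero_le_one
    have b2 : M.energy γ ≤ (l + 3 * ε) ^ 2 := a5.trans (pow_le_pow_left₀ (by positivity) (by linarith) 2)
    have b3 : |D - l * t| ≤ M.cu * ‖m - c (s + l * t)‖ := by
      have := abs_dist_sub_le (M := M) (c s) m (c (s + l * t))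
      rwa [hc.le_dist_add (mul_nonneg hl ht.1) ((mul_le_of_le_one_right hl ht.2).trans hl')] at this
    have b4 : ‖m - c (s + D)‖ ≤ K * ‖m - c (s + l * t)‖ := by
      have e1 := norm_sub_le_norm_sub_add_norm_sub m (c (s + l * t)) (c (s + D))
      have e2 := hc.norm_sub_le (s + D) (s + l * t)
      rw [show s + l * t - (s + D) = -(D - l * t) by ring, abs_neg] at e2
      have e3 : 1 / M.cl * |D - l * t| ≤ 1 / M.cl * (M.cu * ‖m - c (s + l * t)‖) := by gcongr
      rw [hK]; linarith
    calc M.cl / 4 * ‖m - c (s + D)‖ ^ 2 ≤ M.cl / 4 * (K * ‖m - c (s + l * t)‖) ^ 2 := by gcongr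
      _ = K ^ 2 * (M.cl / 4 * ‖m - c (s + l * t)‖ ^ 2) := by ring
      _ ≤ _ := by gcongr; linarith
  have hlim : Tendsto (fun ε : ℝ => K ^ 2 * ((l + 3 * ε) ^ 2 - l ^ 2)) (𝓝[>] 0) (𝓝 0) := by
    have : Continuous fun ε : ℝ => K ^ 2 * ((l + 3 * ε) ^ 2 - l ^ 2) := by fun_prop
    have := this.tendsto 0
    simp only [mul_zero, add_zero, sub_self] at this
    exact this.mono_left nhdsWithin_le_nhds
  have h := ge_of_tendsto hlim (eventually_mem_nhdsWithin.mono fun ε hε => key ε hε)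
  have h2 : ‖m - c (s + D)‖ ^ 2 ≤ 0 := by
    by_contra h3
    have := mul_pos (show 0 < M.cl / 4 by positivity) (not_le.1 h3)
    linarith
  have h3 : ‖m - c (s + D)‖ = 0 := by
    have := norm_nonneg (m - c (s + D)); nlinarith
  exact sub_eq_zero.1 (norm_eq_zero.1 h3)

/-- Short geodesics are determined by their endpoints. -/
lemma UG.unique {c c' : ℝ → ℝ × ℝ} (hc : M.UG c) (hc' : M.UG c') {s s' l : ℝ} (hl : 0 < l)
    (hl' : l ≤ M.rs) (h0 : c s = c' s') (h1 : c (s + l) = c' (s' + l)) (t : ℝ) :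
    c (s + t) = c' (s' + t) := by
  have key : ∀ t ∈ Icc 0 l, c' (s' + t) = c (s + t) := fun t ht => by
    have d1 : M.dist (c s) (c' (s' + t)) = t := by
      rw [h0]; exact hc'.le_dist_add ht.1 (ht.2.trans hl')
    have d2 : M.dist (c' (s' + t)) (c (s + l)) = l - t := by
      rw [h1]
      have := hc'.le_dist_add (s := s' + t) (l := l - t) (by linarith [ht.2]) (by linarith [ht.1])
      rwa [show s' + t + (l - t) = s' + l by ring] at this
    have := hc.eq_of_dist_add_le hl.le hl' (by rw [d1, d2]; linarith)
    rwa [d1] at this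
  have hd : deriv c (s + l / 2) = deriv c' (s' + l / 2) := by
    rw [← deriv_comp_const_add, ← deriv_comp_const_add c']
    refine EventuallyEq.deriv_eq ?_
    filter_upwards [Icc_mem_nhds (show 0 < l / 2 by linarith) (show l / 2 < l by linarith)]
      with t ht using (key t ht).symm
  have := hc.eq_of hc' (key (l / 2) ⟨by linarith, by linarith⟩).symm hd (t - l / 2)
  convert this using 2 <;> ring

lemma mom_smul (x v : ℝ × ℝ) (s : ℝ) : M.mom x (s • v) = s • M.mom x v := by
  ext <;> simp only [mom, Prod.smul_fst, Prod.smul_snd, smul_eq_mul] <;> ring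

/-- The exponential map in terms of unit speed geodesics. -/
lemma exists_ug_exp {x v : ℝ × ℝ} (hv : v ≠ 0) (h4 : M.g x v v ≤ 4) :
    ∃ c, M.UG c ∧ c 0 = x ∧ deriv c 0 = (Real.sqrt (M.g x v v))⁻¹ • v ∧
      (M.flow (x, M.mom x v) 1).1 = c (Real.sqrt (M.g x v v)) := by
  have hpos := M.posdef x v hv
  set l := Real.sqrt (M.g x v v) with hl
  have hl0 : 0 < l := Real.sqrt_pos.2 hpos
  have hl2 : l * l = M.g x v v := Real.mul_self_sqrt hpos.le
  obtain ⟨c, hc, h0, hd⟩ := exists_ug (M := M) (x := x) (v := l⁻¹ • v) (by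
    rw [g_smul_smul, ← hl2]; field_simp)
  refine ⟨c, hc, h0, hd, ?_⟩
  have h := sol_scale hc.hasDerivAt_ph l
  have e : ((M.ph c (l * 0)).1, l • (M.ph c (l * 0)).2) = (x, M.mom x v) := by
    simp only [ph, mul_zero, h0, hd, mom_smul, smul_smul]
    rw [mul_inv_cancel₀ hl0.ne', one_smul]
  have := eq_flow_of_sol h (by rw [e, en_mom]; exact h4)
  rw [e] at this
  rw [← this]
  simp [ph]

lemma flow_zero_momentum (x : ℝ × ℝ) (t : ℝ) : M.flow (x, 0) t = (x, 0) := by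
  have h : M.cham (x, 0) = 0 := by
    simp [cham, ham, vel, force, Dg]
  have := M.eq_flow (γ := fun _ => (x, 0)) fun t => by rw [h]; exact hasDerivAt_const _ _
  exact (congrFun this t).symm

lemma continuous_mom (x : ℝ × ℝ) : Continuous (M.mom x) := by
  unfold mom; fun_prop

lemma exists_short : ∃ ρ : ℝ, 0 < ρ ∧ ρ ≤ M.rs ∧ ∀ x y, M.dist x y ≤ ρ →
    ∃ c, M.UG c ∧ c 0 = x ∧ c (M.dist x y) = y := by
  have hcl := M.cl_pos
  have hcu := M.one_le_cu
  have hcu0 := M.cu_pos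
  have hcd := M.cd_pos
  have hrs := M.rs_pos
  obtain ⟨r, hr, r1, r2, r3⟩ : ∃ r : ℝ, 0 < r ∧ M.cu * r ≤ 1 ∧ M.cd * M.cu * r ≤ 1 / 2 ∧
      M.cu * r ≤ M.rs := by
    refine ⟨min (1 / M.cu) (min (1 / 2 / (M.cd * M.cu)) (M.rs / M.cu)), by positivity, ?_, ?_, ?_⟩
    · rw [mul_comm, ← le_div_iff₀ hcu0]; exact min_le_left _ _
    · rw [mul_comm, ← le_div_iff₀ (by positivity)]
      exact (min_le_right _ _).trans (min_le_left _ _)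
    · rw [mul_comm, ← le_div_iff₀ hcu0]; exact (min_le_right _ _).trans (min_le_right _ _)
  have hg : ∀ x v : ℝ × ℝ, ‖v‖ ≤ r → M.g x v v ≤ (M.cu * ‖v‖) ^ 2 := fun x v hv => by
    refine (le_abs_self _).trans ((M.abs_g_le x v v).trans ?_)
    rw [mul_pow, ← sq]; gcongr; nlinarith
  have hP : ∀ x v : ℝ × ℝ, ‖v‖ ≤ r → ‖(M.flow (x, M.mom x v) 1).1 - x - v‖ ≤ r / 2 := by
    intro x v hv
    rcases eq_or_ne v 0 with rfl | hv0
    · have : M.mom x 0 = 0 := by simp [mom]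
      rw [this, flow_zero_momentum]; simp; linarith
    have hgv := hg x v hv
    have hcv : M.cu * ‖v‖ ≤ 1 := (by gcongr : M.cu * ‖v‖ ≤ M.cu * r).trans r1
    obtain ⟨c, hc, h0, hd, he⟩ := exists_ug_exp (M := M) (x := x) hv0 (by
      have : 0 ≤ M.cu * ‖v‖ := by positivity
      nlinarith)
    have hpos := M.posdef x v hv0
    have ht := hc.norm_taylor_le 0 (Real.sqrt (M.g x v v))
    rw [h0, hd, sub_zero, smul_smul, mul_inv_cancel₀ (Real.sqrt_pos.2 hpos).ne', one_smul,
      abs_of_nonneg (Real.sqrt_nonneg _), Real.sq_sqrt hpos.le] at ht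
    rw [he]
    refine ht.trans ?_
    have hb := (le_abs_self _).trans (M.abs_g_le x v v)
    calc M.cd * M.g x v v ≤ M.cd * (M.cu * (‖v‖ * ‖v‖)) := by gcongr
      _ ≤ M.cd * (M.cu * (r * r)) := by gcongr
      _ = M.cd * M.cu * r * r := by ring
      _ ≤ 1 / 2 * r := by gcongr
      _ = _ := by ring
  refine ⟨min M.rs (M.cl * (r / 2)), by positivity, min_le_left _ _, fun x y hxy => ?_⟩
  have hd1 := hxy.trans (min_le_left _ _)
  have hyx : ‖x - y‖ ≤ r / 2 :=
    le_of_mul_le_mul_left ((M.le_dist x y).trans (hxy.trans (min_le_right _ _))) hcl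
  rcases eq_or_ne x y with rfl | hne
  · obtain ⟨c, hc, h0⟩ := exists_ug_at (M := M) x
    exact ⟨c, hc, h0, by simp [h0]⟩
  have hPc : Continuous fun v : ℝ × ℝ => (M.flow (x, M.mom x v) 1).1 :=
    continuous_fst.comp ((continuous_flow 1).comp (continuous_const.prodMk (continuous_mom x)))
  have hn : ∀ s ∈ Icc (-r) r, ∀ t ∈ Icc (-r) r, ‖((s, t) : ℝ × ℝ)‖ ≤ r := fun s hs t ht => by
    simp only [Prod.norm_def, Real.norm_eq_abs]
    exact max_le (abs_le.2 hs) (abs_le.2 ht)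
  have hsplit : ∀ s t : ℝ, ‖((s, t) : ℝ × ℝ)‖ ≤ r →
      |(M.flow (x, M.mom x (s, t)) 1).1.1 - x.1 - s| ≤ r / 2 ∧
      |(M.flow (x, M.mom x (s, t)) 1).1.2 - x.2 - t| ≤ r / 2 := fun s t h => by
    have h1 := hP x (s, t) h
    exact ⟨(norm_fst_le _).trans h1, (norm_snd_le _).trans h1⟩
  have hy1 : |x.1 - y.1| ≤ r / 2 := (norm_fst_le (x - y)).trans hyx
  have hy2 : |x.2 - y.2| ≤ r / 2 := (norm_snd_le (x - y)).trans hyx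
  rw [abs_le] at hy1 hy2
  have hl : -r ∈ Icc (-r) r := left_mem_Icc.2 (by linarith)
  have hrr : r ∈ Icc (-r) r := right_mem_Icc.2 (by linarith)
  obtain ⟨s, hs, t, ht, e1, e2⟩ := poincare_miranda (a := -r) (b := r) (c := -r) (d := r)
    (by linarith) (by linarith) (F := fun v => (M.flow (x, M.mom x v) 1).1.1 - y.1)
    (G := fun v => (M.flow (x, M.mom x v) 1).1.2 - y.2)
    (hPc.fst.sub continuous_const).continuousOn (hPc.snd.sub continuous_const).continuousOn
    (fun t ht => by
      have := (hsplit _ _ (hn _ hl t ht)).1; rw [abs_le] at this; linarith)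
    (fun t ht => by
      have := (hsplit _ _ (hn _ hrr t ht)).1; rw [abs_le] at this; linarith)
    (fun t ht => by
      have := (hsplit _ _ (hn t ht _ hl)).2; rw [abs_le] at this; linarith)
    (fun t ht => by
      have := (hsplit _ _ (hn t ht _ hrr)).2; rw [abs_le] at this; linarith)
  have hv := hn s hs t ht
  set v : ℝ × ℝ := (s, t)
  have hPv : (M.flow (x, M.mom x v) 1).1 = y := Prod.ext (sub_eq_zero.1 e1) (sub_eq_zero.1 e2)
  have hv0 : v ≠ 0 := by
    intro h0
    have : M.mom x 0 = 0 := by simp [mom]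
    rw [h0, this, flow_zero_momentum] at hPv
    exact hne hPv
  have hgv := hg x v hv
  have hcv : M.cu * ‖v‖ ≤ M.cu * r := by gcongr
  have hcv0 : 0 ≤ M.cu * ‖v‖ := by positivity
  obtain ⟨c, hc, h0, hd, he⟩ := exists_ug_exp (M := M) (x := x) hv0 (by nlinarith)
  have hle : Real.sqrt (M.g x v v) ≤ M.rs :=
    (Real.sqrt_le_iff.2 ⟨hcv0, hgv⟩).trans (hcv.trans r3)
  have hdist := hc.le_dist_add (s := 0) (Real.sqrt_nonneg (M.g x v v)) hle
  rw [zero_add, ← he, hPv, h0] at hdist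
  refine ⟨c, hc, h0, ?_⟩
  rw [hdist, ← he, hPv]

/-- Points at distance at most `rj` are joined by a short geodesic. -/
def rj (M : TorusMetric) : ℝ := M.exists_short.choose
lemma rj_pos (M : TorusMetric) : 0 < M.rj := M.exists_short.choose_spec.1
lemma rj_le (M : TorusMetric) : M.rj ≤ M.rs := M.exists_short.choose_spec.2.1
lemma exists_ug_join {x y : ℝ × ℝ} (h : M.dist x y ≤ M.rj) :
    ∃ c, M.UG c ∧ c 0 = x ∧ c (M.dist x y) = y := M.exists_short.choose_spec.2.2 x y h

lemma UG.isGeodesic {c : ℝ → ℝ × ℝ} (hc : M.UG c) : M.IsGeodesic c := by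
  refine ⟨hc.contDiff, hc.g_deriv, fun t => ⟨M.rs / 2, by have := M.rs_pos; positivity,
    fun s₁ s₂ h1 h2 h3 => ?_⟩⟩
  have h4 : |s₂ - s₁| = s₂ - s₁ := abs_of_nonneg (sub_nonneg.2 h2)
  rw [hc.length_eq, hc.dist_eq (by rw [h4]; linarith), h4]

lemma IsGeodesic.ug {c : ℝ → ℝ × ℝ} (hc : M.IsGeodesic c) : M.UG c := by
  obtain ⟨h1, h2, h3⟩ := hc
  have hlen : ∀ a b, M.length c a b = b - a := fun a b => by simp [length, h2]
  have key : ∀ t, HasDerivAt (M.ph c) (M.ham (M.ph c t)) t := fun t => by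
    obtain ⟨ε, hε, h⟩ := h3 t
    have hrj := M.rj_pos
    obtain ⟨δ, hδ, d1, d2⟩ : ∃ δ > 0, δ ≤ ε ∧ 2 * δ ≤ M.rj :=
      ⟨min ε (M.rj / 2), by positivity, min_le_left _ _, by
        linarith [min_le_right ε (M.rj / 2)]⟩
    have hD : ∀ s₁ s₂, t - δ ≤ s₁ → s₁ ≤ s₂ → s₂ ≤ t + δ → M.dist (c s₁) (c s₂) = s₂ - s₁ :=
      fun s₁ s₂ a b e => by rw [h s₁ s₂ (by linarith) b (by linarith), hlen]
    have hD0 : M.dist (c (t - δ)) (c (t + δ)) = 2 * δ := by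
      rw [hD _ _ le_rfl (by linarith) le_rfl]; ring
    obtain ⟨o, ho, o1, o2⟩ := exists_ug_join (M := M) (x := c (t - δ)) (y := c (t + δ))
      (by rw [hD0]; exact d2)
    rw [hD0] at o2
    have hs := ho.shift (-(t - δ))
    have heq : c =ᶠ[𝓝 t] fun s => o (-(t - δ) + s) := by
      filter_upwards [Icc_mem_nhds (show t - δ < t by linarith) (show t < t + δ by linarith)]
        with s hs
      have e1 : M.dist (o 0) (c s) = s - (t - δ) := by rw [o1, hD _ _ le_rfl hs.1 hs.2]
      have e2 : M.dist (c s) (o (0 + 2 * δ)) = t + δ - s := by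
        rw [zero_add, o2, hD _ _ hs.1 hs.2 le_rfl]
      have := ho.eq_of_dist_add_le (s := 0) (l := 2 * δ) (by positivity) (d2.trans M.rj_le)
        (m := c s) (by rw [e1, e2]; linarith)
      rw [e1] at this
      rw [this]; congr 1; ring
    have hph : M.ph c =ᶠ[𝓝 t] M.ph fun s => o (-(t - δ) + s) := by
      filter_upwards [heq, heq.deriv] with s h1 h2
      simp only [ph, h1, h2]
    have := (hs.hasDerivAt_ph t).congr_of_eventuallyEq hph
    rwa [← hph.eq_of_nhds] at this
  exact ug_of_sol key (by rw [ph, en_mom, h2])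

lemma isGeodesic_iff {c : ℝ → ℝ × ℝ} : M.IsGeodesic c ↔ M.UG c :=
  ⟨fun h => h.ug, fun h => h.isGeodesic⟩

end TorusMetric

namespace TorusMetric
variable {M : TorusMetric}

lemma UG.unique' {c c' : ℝ → ℝ × ℝ} (hc : M.UG c) (hc' : M.UG c') {s s' l l' : ℝ} (hl : l ≠ 0)
    (h1 : |l| ≤ M.rs) (h2 : |l'| ≤ M.rs) (h : c s = c' s') (h' : c (s + l) = c' (s' + l')) :
    (∀ t, c (s + t) = c' (s' + t)) ∨ ∀ t, c (s + t) = c' (s' - t) := by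
  have e1 : M.dist (c s) (c (s + l)) = |l| := by
    rw [hc.dist_eq (by simpa using h1)]; simp
  have e2 : M.dist (c' s') (c' (s' + l')) = |l'| := by
    rw [hc'.dist_eq (by simpa using h2)]; simp
  have e : |l| = |l'| := by rw [← e1, ← e2, h, h']
  have key : ∀ (a b : ℝ → ℝ × ℝ), M.UG a → M.UG b → a 0 = b 0 → ∀ m, 0 < m → m ≤ M.rs →
      a m = b m → ∀ t, a t = b t := by
    intro a b ha hb h0 m hm hm' hab t
    simpa using UG.unique ha hb (s := 0) (s' := 0) hm hm' h0 (by simpa using hab) t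
  have A := hc.shift s
  have B := hc'.shift s'
  have hr : ∀ {d : ℝ → ℝ × ℝ} (q : ℝ), M.UG d → M.UG (fun t => d (q - t)) := by
    intro d q hd
    simpa [sub_eq_add_neg] using (hd.shift q).rev
  rcases lt_or_gt_of_ne hl with hn | hp
  · have hl1 : |l| = -l := abs_of_neg hn
    rcases le_total 0 l' with hq | hq
    · right
      have := key _ _ (hr s hc) B (by simpa using h) (-l) (by linarith) (by linarith)
        (by rw [show s - -l = s + l by ring, h']; congr 1; rw [abs_of_nonneg hq] at e; linarith)
      intro t
      have := this (-t)
      simpa [sub_eq_add_neg] using this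
    · left
      have := key _ _ (hr s hc) (hr s' hc') (by simpa using h) (-l) (by linarith) (by linarith)
        (by rw [show s - -l = s + l by ring, h']; congr 1; rw [abs_of_nonpos hq] at e; linarith)
      intro t
      have := this (-t)
      simpa [sub_eq_add_neg] using this
  · have hl1 : |l| = l := abs_of_pos hp
    rcases le_total 0 l' with hq | hq
    · left
      exact key _ _ A B (by simpa using h) l hp (by linarith)
        (by rw [h']; congr 1; rw [abs_of_nonneg hq] at e; linarith)
    · right
      exact key _ _ A (hr s' hc') (by simpa using h) l hp (by linarith)
        (by rw [h']; congr 1; rw [abs_of_nonpos hq] at e; linarith)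

def dotX (v y : ℝ × ℝ) : ℝ := v.1 * y.1 + v.2 * y.2
def crsY (v y : ℝ × ℝ) : ℝ := v.1 * y.2 - v.2 * y.1

lemma abs_fst_le (y : ℝ × ℝ) : |y.1| ≤ ‖y‖ := norm_fst_le y
lemma abs_snd_le (y : ℝ × ℝ) : |y.2| ≤ ‖y‖ := norm_snd_le y

lemma abs_dotX_le (v y : ℝ × ℝ) : |dotX v y| ≤ 2 * ‖v‖ * ‖y‖ := by
  unfold dotX
  have a := mul_le_mul (abs_fst_le v) (abs_fst_le y) (abs_nonneg _) (norm_nonneg _)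
  have b := mul_le_mul (abs_snd_le v) (abs_snd_le y) (abs_nonneg _) (norm_nonneg _)
  rw [← abs_mul] at a b
  calc _ ≤ |v.1 * y.1| + |v.2 * y.2| := abs_add_le _ _
    _ ≤ _ := by linarith

lemma abs_crsY_le (v y : ℝ × ℝ) : |crsY v y| ≤ 2 * ‖v‖ * ‖y‖ := by
  unfold crsY
  have a := mul_le_mul (abs_fst_le v) (abs_snd_le y) (abs_nonneg _) (norm_nonneg _)
  have b := mul_le_mul (abs_snd_le v) (abs_fst_le y) (abs_nonneg _) (norm_nonneg _)
  rw [← abs_mul] at a b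
  calc _ ≤ |v.1 * y.2| + |v.2 * y.1| := abs_sub _ _
    _ ≤ _ := by linarith

lemma dotX_self_ge (v : ℝ × ℝ) : ‖v‖ ^ 2 ≤ dotX v v := by
  unfold dotX
  rcases max_choice ‖v.1‖ ‖v.2‖ with h | h <;>
  · rw [Prod.norm_def, h, Real.norm_eq_abs, sq_abs]; nlinarith [sq_nonneg v.1, sq_nonneg v.2]

lemma eq_of_dotX_crsY {v y y' : ℝ × ℝ} (hv : v ≠ 0) (h1 : dotX v y = dotX v y')
    (h2 : crsY v y = crsY v y') : y = y' := by
  have hn : 0 < v.1 ^ 2 + v.2 ^ 2 := by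
    have := dotX_self_ge v
    have h3 : 0 < ‖v‖ := norm_pos_iff.2 hv
    unfold dotX at this; nlinarith
  simp only [dotX, crsY] at h1 h2
  ext
  · have : (v.1 ^ 2 + v.2 ^ 2) * y.1 = (v.1 ^ 2 + v.2 ^ 2) * y'.1 := by
      linear_combination v.1 * h1 - v.2 * h2
    exact mul_left_cancel₀ hn.ne' this
  · have : (v.1 ^ 2 + v.2 ^ 2) * y.2 = (v.1 ^ 2 + v.2 ^ 2) * y'.2 := by
      linear_combination v.2 * h1 + v.1 * h2
    exact mul_left_cancel₀ hn.ne' this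

def tau (M : TorusMetric) : ℝ := min M.rs (1 / (24 * M.cd * M.cu))
def rho (M : TorusMetric) : ℝ := M.tau / (4 * M.cu)
def rc (M : TorusMetric) : ℝ := min (M.rho * M.cl) M.rj ⊓ M.tau

lemma tau_pos (M : TorusMetric) : 0 < M.tau :=
  lt_min M.rs_pos (by have := M.cd_pos; have := M.cu_pos; positivity)
lemma rho_pos (M : TorusMetric) : 0 < M.rho := by
  have := M.tau_pos; have := M.cu_pos; unfold rho; positivity
lemma rc_pos (M : TorusMetric) : 0 < M.rc :=
  lt_min (lt_min (mul_pos M.rho_pos M.cl_pos) M.rj_pos) M.tau_pos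

/-- Near `o 0`, the chord `o [-τ, τ]` is a graph, hence the zero set of a function. -/
lemma UG.exists_export {o : ℝ → ℝ × ℝ} (ho : M.UG o) : ∃ F : ℝ → ℝ, Continuous F ∧
    (∀ s, |s| ≤ M.tau → F (dotX (deriv o 0) (o s - o 0)) = crsY (deriv o 0) (o s - o 0)) ∧
    (∀ y, ‖y - o 0‖ ≤ M.rho → ∃ s, |s| ≤ M.tau ∧ |s| * M.cu⁻¹ ≤ 4 * ‖y - o 0‖ ∧
      dotX (deriv o 0) (o s - o 0) = dotX (deriv o 0) (y - o 0)) := by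
  set v := deriv o 0 with hv
  have hcu := M.cu_pos
  have hcd := M.cd_pos
  have hτ := M.tau_pos
  have hv1 : 1 / M.cu ≤ ‖v‖ := ho.le_norm_deriv 0
  have hvp : 0 < ‖v‖ := lt_of_lt_of_le (by positivity) hv1
  set n := dotX v v with hn
  have hnv : ‖v‖ ^ 2 ≤ n := dotX_self_ge v
  have hτ2 : 24 * M.cd * M.tau ≤ ‖v‖ := by
    refine le_trans ?_ hv1
    have : M.tau ≤ 1 / (24 * M.cd * M.cu) := min_le_right _ _
    calc _ ≤ 24 * M.cd * (1 / (24 * M.cd * M.cu)) := by gcongr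
      _ = _ := by field_simp
  have hdiff : ∀ s s', |s| ≤ M.tau → |s'| ≤ M.tau →
      ‖o s - o s' - (s - s') • v‖ ≤ ‖v‖ / 8 * |s - s'| := by
    intro s s' hs hs'
    have e1 := ho.norm_taylor_le s' s
    have e2 := ho.norm_deriv_sub_le 0 s'
    have e3 : o s - o s' - (s - s') • v = (o s - o s' - (s - s') • deriv o s') +
      (s - s') • (deriv o s' - v) := by rw [smul_sub]; abel
    have e4 : |s - s'| ≤ 2 * M.tau := by
      calc _ ≤ |s| + |s'| := abs_sub _ _
        _ ≤ _ := by linarith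
    rw [e3]
    refine (norm_add_le _ _).trans ?_
    rw [norm_smul, Real.norm_eq_abs]
    have e5 : ‖deriv o s' - v‖ ≤ M.cd * M.tau := e2.trans (by simpa using by gcongr)
    calc _ ≤ M.cd * |s - s'| ^ 2 + |s - s'| * (M.cd * M.tau) := by gcongr
      _ ≤ M.cd * (|s - s'| * (2 * M.tau)) + |s - s'| * (M.cd * M.tau) := by
        rw [sq]; gcongr
      _ = (3 * M.cd * M.tau) * |s - s'| := by ring
      _ ≤ _ := by gcongr; linarith
  have hX : ∀ s s', |s| ≤ M.tau → |s'| ≤ M.tau →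
      |dotX v (o s - o 0) - dotX v (o s' - o 0) - n * (s - s')| ≤ n / 4 * |s - s'| := by
    intro s s' hs hs'
    have e : dotX v (o s - o 0) - dotX v (o s' - o 0) - n * (s - s')
        = dotX v (o s - o s' - (s - s') • v) := by
      simp only [hn, dotX, Prod.fst_sub, Prod.snd_sub, Prod.smul_fst, Prod.smul_snd, smul_eq_mul]; ring
    rw [e]
    refine (abs_dotX_le _ _).trans ?_
    calc _ ≤ 2 * ‖v‖ * (‖v‖ / 8 * |s - s'|) := by gcongr; exact hdiff s s' hs hs'
      _ = ‖v‖ ^ 2 / 4 * |s - s'| := by ring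
      _ ≤ _ := by gcongr
  have hY : ∀ s s', |s| ≤ M.tau → |s'| ≤ M.tau →
      |crsY v (o s - o 0) - crsY v (o s' - o 0)| ≤ n / 4 * |s - s'| := by
    intro s s' hs hs'
    have e : crsY v (o s - o 0) - crsY v (o s' - o 0)
        = crsY v (o s - o s' - (s - s') • v) := by
      simp only [crsY, Prod.fst_sub, Prod.snd_sub, Prod.smul_fst, Prod.smul_snd, smul_eq_mul]; ring
    rw [e]
    refine (abs_crsY_le _ _).trans ?_
    calc _ ≤ 2 * ‖v‖ * (‖v‖ / 8 * |s - s'|) := by gcongr; exact hdiff s s' hs hs'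
      _ = ‖v‖ ^ 2 / 4 * |s - s'| := by ring
      _ ≤ _ := by gcongr
  have hnp : 0 < n := lt_of_lt_of_le (by positivity) hnv
  have hXn : ∀ s s', |s| ≤ M.tau → |s'| ≤ M.tau →
      n * (3 / 4) * |s - s'| ≤ |dotX v (o s - o 0) - dotX v (o s' - o 0)| := by
    intro s s' hs hs'
    have h1 := hX s s' hs hs'
    have h2 := abs_sub_abs_le_abs_sub (n * (s - s')) (dotX v (o s - o 0) - dotX v (o s' - o 0))
    rw [abs_sub_comm (n * (s - s')), abs_mul, abs_of_pos hnp] at h2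
    linarith
  let S : Set ℝ := {s | |s| ≤ M.tau}
  have hinj : ∀ s ∈ S, ∀ s' ∈ S, dotX v (o s - o 0) = dotX v (o s' - o 0) → s = s' := by
    intro s hs s' hs' h
    have := hXn s s' hs hs'
    rw [h, sub_self, abs_zero] at this
    have h2 : |s - s'| ≤ 0 := by
      by_contra hh; push Not at hh; nlinarith [mul_pos hnp hh]
    exact sub_eq_zero.1 (abs_nonpos_iff.1 h2)
  let f : ℝ → ℝ := fun s => dotX v (o s - o 0)
  let u : ℝ → ℝ := fun ξ => crsY v (o (Function.invFunOn f S ξ) - o 0)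
  have hu : ∀ s ∈ S, u (f s) = crsY v (o s - o 0) := by
    intro s hs
    have : Function.invFunOn f S (f s) = s := by
      have hex : ∃ a ∈ S, f a = f s := ⟨s, hs, rfl⟩
      exact hinj _ (Function.invFunOn_mem hex) _ hs (Function.invFunOn_eq hex)
    simp only [u, this]
  have hlip : LipschitzOnWith 1 u (f '' S) := by
    refine LipschitzOnWith.of_dist_le_mul ?_
    rintro _ ⟨s, hs, rfl⟩ _ ⟨s', hs', rfl⟩
    rw [hu s hs, hu s' hs', Real.dist_eq, Real.dist_eq, NNReal.coe_one, one_mul]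
    refine (hY s s' hs hs').trans (le_trans ?_ (hXn s s' hs hs'))
    nlinarith [mul_nonneg hnp.le (abs_nonneg (s - s'))]
  obtain ⟨F, hF, hFe⟩ := hlip.extend_real
  refine ⟨F, hF.continuous, fun s hs => ?_, fun y hy => ?_⟩
  · rw [← hu s hs]; exact (hFe ⟨s, hs, rfl⟩).symm
  · have hxy : |dotX v (y - o 0)| ≤ 3 / 4 * n * M.tau := by
      refine (abs_dotX_le _ _).trans ?_
      calc _ ≤ 2 * ‖v‖ * M.rho := by gcongr
        _ = ‖v‖ * (1 / M.cu) * M.tau / 2 := by unfold rho; field_simp; norm_num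
        _ ≤ ‖v‖ * ‖v‖ * M.tau / 2 := by gcongr
        _ ≤ _ := by nlinarith
    have hcont : ContinuousOn f (Icc (-M.tau) M.tau) := by
      have := ho.continuous
      simp only [f, dotX]; fun_prop
    have h0 : f 0 = 0 := by simp [f, dotX]
    have hp := hX M.tau 0 (by rw [abs_of_pos hτ]) (by simpa using hτ.le)
    have hm := hX (-M.tau) 0 (by rw [abs_neg, abs_of_pos hτ]) (by simpa using hτ.le)
    simp only [sub_self, sub_zero, abs_neg, abs_of_pos hτ] at hp hm
    rw [abs_le] at hp hm hxy
    have z : dotX v 0 = 0 := by simp [dotX]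
    rw [z] at hp hm
    have hmem : dotX v (y - o 0) ∈ Icc (f (-M.tau)) (f M.tau) := by
      simp only [f]
      constructor <;> linarith [hp.1, hm.2, hxy.1, hxy.2]
    obtain ⟨s, hs, hfs⟩ := intermediate_value_Icc (by linarith) hcont hmem
    have hs' : |s| ≤ M.tau := abs_le.2 hs
    refine ⟨s, hs', ?_, hfs⟩
    have h1 := hXn s 0 hs' (by simpa using hτ.le)
    simp only [sub_self, sub_zero, z] at h1
    change _ ≤ |f s| at h1
    rw [hfs] at h1
    have h2 := h1.trans (abs_dotX_le _ _)
    have h3 : ‖v‖ ^ 2 * (3 / 4) * |s| ≤ 2 * ‖v‖ * ‖y - o 0‖ :=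
      le_trans (by gcongr) h2
    have h4 : ‖v‖ * (3 / 4 * |s| * ‖v‖) ≤ ‖v‖ * (2 * ‖y - o 0‖) := by nlinarith
    have h5 := le_of_mul_le_mul_left h4 hvp
    have h6 : |s| * M.cu⁻¹ ≤ |s| * ‖v‖ := by
      gcongr; simpa using hv1
    nlinarith [norm_nonneg (y - o 0)]

lemma crsY_smul (v w : ℝ × ℝ) (t : ℝ) : crsY v (t • w) = t * crsY v w := by
  simp only [crsY, Prod.smul_fst, Prod.smul_snd, smul_eq_mul]; ring

lemma crsY_self (v : ℝ × ℝ) : crsY v v = 0 := by simp only [crsY]; ring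

lemma crsY_add (v w w' : ℝ × ℝ) : crsY v (w + w') = crsY v w + crsY v w' := by
  simp only [crsY, Prod.fst_add, Prod.snd_add]; ring

end TorusMetric

namespace TorusMetric
variable {M : TorusMetric}

/-- Two unit vectors at the same point with vanishing determinant agree up to sign. -/
lemma eq_or_neg_of_crsY {x v w : ℝ × ℝ} (hv : M.g x v v = 1) (hw : M.g x w w = 1)
    (h : crsY v w = 0) : w = v ∨ w = -v := by
  have hv0 : v ≠ 0 := by
    rintro rfl
    have := M.g_smul_smul x 0 0 0
    simp_all
  have hn : 0 < dotX v v := lt_of_lt_of_le (by have := norm_pos_iff.2 hv0; positivity) (dotX_self_ge v)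
  set a := dotX v w / dotX v v with ha
  have e : w = a • v := by
    apply eq_of_dotX_crsY hv0
    · have : dotX v (a • v) = a * dotX v v := by
        simp only [dotX, Prod.smul_fst, Prod.smul_snd, smul_eq_mul]; ring
      rw [this, ha]; field_simp
    · rw [h, crsY_smul, crsY_self, mul_zero]
  have h2 : a ^ 2 = 1 := by
    rw [e, M.g_smul_smul, hv] at hw; linarith
  rcases mul_eq_zero.1 (show (a - 1) * (a + 1) = 0 by linear_combination h2) with h | h
  · left; rw [e, sub_eq_zero.1 h, one_smul]
  · right; rw [e, eq_neg_of_add_eq_zero_left h, neg_one_smul]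

lemma deriv_rev (c : ℝ → ℝ × ℝ) (t : ℝ) :
    deriv (fun t => c (-t)) t = -deriv c (-t) := by
  rw [deriv_comp_neg]

lemma UG.side_zero {o σ : ℝ → ℝ × ℝ} (ho : M.UG o) (hσ : M.UG σ) {l t₀ : ℝ} (ht₀ : t₀ ∈ Icc 0 l)
    (hl : l ≤ M.rc) (hx : σ t₀ = o 0) {K : Set (ℝ × ℝ)} (hK : IsPreconnected K)
    (h0 : σ 0 ∈ K) (h1 : σ l ∈ K) (hKb : ∀ y ∈ K, ‖y - o 0‖ ≤ M.rho) :
    ∃ s, |s| ≤ M.tau ∧ o s ∈ K := by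
  by_contra! hno
  have hτ := M.tau_pos
  have hlτ : l ≤ M.tau := hl.trans (min_le_right _ _)
  have hlρ : l ≤ M.rho * M.cl := hl.trans ((min_le_left _ _).trans (min_le_left _ _))
  have hτs : M.tau ≤ M.rs := min_le_left _ _
  have hcl := M.cl_pos
  have hcu := M.cu_pos
  have hcd := M.cd_pos
  have hne0 : 0 < t₀ := by
    rcases ht₀.1.eq_or_lt with h | h
    · exact absurd h0 (by rw [h, hx]; exact hno 0 (by simpa using hτ.le))
    · exact h
  have hne1 : t₀ < l := by
    rcases ht₀.2.eq_or_lt with h | h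
    · exact absurd h1 (by rw [← h, hx]; exact hno 0 (by simpa using hτ.le))
    · exact h
  have hcoin : (∀ t, σ (t₀ + t) = o (0 + t)) ∨ (∀ t, σ (t₀ + t) = o (0 - t)) → False := by
    rintro (h | h)
    · have := h (-t₀)
      rw [show t₀ + -t₀ = 0 by ring] at this
      exact hno _ (by simpa [abs_of_pos hne0] using by linarith) (this ▸ h0)
    · have := h (-t₀)
      rw [show t₀ + -t₀ = 0 by ring] at this
      exact hno _ (by simpa [abs_of_pos hne0] using by linarith) (this ▸ h0)
  obtain ⟨F, hF, hFo, hFy⟩ := ho.exists_export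
  set v := deriv o 0 with hv
  have hv0 : v ≠ 0 := by
    have := ho.le_norm_deriv 0
    exact norm_pos_iff.1 (lt_of_lt_of_le (by positivity) this)
  set G : ℝ × ℝ → ℝ := fun y => crsY v (y - o 0) - F (dotX v (y - o 0)) with hG
  have hGc : Continuous G := by
    simp only [hG, crsY, dotX]; fun_prop
  have hσb : ∀ t, ‖σ t - o 0‖ ≤ 1 / M.cl * |t - t₀| := fun t => by rw [← hx]; exact hσ.norm_sub_le t₀ t
  have hσρ : ∀ t ∈ Icc 0 l, ‖σ t - o 0‖ ≤ M.rho := by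
    intro t ht
    refine (hσb t).trans ?_
    have : |t - t₀| ≤ l := abs_le.2 ⟨by linarith [ht.1, ht₀.2], by linarith [ht.2, ht₀.1]⟩
    rw [div_mul_eq_mul_div, one_mul, div_le_iff₀ hcl]; linarith
  have hzero : ∀ y, ‖y - o 0‖ ≤ M.rho → G y = 0 → ∃ s, |s| ≤ M.tau ∧ y = o s := by
    intro y hy hGy
    obtain ⟨s, hs, -, hs2⟩ := hFy y hy
    refine ⟨s, hs, ?_⟩
    have h3 := hFo s hs
    rw [hs2] at h3
    have : y - o 0 = o s - o 0 := eq_of_dotX_crsY hv0 hs2.symm (by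
      simp only [hG] at hGy; linarith)
    exact sub_left_injective this
  have hnz : ∀ t ∈ Icc 0 l, t ≠ t₀ → G (σ t) ≠ 0 := by
    intro t ht htt hGt
    obtain ⟨s, hs, hst⟩ := hzero _ (hσρ t ht) hGt
    refine hcoin (hσ.unique' ho (l := t - t₀) (l' := s) (sub_ne_zero.2 htt) ?_ (hs.trans hτs) hx ?_)
    · exact le_trans (abs_le.2 ⟨by linarith [ht.1], by linarith [ht.2]⟩) (hlτ.trans hτs)
    · rw [add_sub_cancel, zero_add, hst]
  set w := deriv σ t₀ with hw
  set D := crsY v w with hD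
  have hD0 : D ≠ 0 := by
    intro h
    have e1 := ho.g_deriv 0
    have e2 := hσ.g_deriv t₀
    rw [hx] at e2
    rcases eq_or_neg_of_crsY e1 e2 h with h | h
    · exact hcoin (.inl (hσ.eq_of ho hx h))
    · refine hcoin (.inr fun t => ?_)
      have := hσ.eq_of ho.rev (s := t₀) (s' := 0) (by simpa using hx) (by rw [deriv_rev]; simpa using h) t
      simpa using this
  obtain ⟨C, hC, hexp⟩ : ∃ C > 0, ∀ t, t₀ + t ∈ Icc 0 l → |G (σ (t₀ + t)) - t * D| ≤ C * t ^ 2 := by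
    refine ⟨2 * ‖v‖ * M.cd + 2 * ‖v‖ * (M.cd * (4 * M.cu / M.cl) ^ 2), ?_, fun t ht => ?_⟩
    · have := norm_pos_iff.2 hv0; positivity
    obtain ⟨s, hs, hs1, hs2⟩ := hFy _ (hσρ _ ht)
    have h3 := hFo s hs
    rw [hs2] at h3
    have e1 := hσ.norm_taylor_le t₀ (t₀ + t)
    have e2 := ho.norm_taylor_le 0 s
    rw [hx] at e1
    rw [add_sub_cancel_left, sq_abs] at e1
    rw [sub_zero, sq_abs] at e2
    have e4 : |s| ≤ 4 * M.cu / M.cl * |t| := by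
      have := hσb (t₀ + t)
      rw [add_sub_cancel_left] at this
      have h5 : |s| * M.cu⁻¹ ≤ 4 * (1 / M.cl * |t|) := hs1.trans (by linarith)
      rw [← div_eq_mul_inv, div_le_iff₀ hcu] at h5
      refine h5.trans_eq ?_; ring
    have e5 : s ^ 2 ≤ (4 * M.cu / M.cl) ^ 2 * t ^ 2 := by
      rw [← sq_abs s, ← sq_abs t, ← mul_pow]; gcongr
    have e6 : G (σ (t₀ + t)) - t * D = crsY v (σ (t₀ + t) - o 0 - t • w) - crsY v (o s - o 0 - s • v) := by
      simp only [hG]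
      rw [h3, hD, ← crsY_smul, sub_eq_add_neg (σ (t₀ + t) - o 0), crsY_add, sub_eq_add_neg (o s - o 0),
        crsY_add, ← neg_smul, ← neg_smul, crsY_smul v v, crsY_self, crsY_smul, crsY_smul]
      ring
    rw [e6]
    refine (abs_sub _ _).trans ?_
    have f1 := (abs_crsY_le v (σ (t₀ + t) - o 0 - t • w)).trans
      (mul_le_mul_of_nonneg_left e1 (by positivity))
    have f2 := (abs_crsY_le v (o s - o 0 - s • v)).trans
      (mul_le_mul_of_nonneg_left (e2.trans (mul_le_mul_of_nonneg_left e5 hcd.le)) (by positivity))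
    refine (add_le_add f1 f2).trans_eq ?_
    ring
  set δ := min (min t₀ (l - t₀)) (|D| / (2 * C)) with hδ
  have hδp : 0 < δ := lt_min (lt_min hne0 (by linarith)) (by positivity)
  have hδ1 : δ ≤ t₀ := (min_le_left _ _).trans (min_le_left _ _)
  have hδ2 : δ ≤ l - t₀ := (min_le_left _ _).trans (min_le_right _ _)
  have hδ3 : C * δ ^ 2 < δ * |D| := by
    have : δ ≤ |D| / (2 * C) := min_le_right _ _
    rw [le_div_iff₀ (by positivity)] at this
    nlinarith [abs_pos.2 hD0, mul_pos hδp (abs_pos.2 hD0)]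
  have hDD : D * D = |D| * |D| := (abs_mul_abs_self D).symm
  have hP : 0 < D * G (σ (t₀ + δ)) := by
    have := hexp δ ⟨by linarith, by linarith⟩
    have h2 : |D * (G (σ (t₀ + δ)) - δ * D)| < |D| * (δ * |D|) := by
      rw [abs_mul]; exact mul_lt_mul_of_pos_left (this.trans_lt hδ3) (abs_pos.2 hD0)
    have h3 := (abs_lt.1 h2).1
    nlinarith
  have hN : D * G (σ (t₀ - δ)) < 0 := by
    have := hexp (-δ) ⟨by linarith, by linarith⟩
    rw [neg_sq, ← sub_eq_add_neg] at this
    have h2 : |D * (G (σ (t₀ - δ)) - -δ * D)| < |D| * (δ * |D|) := by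
      rw [abs_mul]; exact mul_lt_mul_of_pos_left (this.trans_lt hδ3) (abs_pos.2 hD0)
    have h3 := (abs_lt.1 h2).2
    nlinarith
  have hcs : Continuous fun t => D * G (σ t) := by
    have := hσ.continuous; fun_prop
  have hP1 : 0 < D * G (σ l) := by
    by_contra! hle
    obtain ⟨t, ht, hGt⟩ := intermediate_value_Icc' (show t₀ + δ ≤ l by linarith) hcs.continuousOn
      (show (0 : ℝ) ∈ Icc (D * G (σ l)) (D * G (σ (t₀ + δ))) from ⟨hle, hP.le⟩)
    exact hnz t ⟨by linarith [ht.1], ht.2⟩ (by linarith [ht.1]) ((mul_eq_zero.1 hGt).resolve_left hD0)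
  have hN1 : D * G (σ 0) < 0 := by
    by_contra! hle
    obtain ⟨t, ht, hGt⟩ := intermediate_value_Icc' (show 0 ≤ t₀ - δ by linarith) hcs.continuousOn
      (show (0 : ℝ) ∈ Icc (D * G (σ (t₀ - δ))) (D * G (σ 0)) from ⟨hN.le, hle⟩)
    exact hnz t ⟨ht.1, by linarith [ht.2]⟩ (by linarith [ht.2]) ((mul_eq_zero.1 hGt).resolve_left hD0)
  obtain ⟨y, hyK, hy⟩ := hK.intermediate_value h0 h1 (f := fun y => D * G y) (by fun_prop)
    (show (0 : ℝ) ∈ Icc _ _ from ⟨hN1.le, hP1.le⟩)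
  obtain ⟨s, hs, hys⟩ := hzero y (hKb y hyK) ((mul_eq_zero.1 hy).resolve_left hD0)
  exact hno s hs (hys ▸ hyK)

/-- A connected set near a crossing point of a short geodesic `σ` with a geodesic `o`, containing
the endpoints of `σ`, meets `o`. -/
lemma UG.side {o σ : ℝ → ℝ × ℝ} (ho : M.UG o) (hσ : M.UG σ) {l t₀ s₀ : ℝ} (ht₀ : t₀ ∈ Icc 0 l)
    (hl : l ≤ M.rc) (hx : σ t₀ = o s₀) {K : Set (ℝ × ℝ)} (hK : IsPreconnected K)
    (h0 : σ 0 ∈ K) (h1 : σ l ∈ K) (hKb : ∀ y ∈ K, ‖y - o s₀‖ ≤ M.rho) :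
    ∃ s, |s - s₀| ≤ M.tau ∧ o s ∈ K := by
  obtain ⟨s, hs, hsK⟩ := (ho.shift s₀).side_zero hσ ht₀ hl (by simpa using hx) hK h0 h1 (by simpa using hKb)
  exact ⟨s₀ + s, by simpa using hs, hsK⟩

end TorusMetric

namespace TorusMetric
variable {M : TorusMetric}

/-- A `dist`-nonexpanding path `κ : [0, L] → ℝ²` from `A` to `B` avoiding `O`. -/
structure LP (M : TorusMetric) (O : Set (ℝ × ℝ)) (L : ℝ) (A B : ℝ × ℝ) (κ : ℝ → ℝ × ℝ) : Prop where
  len : 0 ≤ L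
  start : κ 0 = A
  finish : κ L = B
  lip : ∀ s t, 0 ≤ s → s ≤ t → t ≤ L → M.dist (κ s) (κ t) ≤ t - s
  avoid : ∀ s, 0 ≤ s → s ≤ L → κ s ∉ O

variable {O : Set (ℝ × ℝ)} {A B C : ℝ × ℝ} {L L' : ℝ} {κ κ' : ℝ → ℝ × ℝ}

lemma LP.norm_le (h : M.LP O L A B κ) {s t : ℝ} (hs : s ∈ Icc 0 L) (ht : t ∈ Icc 0 L) :
    ‖κ s - κ t‖ ≤ 1 / M.cl * |s - t| := by
  have key : ∀ s t, s ∈ Icc 0 L → t ∈ Icc 0 L → s ≤ t → ‖κ s - κ t‖ ≤ 1 / M.cl * |s - t| := by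
    intro s t hs ht hst
    have h1 := (M.le_dist (κ s) (κ t)).trans (h.lip s t hs.1 hst ht.2)
    rw [abs_sub_comm, abs_of_nonneg (by linarith : 0 ≤ t - s), div_mul_eq_mul_div, one_mul,
      le_div_iff₀ M.cl_pos]
    linarith
  rcases le_total s t with h1 | h1
  · exact key s t hs ht h1
  · rw [norm_sub_rev, abs_sub_comm]; exact key t s ht hs h1

lemma LP.continuousOn (h : M.LP O L A B κ) : ContinuousOn κ (Icc 0 L) := by
  have hcl := M.cl_pos
  have : LipschitzOnWith (⟨1 / M.cl, by positivity⟩ : NNReal) κ (Icc 0 L) := by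
    refine LipschitzOnWith.of_dist_le_mul fun s hs t ht => ?_
    rw [dist_eq_norm, Real.dist_eq]
    exact h.norm_le hs ht
  exact this.continuousOn

lemma LP.trans (h : M.LP O L A B κ) (h' : M.LP O L' B C κ') : ∃ κ'', M.LP O (L + L') A C κ'' := by
  have hl := h.len
  have hl' := h'.len
  refine ⟨fun s => if s ≤ L then κ s else κ' (s - L), by linarith, by simp [hl, h.start], ?_, ?_, ?_⟩
  · split_ifs with h1
    · have : L' = 0 := by linarith
      rw [this, add_zero, h.finish, ← h'.start, ← h'.finish, this]
    · simpa using h'.finish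
  · intro s t hs hst ht
    by_cases h1 : t ≤ L
    · simp only [h1, hst.trans h1, if_true]
      exact h.lip s t hs hst h1
    · by_cases h2 : s ≤ L
      · simp only [h1, h2, if_true, if_false]
        push Not at h1
        have e1 := h.lip s L hs h2 le_rfl
        have e2 := h'.lip 0 (t - L) le_rfl (by linarith) (by linarith)
        rw [h.finish] at e1
        rw [h'.start] at e2
        linarith [M.dist_triangle' (κ s) B (κ' (t - L))]
      · simp only [h1, h2, if_false]
        push Not at h1 h2
        have := h'.lip (s - L) (t - L) (by linarith) (by linarith) (by linarith)
        linarith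
  · intro s hs hsl
    split_ifs with h1
    · exact h.avoid s hs h1
    · push Not at h1
      exact h'.avoid _ (by linarith) (by linarith)

lemma LP.restrict (h : M.LP O L A B κ) {a b : ℝ} (ha : 0 ≤ a) (hab : a ≤ b) (hb : b ≤ L) :
    M.LP O (b - a) (κ a) (κ b) (fun s => κ (a + s)) := by
  refine ⟨by linarith, by simp, by simp, fun s t hs hst ht => ?_, fun s hs ht => ?_⟩
  · have := h.lip (a + s) (a + t) (by linarith) (by linarith) (by linarith)
    linarith
  · exact h.avoid _ (by linarith) (by linarith)

lemma UG.lp {σ : ℝ → ℝ × ℝ} (hσ : M.UG σ) {l : ℝ} (hl : 0 ≤ l) (h : ∀ t ∈ Icc 0 l, σ t ∉ O) :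
    M.LP O l (σ 0) (σ l) σ :=
  ⟨hl, rfl, rfl, fun s t _ hst _ => by simpa [abs_of_nonneg (sub_nonneg.2 hst)] using hσ.dist_le s t,
    fun s h0 h1 => h s ⟨h0, h1⟩⟩

lemma exists_lp_seg (h : ∀ t ∈ Icc (0 : ℝ) 1, A + t • (B - A) ∉ O) :
    ∃ κ, M.LP O (M.cu * ‖A - B‖) A B κ := by
  have hcu := M.cu_pos
  rcases eq_or_ne A B with rfl | hne
  · refine ⟨fun _ => A, by simp, rfl, rfl, fun s t _ hst _ => by simpa using hst, fun s _ _ => ?_⟩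
    simpa using h 0 (by simp)
  have hD : 0 < M.cu * ‖A - B‖ := mul_pos hcu (norm_pos_iff.2 (sub_ne_zero.2 hne))
  refine ⟨fun s => A + (s / (M.cu * ‖A - B‖)) • (B - A), hD.le, by simp, ?_, ?_, ?_⟩
  · rw [div_self hD.ne']; simp
  · intro s t _ hst _
    refine (M.dist_le _ _).trans_eq ?_
    rw [add_sub_add_left_eq_sub, ← sub_smul, norm_smul, norm_sub_rev B A, Real.norm_eq_abs, ← sub_div,
      abs_div, abs_of_pos hD, abs_sub_comm, abs_of_nonneg (sub_nonneg.2 hst)]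
    have : ‖A - B‖ ≠ 0 := norm_ne_zero_iff.2 (sub_ne_zero.2 hne)
    field_simp
  · intro s hs hs'
    exact h _ ⟨by positivity, (div_le_one hD).2 hs'⟩

lemma LP.dist_le (h : M.LP O L A B κ) : M.dist A B ≤ L := by
  have := h.lip 0 L le_rfl h.len le_rfl
  rw [h.start, h.finish] at this; linarith

/-- Short geodesic shortcuts of paths starting at `A` and avoiding `O` still avoid `O`. -/
def CC (M : TorusMetric) (O : Set (ℝ × ℝ)) (A : ℝ × ℝ) : Prop :=
  ∀ L B κ, M.LP O L A B κ → ∀ a b, 0 ≤ a → a ≤ b → b ≤ L → b - a ≤ M.rc / 4 →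
    ∀ σ, M.UG σ → ∀ l, 0 ≤ l → l ≤ b - a → σ 0 = κ a → σ l = κ b → ∀ t ∈ Icc 0 l, σ t ∉ O

lemma cc_empty (A : ℝ × ℝ) : M.CC ∅ A := fun _ _ _ _ _ _ _ _ _ _ _ _ _ _ _ _ _ _ _ => id

set_option maxHeartbeats 1600000 in
/-- The polygon of a nearly minimal path is nearly geodesic. -/
lemma exists_min (hcc : M.CC O A) (hne : ∃ L κ, M.LP O L A B κ) (hAB : A ≠ B) :
    ∃ L₀ > 0, (∀ L κ, M.LP O L A B κ → L₀ ≤ L) ∧ ∀ η > 0, ∃ c, M.UG c ∧ c 0 = A ∧ c L₀ = B ∧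
      ∀ ε > 0, ∃ L κ, M.LP O L A B κ ∧ L ≤ L₀ + ε ∧ ∀ s ∈ Icc 0 L₀, ‖κ s - c s‖ ≤ η := by
  have hcl := M.cl_pos
  have hrc := M.rc_pos
  have hrcj : M.rc ≤ M.rj := (min_le_left _ _).trans (min_le_right _ _)
  have hrcs : M.rc ≤ M.rs := hrcj.trans M.rj_le
  let S : Set ℝ := {L | ∃ κ, M.LP O L A B κ}
  have hSne : S.Nonempty := hne
  have hSb : BddBelow S := ⟨M.dist A B, by rintro L ⟨κ, h⟩; exact h.dist_le⟩
  have hdp : 0 < M.dist A B := by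
    by_contra! h
    exact hAB (M.eq_of_dist h)
  set L₀ := sInf S with hL₀
  have hL₀p : 0 < L₀ := hdp.trans_le (le_csInf hSne (by rintro L ⟨κ, h⟩; exact h.dist_le))
  have hmin : ∀ L κ, M.LP O L A B κ → L₀ ≤ L := fun L κ h => csInf_le hSb ⟨κ, h⟩
  refine ⟨L₀, hL₀p, hmin, fun η hη => ?_⟩
  have hex : ∀ n : ℕ, ∃ L κ, M.LP O L A B κ ∧ L < L₀ + 1 / ((n : ℝ) + 1) := by
    intro n
    obtain ⟨L, ⟨κ, h⟩, hL⟩ := exists_lt_of_csInf_lt hSne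
      (show sInf S < L₀ + 1 / ((n : ℝ) + 1) by rw [← hL₀]; linarith [show (0:ℝ) < 1 / ((n : ℝ) + 1) by positivity])
    exact ⟨L, κ, h, hL⟩
  choose Ls κs hLP hLs using hex
  have hLs1 : ∀ n, Ls n ≤ L₀ + 1 := fun n => (hLs n).le.trans (by
    have : 1 / ((n : ℝ) + 1) ≤ 1 := by
      rw [div_le_one (by positivity)]; linarith [show (0:ℝ) ≤ n by positivity]
    linarith)
  have hLt : Tendsto Ls atTop (𝓝 L₀) := by
    refine tendsto_of_tendsto_of_tendsto_of_le_of_le tendsto_const_nhds ?_ (fun n => hmin _ _ (hLP n))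
      (fun n => (hLs n).le)
    simpa using (tendsto_const_nhds (x := L₀)).add tendsto_one_div_add_atTop_nhds_zero_nat
  obtain ⟨N, hN⟩ := exists_nat_gt (max 2 (max (8 * (L₀ + 1) / M.rc) (4 * L₀ / (M.cl * η))))
  have hN2 : (2 : ℝ) < N := (le_max_left _ _).trans_lt hN
  have hNp : (0 : ℝ) < N := by linarith
  have hNr : 2 * (L₀ + 1) / N ≤ M.rc / 4 := by
    have : 8 * (L₀ + 1) / M.rc < N := ((le_max_left _ _).trans (le_max_right _ _)).trans_lt hN
    rw [div_lt_iff₀ hrc] at this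
    rw [div_le_iff₀ hNp]; linarith
  have hNη : 2 * (L₀ / N) ≤ M.cl * η / 2 := by
    have : 4 * L₀ / (M.cl * η) < N := ((le_max_right _ _).trans (le_max_right _ _)).trans_lt hN
    rw [div_lt_iff₀ (by positivity)] at this
    rw [← mul_div_assoc, div_le_iff₀ hNp]; linarith
  have hN2' : 2 ≤ N := by exact_mod_cast hN2.le
  let q : ℕ → ℝ := fun i => (min i N : ℕ) / (N : ℝ)
  have hq0 : ∀ i, 0 ≤ q i := fun i => by positivity
  have hq1 : ∀ i, q i ≤ 1 := fun i => by
    rw [div_le_one hNp]; exact_mod_cast min_le_right _ _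
  have hqi : ∀ i, i ≤ N → q i = i / N := fun i hi => by simp only [q, min_eq_left hi]
  have hmem : ∀ n i, q i * Ls n ∈ Icc 0 (Ls n) := fun n i =>
    ⟨mul_nonneg (hq0 i) (hLP n).len, mul_le_of_le_one_left (hLP n).len (hq1 i)⟩
  let X : ℕ → ℕ → ℝ × ℝ := fun n i => κs n (q i * Ls n)
  have hXK : ∀ n, X n ∈ Set.pi univ (fun _ : ℕ => Metric.closedBall A (1 / M.cl * (L₀ + 1))) := by
    intro n i _
    rw [Metric.mem_closedBall, dist_eq_norm, ← (hLP n).start]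
    refine ((hLP n).norm_le (hmem n i) ⟨le_rfl, (hLP n).len⟩).trans ?_
    rw [sub_zero, abs_of_nonneg (hmem n i).1]
    gcongr
    exact (hmem n i).2.trans (hLs1 n)
  obtain ⟨x, -, φ, hφ, hx⟩ := (isCompact_univ_pi fun _ : ℕ => isCompact_closedBall A _).tendsto_subseq hXK
  have hx' : ∀ i, Tendsto (fun n => X (φ n) i) atTop (𝓝 (x i)) := tendsto_pi_nhds.1 hx
  have hLφ : Tendsto (fun n => Ls (φ n)) atTop (𝓝 L₀) := hLt.comp hφ.tendsto_atTop
  set m := L₀ / N with hm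
  have hmp : 0 < m := by positivity
  have hd : ∀ i j, Tendsto (fun n => M.dist (X (φ n) i) (X (φ n) j)) atTop (𝓝 (M.dist (x i) (x j))) :=
    fun i j => (M.continuous_dist.tendsto (x i, x j)).comp ((hx' i).prodMk_nhds (hx' j))
  have hd1 : ∀ i, i + 1 ≤ N → M.dist (x i) (x (i + 1)) ≤ m := by
    intro i hi
    refine le_of_tendsto_of_tendsto' (hd i (i + 1)) (hLφ.div_const (N : ℝ)) fun n => ?_
    have := (hLP (φ n)).lip (q i * Ls (φ n)) (q (i + 1) * Ls (φ n)) (hmem _ _).1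
      (by gcongr
          · exact (hLP (φ n)).len
          · rw [hqi i (by omega), hqi _ hi]; gcongr; simp) (hmem _ _).2
    refine this.trans_eq ?_
    rw [hqi i (by omega), hqi _ hi]; push_cast; ring
  have hm2 : 2 * m ≤ M.rc / 4 := by
    refine le_trans ?_ hNr
    rw [hm, ← mul_div_assoc]; gcongr; linarith
  have hd2 : ∀ i, i + 2 ≤ N → 2 * m ≤ M.dist (x i) (x (i + 2)) := by
    intro i hi
    have hlim : Tendsto (fun n => L₀ - (Ls (φ n) - 2 * (Ls (φ n) / N))) atTop (𝓝 (L₀ - (L₀ - 2 * (L₀ / N)))) :=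
      tendsto_const_nhds.sub (hLφ.sub ((hLφ.div_const (N : ℝ)).const_mul 2))
    rw [sub_sub_cancel] at hlim
    refine le_of_tendsto_of_tendsto' hlim (hd i (i + 2)) fun n => ?_
    have hP := hLP (φ n)
    set a := q i * Ls (φ n) with ha
    set b := q (i + 2) * Ls (φ n) with hb
    have hba : b - a = 2 * (Ls (φ n) / N) := by
      rw [ha, hb, hqi i (by omega), hqi _ hi]; push_cast; ring
    have hab : a ≤ b := by
      have : 0 ≤ 2 * (Ls (φ n) / N) := by have := hP.len; positivity
      linarith
    have hbr : b - a ≤ M.rc / 4 := by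
      rw [hba]; refine le_trans ?_ hNr
      rw [← mul_div_assoc]; gcongr; exact hLs1 _
    have hl := hP.lip a b (hmem _ _).1 hab (hmem _ _).2
    obtain ⟨σ, hσ, h0, h1⟩ := M.exists_ug_join (x := κs (φ n) a) (y := κs (φ n) b)
      (hl.trans (by linarith))
    have hP2 := hσ.lp (M.dist_nonneg' _ _) (hcc _ _ _ hP a b (hmem _ _).1 hab (hmem _ _).2 hbr σ hσ _
      (M.dist_nonneg' _ _) hl h0 h1)
    rw [h0, h1] at hP2
    have hP1 := hP.restrict le_rfl (hmem (φ n) i).1 (hmem (φ n) i).2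
    have hP3 := hP.restrict (hmem (φ n) (i + 2)).1 (hmem (φ n) (i + 2)).2 le_rfl
    rw [hP.start] at hP1
    rw [hP.finish] at hP3
    obtain ⟨κ1, hκ1⟩ := hP1.trans hP2
    obtain ⟨κ2, hκ2⟩ := hκ1.trans hP3
    have := hmin _ _ hκ2
    change _ ≤ M.dist (κs (φ n) a) (κs (φ n) b)
    linarith
  have hd1e : ∀ i, i + 2 ≤ N → M.dist (x i) (x (i + 1)) = m ∧ M.dist (x (i + 1)) (x (i + 2)) = m ∧
      M.dist (x i) (x (i + 2)) = 2 * m := by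
    intro i hi
    have a1 := hd1 i (by omega)
    have a2 := hd1 (i + 1) (by omega)
    have a3 := hd2 i hi
    have a4 := M.dist_triangle' (x i) (x (i + 1)) (x (i + 2))
    rw [add_assoc] at a2
    refine ⟨?_, ?_, ?_⟩ <;> linarith
  have hσ : ∀ i, i + 2 ≤ N → ∃ σ, M.UG σ ∧ σ 0 = x i ∧ σ m = x (i + 1) ∧ σ (2 * m) = x (i + 2) := by
    intro i hi
    obtain ⟨a1, a2, a3⟩ := hd1e i hi
    obtain ⟨σ, hσ, h0, h1⟩ := M.exists_ug_join (x := x i) (y := x (i + 2)) (by rw [a3]; linarith)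
    rw [a3] at h1
    have := hσ.eq_of_dist_add_le (s := 0) (l := 2 * m) (m := x (i + 1)) (by linarith) (by linarith)
      (by rw [zero_add, h0, h1, a1, a2]; linarith)
    rw [zero_add, h0, a1] at this
    exact ⟨σ, hσ, h0, this.symm, h1⟩
  obtain ⟨c, hc, hc0, hc1, -⟩ := hσ 0 (by omega)
  have hci : ∀ i, i + 1 ≤ N → c (i * m) = x i ∧ c ((i + 1 : ℕ) * m) = x (i + 1) := by
    intro i
    induction i with
    | zero => intro _; simpa using ⟨hc0, hc1⟩
    | succ i ih =>
      intro hi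
      obtain ⟨b1, b2⟩ := ih (by omega)
      refine ⟨b2, ?_⟩
      obtain ⟨σ, hσ, h0, h1, h2⟩ := hσ i hi
      have := hc.unique hσ (s := i * m) (s' := 0) hmp (by linarith) (by rw [b1, h0])
        (by rw [zero_add, h1, ← b2]; push_cast; congr 1; ring) (2 * m)
      rw [zero_add, h2] at this
      rw [add_assoc, ← this]; push_cast; congr 1; ring
  have hci' : ∀ i, i ≤ N → c (i * m) = x i := by
    intro i hi
    rcases hi.lt_or_eq with h | rfl
    · exact (hci i h).1
    · have := (hci (i - 1) (by omega)).2
      rwa [Nat.sub_add_cancel (by omega)] at this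
  have hq00 : q 0 = 0 := by simp [q]
  have hqN : q N = 1 := by rw [hqi N le_rfl]; exact div_self hNp.ne'
  refine ⟨c, hc, ?_, ?_, fun ε hε => ?_⟩
  · rw [hc0]
    refine tendsto_nhds_unique (hx' 0) ?_
    simp only [X, hq00, zero_mul, (hLP _).start, tendsto_const_nhds]
  · have := hci' N le_rfl
    rw [hm, mul_div_cancel₀ _ hNp.ne'] at this
    rw [this]
    refine tendsto_nhds_unique (hx' N) ?_
    simp only [X, hqN, one_mul, (hLP _).finish, tendsto_const_nhds]
  · have e1 : ∀ᶠ n in atTop, Ls (φ n) < L₀ + min ε (M.cl * η / 4) :=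
      hLφ.eventually (gt_mem_nhds (lt_add_of_pos_right _ (by positivity)))
    have e2 : ∀ᶠ n in atTop, ∀ i ∈ Finset.range (N + 1), ‖X (φ n) i - x i‖ < η / 4 := by
      rw [Finset.eventually_all]
      intro i _
      have := Metric.tendsto_nhds.1 (hx' i) (η / 4) (by positivity)
      simpa only [dist_eq_norm] using this
    obtain ⟨n, hn1, hn2⟩ := (e1.and e2).exists
    have hP := hLP (φ n)
    refine ⟨_, _, hP, hn1.le.trans (by linarith [min_le_left ε (M.cl * η / 4)]), fun s hs => ?_⟩
    have hLL := hmin _ _ hP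
    have hdL : Ls (φ n) - L₀ ≤ M.cl * η / 4 := by linarith [min_le_right ε (M.cl * η / 4)]
    set i := ⌊s / m⌋₊ with hi
    have hi1 : i * m ≤ s := by
      rw [← le_div_iff₀ hmp]; exact Nat.floor_le (by have := hs.1; positivity)
    have hi2 : s < (i + 1) * m := by
      rw [← div_lt_iff₀ hmp]; exact Nat.lt_floor_add_one _
    have hiN : i ≤ N := by
      have : (i : ℝ) * m ≤ N * m := by
        rw [hm, mul_div_cancel₀ _ hNp.ne', ← hm]; exact hi1.trans hs.2
      exact_mod_cast le_of_mul_le_mul_right this hmp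
    have hiN1 : (i : ℝ) / N ≤ 1 := by rw [div_le_one hNp]; exact_mod_cast hiN
    have f1 : ‖κs (φ n) s - X (φ n) i‖ ≤ 1 / M.cl * (m + (Ls (φ n) - L₀)) := by
      refine (hP.norm_le ⟨hs.1, hs.2.trans hLL⟩ (hmem _ _)).trans ?_
      gcongr
      rw [hqi i hiN]
      have g1 : (i : ℝ) / N * Ls (φ n) = i * m + i / N * (Ls (φ n) - L₀) := by rw [hm]; ring
      have g2 : (i : ℝ) / N * (Ls (φ n) - L₀) ≤ Ls (φ n) - L₀ :=
        mul_le_of_le_one_left (by linarith) hiN1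
      have g3 : 0 ≤ (i : ℝ) / N * (Ls (φ n) - L₀) := mul_nonneg (by positivity) (by linarith)
      rw [g1, abs_le]
      constructor <;> linarith
    have f2 := hn2 i (Finset.mem_range.2 (by omega))
    have f3 : ‖c (i * m) - c s‖ ≤ 1 / M.cl * m := by
      refine (hc.norm_sub_le s (i * m)).trans ?_
      gcongr
      rw [abs_le]
      constructor <;> linarith
    rw [← hci' i hiN] at f2
    have f4 : κs (φ n) s - c s = (κs (φ n) s - X (φ n) i) + (X (φ n) i - c (i * m)) + (c (i * m) - c s) := by abel
    rw [f4]
    refine (norm_add₃_le).trans ?_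
    have f5 : 1 / M.cl * (m + (Ls (φ n) - L₀)) + 1 / M.cl * m ≤ 3 / 4 * η := by
      rw [← mul_add, div_mul_eq_mul_div, one_mul, div_le_iff₀ hcl]; linarith
    linarith

end TorusMetric

namespace TorusMetric
variable {M : TorusMetric} {O : Set (ℝ × ℝ)} {A B C : ℝ × ℝ} {L L' : ℝ} {κ κ' : ℝ → ℝ × ℝ}

lemma LP.trans_lat (h : M.LP ∅ L A B κ) (k : ℤ × ℤ) :
    M.LP ∅ L (A + lat k) (B + lat k) (fun s => κ s + lat k) :=
  ⟨h.len, by rw [h.start], by rw [h.finish], fun s t h0 h1 h2 => by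
    rw [M.dist_add_lat]; exact h.lip s t h0 h1 h2, fun _ _ _ => id⟩

lemma lat_ne_zero {k : ℤ × ℤ} (hk : k ≠ 0) : lat k ≠ 0 := by
  intro h
  apply hk
  have h1 := congrArg Prod.fst h
  have h2 := congrArg Prod.snd h
  simp only [lat, Prod.fst_zero, Prod.snd_zero, Int.cast_eq_zero] at h1 h2
  exact Prod.ext h1 h2

/-- Any two distinct points are joined by a geodesic that is shortest among nonexpanding paths. -/
lemma exists_shortest (hAB : A ≠ B) : ∃ L₀ > 0, (∀ L κ, M.LP ∅ L A B κ → L₀ ≤ L) ∧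
    (∃ c, M.UG c ∧ c 0 = A ∧ c L₀ = B) := by
  obtain ⟨L₀, h0, h1, h2⟩ := exists_min (M := M) (cc_empty A)
    ⟨_, exists_lp_seg (A := A) (B := B) (fun _ _ => id)⟩ hAB
  obtain ⟨c, hc, ha, hb, -⟩ := h2 1 one_pos
  exact ⟨L₀, h0, h1, c, hc, ha, hb⟩

/-- Every nontrivial translation has an axis. -/
lemma exists_closed (M : TorusMetric) {k : ℤ × ℤ} (hk : k ≠ 0) :
    ∃ α, M.UG α ∧ ∃ l > 0, ∀ t, α (t + l) = α t + lat k := by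
  have hne : ∀ x : ℝ × ℝ, x ≠ x + lat k := fun x h => lat_ne_zero hk (by simpa using h)
  choose f hf0 hfmin c hc hc0 hc1 using fun x => exists_shortest (M := M) (hne x)
  have hlp : ∀ x, M.LP ∅ (f x) x (x + lat k) (c x) := fun x => by
    have := (hc x).lp (O := ∅) (hf0 x).le (fun _ _ => id)
    rwa [hc0, hc1] at this
  have hfl : ∀ x y, f x ≤ f y + 2 * M.cu * ‖x - y‖ := by
    intro x y
    obtain ⟨κ1, h1⟩ := exists_lp_seg (M := M) (O := ∅) (A := x) (B := y) (fun _ _ => id)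
    obtain ⟨κ2, h2⟩ := exists_lp_seg (M := M) (O := ∅) (A := y + lat k) (B := x + lat k) (fun _ _ => id)
    obtain ⟨κ3, h3⟩ := h1.trans (hlp y)
    obtain ⟨κ4, h4⟩ := h3.trans h2
    have := hfmin x _ _ h4
    rw [add_sub_add_right_eq_sub, norm_sub_rev y x] at this
    linarith
  have hfc : Continuous f := by
    have hcu := M.cu_pos
    have : LipschitzWith (⟨2 * M.cu, by positivity⟩ : NNReal) f := by
      refine LipschitzWith.of_dist_le_mul fun x y => ?_
      rw [Real.dist_eq, dist_eq_norm]
      change _ ≤ 2 * M.cu * ‖x - y‖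
      rw [abs_le]
      have a := hfl x y
      have b := hfl y x
      rw [norm_sub_rev] at b
      constructor <;> linarith
    exact this.continuous
  have hfp : ∀ x j, f x ≤ f (x + lat j) := by
    intro x j
    have := (hlp (x + lat j)).trans_lat (-j)
    rw [show x + lat j + lat (-j) = x by rw [lat_neg]; abel,
      show x + lat j + lat k + lat (-j) = x + lat k by rw [lat_neg]; abel] at this
    exact hfmin x _ _ this
  obtain ⟨x, -, hx⟩ := (isCompact_Icc (a := (0 : ℝ × ℝ)) (b := 1)).exists_isMinOn
    ⟨0, by simp⟩ hfc.continuousOn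
  have hxm : ∀ y, f x ≤ f y := by
    intro y
    obtain ⟨j, z, hz, rfl⟩ := exists_lat_add y
    exact (hx hz).trans (hfp z j)
  set l := f x with hl
  have hlp0 : 0 < l := hf0 x
  refine ⟨c x, hc x, l, hlp0, fun t => ?_⟩
  set s := min (M.rj / 2) (l / 2) with hs
  have hrj := M.rj_pos
  have hsp : 0 < s := by positivity
  have hs1 : 2 * s ≤ M.rj := by linarith [min_le_left (M.rj / 2) (l / 2)]
  have hs2 : 2 * s ≤ l := by linarith [min_le_right (M.rj / 2) (l / 2)]
  have hU := hc x
  have e1 : M.dist (c x (l - s)) (c x l) ≤ s := (hU.dist_le _ _).trans_eq (by simp [abs_of_pos hsp])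
  have e2 : M.dist (c x l) (c x s + lat k) ≤ s := by
    rw [hl, hc1]
    have := hU.dist_le 0 s
    rw [hc0, sub_zero, abs_of_pos hsp] at this
    rwa [M.dist_add_lat]
  have e3 := M.dist_triangle' (c x (l - s)) (c x l) (c x s + lat k)
  obtain ⟨σ, hσ, σ0, σ1⟩ := M.exists_ug_join (x := c x (l - s)) (y := c x s + lat k) (by linarith)
  have e4 : 2 * s ≤ M.dist (c x (l - s)) (c x s + lat k) := by
    have h1 := (hU.shift s).lp (O := ∅) (l := l - 2 * s) (by linarith) (fun _ _ => id)
    have h2 := hσ.lp (O := ∅) (M.dist_nonneg' (c x (l - s)) (c x s + lat k)) (fun _ _ => id)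
    rw [σ0, σ1] at h2
    rw [add_zero, show s + (l - 2 * s) = l - s by ring] at h1
    obtain ⟨κ1, h3⟩ := h1.trans h2
    have := hfmin (c x s) _ _ h3
    linarith [hxm (c x s)]
  have e5 : M.dist (c x (l - s)) (c x s + lat k) = 2 * s := by linarith
  rw [e5] at σ1
  have hrs := M.rj_le
  have e6 : c x l = σ s := by
    have := hσ.eq_of_dist_add_le (s := 0) (l := 2 * s) (m := c x l) (by linarith) (by linarith)
      (by rw [zero_add, σ0, σ1]; linarith)
    rw [this, zero_add, σ0]
    congr 1; linarith
  have h1 := hU.unique hσ (s := l - s) (s' := 0) hsp (by linarith) σ0.symm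
    (by rw [sub_add_cancel, zero_add, e6]) (s + t)
  have h2 := (hU.trans k).unique hσ (s := 0) (s' := s) hsp (by linarith)
    (by rw [hc0, ← e6, hl, hc1]) (by rw [zero_add, ← σ1]; congr 1; ring) t
  rw [zero_add] at h2
  rw [h2, ← zero_add (s + t), ← h1]; congr 1; ring

lemma norm_le_dist (x y : ℝ × ℝ) {r : ℝ} (h : M.dist x y ≤ r) : ‖x - y‖ ≤ 1 / M.cl * r := by
  have := M.le_dist x y
  rw [div_mul_eq_mul_div, one_mul, le_div_iff₀ M.cl_pos]; linarith

lemma norm_le_rho {x y : ℝ × ℝ} (h : M.dist x y ≤ M.rc) : ‖x - y‖ ≤ M.rho := by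
  refine (norm_le_dist _ _ h).trans ?_
  rw [div_mul_eq_mul_div, one_mul, div_le_iff₀ M.cl_pos]
  exact (min_le_left _ _).trans (min_le_left _ _)

/-- `O` contains a chord of a geodesic through `x`, or `x` lies on a geodesic arc in `O` ending on
a complete geodesic in `O`. -/
def Chord (M : TorusMetric) (O : Set (ℝ × ℝ)) (x : ℝ × ℝ) : Prop :=
  (∃ o s₀, M.UG o ∧ o s₀ = x ∧ ∀ s, |s - s₀| ≤ M.tau → o s ∈ O) ∨
  ∃ D s₁ s₀ c t₀, M.UG D ∧ M.UG c ∧ D s₁ = x ∧ s₁ ≤ s₀ ∧ (∀ s ≤ s₀, |s - s₁| ≤ M.tau → D s ∈ O) ∧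
    (∀ t, c t ∈ O) ∧ c t₀ = D s₀

lemma cc_of_chord (h : ∀ L B κ, M.LP O L A B κ → ∀ s ∈ Icc 0 L, ∀ x ∈ O, M.dist (κ s) x ≤ M.rc / 4 →
    M.Chord O x) : M.CC O A := by
  intro L B κ hκ a b ha hab hb hr σ hσ l hl0 hl σ0 σ1 t ht hO
  have hrc := M.rc_pos
  have hd1 : ∀ u ∈ Icc a b, M.dist (κ a) (κ u) ≤ M.rc / 4 := fun u hu =>
    (hκ.lip a u ha hu.1 (hu.2.trans hb)).trans (by linarith [hu.2])
  have hd2 : ∀ u ∈ Icc 0 l, M.dist (κ a) (σ u) ≤ M.rc / 4 := fun u hu => by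
    rw [← σ0]; refine (hσ.dist_le 0 u).trans ?_
    rw [sub_zero, abs_of_nonneg hu.1]; linarith [hu.2]
  set K : Set (ℝ × ℝ) := κ '' Icc a b with hK
  have hKp : IsPreconnected K := isPreconnected_Icc.image _ (hκ.continuousOn.mono (Icc_subset_Icc ha hb))
  have hKO : ∀ y ∈ K, y ∉ O := by
    rintro _ ⟨u, hu, rfl⟩; exact hκ.avoid u (ha.trans hu.1) (hu.2.trans hb)
  have hσ0 : σ 0 ∈ K := ⟨a, ⟨le_rfl, hab⟩, σ0.symm⟩
  have hσ1 : σ l ∈ K := ⟨b, ⟨hab, le_rfl⟩, σ1.symm⟩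
  have hlr : l ≤ M.rc := by linarith
  have hKd : ∀ y ∈ K, M.dist (κ a) y ≤ M.rc / 4 := by
    rintro _ ⟨u, hu, rfl⟩; exact hd1 u hu
  have hKb : ∀ u ∈ Icc 0 l, ∀ y ∈ K, ‖y - σ u‖ ≤ M.rho := fun u hu y hy => norm_le_rho (by
    have := M.dist_triangle' y (κ a) (σ u)
    rw [M.dist_comm' y (κ a)] at this
    linarith [hKd y hy, hd2 u hu])
  rcases h L B κ hκ a ⟨ha, hab.trans hb⟩ _ hO (hd2 t ht) with
    ⟨o, s₀, ho, ho0, hoO⟩ | ⟨D, s₁, s₀, c, t₀, hD, hc, hDx, hs, hDO, hcO, hcD⟩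
  · obtain ⟨s, hs, hsK⟩ := ho.side hσ ht hlr ho0.symm hKp hσ0 hσ1 (by rw [ho0]; exact hKb t ht)
    exact hKO _ hsK (hoO s hs)
  · obtain ⟨s', hs', hsK⟩ := hD.side hσ ht hlr hDx.symm hKp hσ0 hσ1 (by rw [hDx]; exact hKb t ht)
    rcases le_or_gt s' s₀ with hle | hgt
    · exact hKO _ hsK (hDO s' hle hs')
    have hss : s' - s₁ ≤ M.rc / 2 := by
      have h1 := hD.dist_eq (s := s₁) (t := s') (hs'.trans (min_le_left _ _))
      rw [hDx] at h1
      have h2 := M.dist_triangle' (σ t) (κ a) (D s')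
      rw [M.dist_comm' (σ t) (κ a)] at h2
      linarith [le_abs_self (s' - s₁), hKd _ hsK, hd2 t ht]
    set K' : Set (ℝ × ℝ) := K ∪ σ '' Icc 0 t with hK'
    have hKp' : IsPreconnected K' :=
      hKp.union (σ 0) hσ0 ⟨0, ⟨le_rfl, ht.1⟩, rfl⟩ (isPreconnected_Icc.image _ hσ.continuous.continuousOn)
    obtain ⟨t', -, htK⟩ := hc.side (hD.shift s₁) (l := s' - s₁) (t₀ := s₀ - s₁) (s₀ := t₀)
      ⟨by linarith, by linarith⟩ (by linarith) (by rw [add_sub_cancel, hcD]) hKp'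
      (.inr ⟨t, ⟨ht.1, le_rfl⟩, by rw [add_zero, hDx]⟩) (.inl (by rw [add_sub_cancel]; exact hsK))
      (fun y hy => norm_le_rho (by
        have h3 : M.dist (κ a) y ≤ M.rc / 4 := by
          rcases hy with hy | ⟨u, hu, rfl⟩
          · exact hKd y hy
          · exact hd2 u ⟨hu.1, hu.2.trans ht.2⟩
        have h4 := M.dist_triangle' y (κ a) (D s₁)
        have h5 := M.dist_triangle' y (D s₁) (D s₀)
        have h6 := hD.dist_le s₁ s₀
        rw [abs_of_nonneg (by linarith)] at h6
        rw [M.dist_comm' y (κ a)] at h4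
        rw [hcD]
        have h7 := hd2 t ht
        rw [← hDx] at h7
        linarith))
    rcases htK with htK | ⟨u, hu, hut⟩
    · exact hKO _ htK (hcO t')
    · have hu' : u ∈ Icc 0 l := ⟨hu.1, hu.2.trans ht.2⟩
      obtain ⟨s, -, hsK⟩ := hc.side hσ hu' hlr hut hKp hσ0 hσ1 (by rw [← hut]; exact hKb u hu')
      exact hKO _ hsK (hcO s)

end TorusMetric

/-- A path `κ` that passes on both sides of the barrier formed by the arc `β` and the ray from its
endpoint in direction `u` meets that barrier. -/
lemma exists_barrier_crossing {ξ h : ℝ × ℝ →L[ℝ] ℝ} {e u : ℝ × ℝ}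
    (hinj : ∀ x, ξ x = 0 → h x = 0 → x = 0)
    (hξe : 0 < ξ e) (hhe : h e = 0) (hξu : ξ u = 0) (hhu : 0 < h u) {κ β : ℝ → ℝ × ℝ} {a b t₁ t₂ : ℝ}
    (hab : a ≤ b) (ht : t₁ ≤ t₂) (hκ : ContinuousOn κ (Icc a b)) (hβ : ContinuousOn β (Icc t₁ t₂))
    (hbot : ∀ s ∈ Icc a b, h (β t₁) ≤ h (κ s)) (hL₁ : ξ (κ a) ≤ ξ (β t₂)) (hR₁ : ξ (β t₂) ≤ ξ (κ b))
    (hL : ∀ t ∈ Icc t₁ t₂, h (β t) = h (κ a) → ξ (κ a) ≤ ξ (β t))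
    (hR : ∀ t ∈ Icc t₁ t₂, h (β t) = h (κ b) → ξ (β t) ≤ ξ (κ b)) :
    ∃ s ∈ Icc a b, (∃ t ∈ Icc t₁ t₂, κ s = β t) ∨ (ξ (κ s) = ξ (β t₂) ∧ h (β t₂) ≤ h (κ s)) := by
  let p : ℝ → ℝ := fun s => max a (min b s)
  let r : ℝ → ℝ := fun t => max t₁ (min t₂ t)
  have hp : ∀ s, p s ∈ Icc a b := fun s => ⟨le_max_left _ _, max_le hab (min_le_left _ _)⟩
  have hr : ∀ s, r s ∈ Icc t₁ t₂ := fun s => ⟨le_max_left _ _, max_le ht (min_le_left _ _)⟩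
  have hpc : Continuous p := by fun_prop
  have hrc : Continuous r := by fun_prop
  have hκc : Continuous fun s => κ (p s) := hκ.comp_continuous hpc hp
  have hβc : Continuous fun s => β (r s) := hβ.comp_continuous hrc hr
  let κ' : ℝ → ℝ × ℝ := fun s => κ (p s) + (s - p s) • e
  let β' : ℝ → ℝ × ℝ := fun t => β (r t) + (t - r t) • u
  have hκ'c : Continuous κ' := hκc.add ((continuous_id.sub hpc).smul continuous_const)
  have hβ'c : Continuous β' := hβc.add ((continuous_id.sub hrc).smul continuous_const)
  have hκh : ∀ s, h (κ' s) = h (κ (p s)) := fun s => by simp [κ', hhe]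
  have hκξ : ∀ s, ξ (κ' s) = ξ (κ (p s)) + (s - p s) * ξ e := fun s => by simp [κ']
  have hβh : ∀ t, h (β' t) = h (β (r t)) + (t - r t) * h u := fun t => by simp [β']
  have hβξ : ∀ t, ξ (β' t) = ξ (β (r t)) := fun t => by simp [β', hξu]
  obtain ⟨X, hX⟩ := isCompact_Icc.exists_bound_of_continuousOn (ξ.continuous.comp_continuousOn hβ)
  obtain ⟨H, hH⟩ := isCompact_Icc.exists_bound_of_continuousOn (h.continuous.comp_continuousOn hκ)
  simp only [Real.norm_eq_abs, Function.comp] at hX hH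
  have hX0 : 0 ≤ X := (abs_nonneg _).trans (hX t₁ ⟨le_rfl, ht⟩)
  have hH0 : 0 ≤ H := (abs_nonneg _).trans (hH a ⟨le_rfl, hab⟩)
  set Y := (X + |ξ (κ a)| + |ξ (κ b)|) / ξ e with hY
  set Z := (H + |h (β t₂)|) / h u with hZ
  have hY0 : 0 ≤ Y := by positivity
  have hZ0 : 0 ≤ Z := by positivity
  have hYe : Y * ξ e = X + |ξ (κ a)| + |ξ (κ b)| := div_mul_cancel₀ _ hξe.ne'
  have hZe : Z * h u = H + |h (β t₂)| := div_mul_cancel₀ _ hhu.ne'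
  have pa : ∀ s ≤ a, p s = a := fun s hs => max_eq_left ((min_le_right _ _).trans hs)
  have pb : ∀ s, b ≤ s → p s = b := fun s hs => by simp only [p, min_eq_left hs, max_eq_right hab]
  have pm : ∀ s ∈ Icc a b, p s = s := fun s hs => by simp only [p, min_eq_right hs.2, max_eq_right hs.1]
  have rb : ∀ s, t₂ ≤ s → r s = t₂ := fun s hs => by simp only [r, min_eq_left hs, max_eq_right ht]
  have rm : ∀ s ∈ Icc t₁ t₂, r s = s := fun s hs => by simp only [r, min_eq_right hs.2, max_eq_right hs.1]
  obtain ⟨s, hs, t, htt, hst⟩ := exists_crossing hinj (show a - Y ≤ b + Y by linarith)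
    (show t₁ ≤ t₂ + Z by linarith) hκ'c.continuousOn hβ'c.continuousOn
    (fun t _ => by
      rw [hκξ, hβξ, pa _ (by linarith)]
      have := abs_le.1 (hX _ (hr t))
      nlinarith [le_abs_self (ξ (κ a)), abs_nonneg (ξ (κ b))])
    (fun t _ => by
      rw [hκξ, hβξ, pb _ (by linarith)]
      have := abs_le.1 (hX _ (hr t))
      nlinarith [neg_abs_le (ξ (κ b)), abs_nonneg (ξ (κ a))])
    (fun s _ => by
      rw [hκh, hβh, rm _ ⟨le_rfl, ht⟩, sub_self, zero_mul, add_zero]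
      exact hbot _ (hp s))
    (fun s _ => by
      rw [hκh, hβh, rb _ (by linarith)]
      have := abs_le.1 (hH _ (hp s))
      nlinarith [neg_abs_le (h (β t₂))])
  have e1 : h (κ (p s)) = h (β (r t)) + (t - r t) * h u := by rw [← hκh, ← hβh, hst]
  have e2 : ξ (κ (p s)) + (s - p s) * ξ e = ξ (β (r t)) := by rw [← hκξ, ← hβξ, hst]
  rcases lt_or_ge s a with h1 | h1
  · exfalso
    rw [pa s h1.le] at e1 e2
    have e3 : (s - a) * ξ e < 0 := mul_neg_of_neg_of_pos (by linarith) hξe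
    rcases le_total t t₂ with h2 | h2
    · rw [rm t ⟨htt.1, h2⟩] at e1 e2
      have := hL t ⟨htt.1, h2⟩ (by rw [e1]; ring)
      linarith
    · rw [rb t h2] at e2; linarith
  rcases lt_or_ge b s with h3 | h3
  · exfalso
    rw [pb s h3.le] at e1 e2
    have e3 : 0 < (s - b) * ξ e := mul_pos (by linarith) hξe
    rcases le_total t t₂ with h2 | h2
    · rw [rm t ⟨htt.1, h2⟩] at e1 e2
      have := hR t ⟨htt.1, h2⟩ (by rw [e1]; ring)
      linarith
    · rw [rb t h2] at e2; linarith
  refine ⟨s, ⟨h1, h3⟩, ?_⟩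
  rw [pm s ⟨h1, h3⟩] at e1 e2
  rcases le_total t t₂ with h2 | h2
  · left
    refine ⟨t, ⟨htt.1, h2⟩, ?_⟩
    simpa [κ', β', pm s ⟨h1, h3⟩, rm t ⟨htt.1, h2⟩] using hst
  · right
    rw [rb t h2] at e1 e2
    refine ⟨by linarith, ?_⟩
    have : 0 ≤ (t - t₂) * h u := mul_nonneg (by linarith) hhu.le
    linarith

/-- Height and width functionals attached to a lattice direction. -/
def hgt (w : ℤ × ℤ) : ℝ × ℝ →L[ℝ] ℝ :=
  (w.1 : ℝ) • ContinuousLinearMap.fst ℝ ℝ ℝ + (w.2 : ℝ) • ContinuousLinearMap.snd ℝ ℝ ℝ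
def wid (w : ℤ × ℤ) : ℝ × ℝ →L[ℝ] ℝ :=
  (w.1 : ℝ) • ContinuousLinearMap.snd ℝ ℝ ℝ - (w.2 : ℝ) • ContinuousLinearMap.fst ℝ ℝ ℝ
def rot (w : ℤ × ℤ) : ℤ × ℤ := (-w.2, w.1)
def qq (w : ℤ × ℤ) : ℝ := (w.1 : ℝ) ^ 2 + (w.2 : ℝ) ^ 2
def ww (w : ℤ × ℤ) : ℝ := |(w.1 : ℝ)| + |(w.2 : ℝ)|

lemma hgt_apply (w : ℤ × ℤ) (y : ℝ × ℝ) : hgt w y = w.1 * y.1 + w.2 * y.2 := by simp [hgt]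
lemma wid_apply (w : ℤ × ℤ) (y : ℝ × ℝ) : wid w y = w.1 * y.2 - w.2 * y.1 := by simp [wid]
lemma hgt_self (w : ℤ × ℤ) : hgt w (lat w) = qq w := by rw [hgt_apply]; simp only [lat, qq]; ring
lemma wid_self (w : ℤ × ℤ) : wid w (lat w) = 0 := by rw [wid_apply]; simp only [lat]; ring
lemma hgt_rot (w : ℤ × ℤ) : hgt w (lat (rot w)) = 0 := by
  rw [hgt_apply]; simp only [lat, rot]; push_cast; ring
lemma wid_rot (w : ℤ × ℤ) : wid w (lat (rot w)) = qq w := by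
  rw [wid_apply]; simp only [lat, rot, qq]; push_cast; ring
lemma hgt_neg (w : ℤ × ℤ) (y : ℝ × ℝ) : hgt (-w) y = -hgt w y := by
  rw [hgt_apply, hgt_apply]; simp only [Prod.fst_neg, Prod.snd_neg]; push_cast; ring
lemma rot_ne_zero {w : ℤ × ℤ} (hw : w ≠ 0) : rot w ≠ 0 := by
  intro h
  apply hw
  have h1 := congrArg Prod.fst h
  have h2 := congrArg Prod.snd h
  simp only [rot, Prod.fst_zero, Prod.snd_zero, neg_eq_zero] at h1 h2
  exact Prod.ext h2 h1

lemma abs_le_sq_int (n : ℤ) : |(n : ℝ)| ≤ (n : ℝ) ^ 2 := by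
  rw [← Int.cast_abs, ← Int.cast_pow]
  exact_mod_cast (by
    rcases eq_or_ne n 0 with rfl | h
    · simp
    · have h1 : 1 ≤ |n| := Int.one_le_abs h
      nlinarith [sq_abs n] : |n| ≤ n ^ 2)

lemma ww_le_qq (w : ℤ × ℤ) : ww w ≤ qq w := add_le_add (abs_le_sq_int _) (abs_le_sq_int _)

lemma one_le_ww {w : ℤ × ℤ} (hw : w ≠ 0) : 1 ≤ ww w := by
  unfold ww
  have : w.1 ≠ 0 ∨ w.2 ≠ 0 := by
    by_contra! h; exact hw (Prod.ext h.1 h.2)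
  rcases this with h | h
  · have h1 : (1 : ℝ) ≤ |(w.1 : ℝ)| := by exact_mod_cast Int.one_le_abs h
    linarith [abs_nonneg (w.2 : ℝ)]
  · have h1 : (1 : ℝ) ≤ |(w.2 : ℝ)| := by exact_mod_cast Int.one_le_abs h
    linarith [abs_nonneg (w.1 : ℝ)]

lemma one_le_qq {w : ℤ × ℤ} (hw : w ≠ 0) : 1 ≤ qq w := (one_le_ww hw).trans (ww_le_qq w)
lemma qq_pos {w : ℤ × ℤ} (hw : w ≠ 0) : 0 < qq w := one_pos.trans_le (one_le_qq hw)
lemma ww_pos {w : ℤ × ℤ} (hw : w ≠ 0) : 0 < ww w := one_pos.trans_le (one_le_ww hw)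

lemma abs_hgt_le (w : ℤ × ℤ) (y : ℝ × ℝ) : |hgt w y| ≤ ww w * ‖y‖ := by
  rw [hgt_apply, ww, add_mul]
  refine (abs_add_le _ _).trans ?_
  rw [abs_mul, abs_mul]
  gcongr
  exacts [norm_fst_le y, norm_snd_le y]

lemma abs_wid_le (w : ℤ × ℤ) (y : ℝ × ℝ) : |wid w y| ≤ ww w * ‖y‖ := by
  rw [wid_apply, ww, add_mul]
  refine (abs_sub _ _).trans ?_
  rw [abs_mul, abs_mul]
  gcongr
  exacts [norm_snd_le y, norm_fst_le y]

lemma norm_le_hgt_wid {w : ℤ × ℤ} (hw : w ≠ 0) (y : ℝ × ℝ) : ‖y‖ ≤ |hgt w y| + |wid w y| := by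
  have hq := qq_pos hw
  have h1 : qq w * y.1 = w.1 * hgt w y - w.2 * wid w y := by rw [hgt_apply, wid_apply, qq]; ring
  have h2 : qq w * y.2 = w.2 * hgt w y + w.1 * wid w y := by rw [hgt_apply, wid_apply, qq]; ring
  have a1 : |(w.1 : ℝ)| ≤ qq w := by
    have := abs_le_sq_int w.1; unfold qq; nlinarith [sq_nonneg (w.2 : ℝ)]
  have a2 : |(w.2 : ℝ)| ≤ qq w := by
    have := abs_le_sq_int w.2; unfold qq; nlinarith [sq_nonneg (w.1 : ℝ)]
  have key : ∀ z u v : ℝ, |u| ≤ qq w → |v| ≤ qq w → (qq w * z = u * hgt w y - v * wid w y ∨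
      qq w * z = u * hgt w y + v * wid w y) → |z| ≤ |hgt w y| + |wid w y| := by
    intro z u v hu hv hz
    have : qq w * |z| ≤ qq w * (|hgt w y| + |wid w y|) := by
      rw [← abs_of_pos hq, ← abs_mul, abs_of_pos hq]
      have h3 : |qq w * z| ≤ |u * hgt w y| + |v * wid w y| := by
        rcases hz with hz | hz <;> rw [hz]
        · exact abs_sub _ _
        · exact abs_add_le _ _
      rw [abs_mul u, abs_mul v] at h3
      nlinarith [abs_nonneg (hgt w y), abs_nonneg (wid w y)]
    exact le_of_mul_le_mul_left this hq
  rw [Prod.norm_def]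
  exact max_le (key _ _ _ a1 a2 (.inl h1)) (key _ _ _ a2 a1 (.inr h2))

lemma hgt_wid_inj {w : ℤ × ℤ} (hw : w ≠ 0) (x : ℝ × ℝ) (h1 : wid w x = 0) (h2 : hgt w x = 0) : x = 0 := by
  have := norm_le_hgt_wid hw x
  rw [h1, h2, abs_zero, add_zero] at this
  exact norm_le_zero_iff.1 this

/-- The point with prescribed width and height coordinates. -/
def pt (w : ℤ × ℤ) (x y : ℝ) : ℝ × ℝ := (x / qq w) • lat (rot w) + (y / qq w) • lat w

lemma hgt_pt {w : ℤ × ℤ} (hw : w ≠ 0) (x y : ℝ) : hgt w (pt w x y) = y := by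
  have := (qq_pos hw).ne'
  simp only [pt, map_add, map_smul, hgt_rot, hgt_self, smul_eq_mul]; field_simp; ring
lemma wid_pt {w : ℤ × ℤ} (hw : w ≠ 0) (x y : ℝ) : wid w (pt w x y) = x := by
  have := (qq_pos hw).ne'
  simp only [pt, map_add, map_smul, wid_rot, wid_self, smul_eq_mul]; field_simp; ring

namespace TorusMetric
variable {M : TorusMetric}

lemma UG.abs_hgt_sub_le {c : ℝ → ℝ × ℝ} (hc : M.UG c) (w : ℤ × ℤ) (s t : ℝ) :
    |hgt w (c t) - hgt w (c s)| ≤ ww w / M.cl * |t - s| := by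
  rw [← map_sub]
  refine (abs_hgt_le _ _).trans ?_
  have h0 : 0 ≤ ww w := by unfold ww; positivity
  calc _ ≤ ww w * (1 / M.cl * |t - s|) := by gcongr; exact hc.norm_sub_le s t
    _ = _ := by ring

/-- A periodic geodesic separating high from low points. -/
lemma exists_floor (M : TorusMetric) {w : ℤ × ℤ} (hw : w ≠ 0) : ∃ S : ℝ, 0 < S ∧ ∀ y : ℝ, ∃ α, M.UG α ∧
    (∀ t, hgt w (α t) ∈ Icc (y - S) y) ∧ ∀ X, ∃ a b, a ≤ b ∧
      wid w (α a) ≤ -X ∧ X ≤ wid w (α b) := by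
  obtain ⟨α, hα, l, hl, hp⟩ := M.exists_closed (rot_ne_zero hw)
  have hq := qq_pos hw
  have hper : ∀ n : ℕ, ∀ t, α (t + n * l) = α t + (n : ℝ) • lat (rot w) := by
    intro n
    induction n with
    | zero => intro t; simp
    | succ n ih =>
      intro t
      rw [show t + ((n + 1 : ℕ) : ℝ) * l = (t + n * l) + l by push_cast; ring, hp, ih]
      push_cast; rw [add_smul, one_smul, add_assoc]
  have hhp : Function.Periodic (fun t => hgt w (α t)) l := by
    intro t; simp only [hp, map_add, hgt_rot, add_zero]
  obtain ⟨H, hH⟩ := isCompact_Icc (a := (0 : ℝ)) (b := l) |>.exists_bound_of_continuousOn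
    ((hgt w).continuous.comp hα.continuous).continuousOn
  have hH' : ∀ t, |hgt w (α t)| ≤ H := by
    intro t
    obtain ⟨s, hs, hst⟩ := hhp.exists_mem_Ico₀ hl t
    have hst' : hgt w (α t) = hgt w (α s) := hst
    rw [hst']; exact hH s ⟨hs.1, hs.2.le⟩
  have hH0 : 0 ≤ H := (abs_nonneg _).trans (hH' 0)
  refine ⟨2 * H + qq w, by linarith, fun y => ?_⟩
  set j : ℤ := ⌊(y - H) / qq w⌋ with hj
  have j1 : j * qq w ≤ y - H := by rw [← le_div_iff₀ hq]; exact Int.floor_le _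
  have j2 : y - H < (j + 1) * qq w := by rw [← div_lt_iff₀ hq]; exact Int.lt_floor_add_one _
  refine ⟨_, hα.trans (j • w), fun t => ?_, fun X => ?_⟩
  · have := abs_le.1 (hH' t)
    simp only [map_add, lat_zsmul, map_smul, hgt_self, smul_eq_mul]
    constructor <;> nlinarith
  · obtain ⟨n, hn⟩ := exists_nat_ge ((X + |wid w (α 0)|) / qq w)
    rw [div_le_iff₀ hq] at hn
    have h1 := hper n 0
    have h2 := hper n (-(n * l))
    rw [neg_add_cancel] at h2
    have h2' : α (-(n * l)) = α 0 - (n : ℝ) • lat (rot w) := by rw [h2]; abel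
    refine ⟨-(n * l), 0 + n * l, by have : 0 ≤ (n : ℝ) * l := by positivity
                                    linarith, ?_⟩
    rw [h1, h2']
    simp only [map_add, map_sub, lat_zsmul, map_smul, wid_self, wid_rot, smul_eq_mul, mul_zero, add_zero]
    constructor <;> linarith [neg_abs_le (wid w (α 0)), le_abs_self (wid w (α 0))]

end TorusMetric

namespace TorusMetric
variable {M : TorusMetric} {O : Set (ℝ × ℝ)} {A B : ℝ × ℝ} {L : ℝ} {κ : ℝ → ℝ × ℝ}

/-- A path avoiding a floor stays above it. -/
lemma LP.floor {w : ℤ × ℤ} (hw : w ≠ 0) {α : ℝ → ℝ × ℝ} (hα : M.UG α) {y S : ℝ}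
    (hr : ∀ t, hgt w (α t) ∈ Icc (y - S) y)
    (hX : ∀ X, ∃ a b, a ≤ b ∧ wid w (α a) ≤ -X ∧ X ≤ wid w (α b)) (h : M.LP O L A B κ)
    (hO : ∀ t, α t ∈ O) (hA : y ≤ hgt w A) {s : ℝ} (hs : s ∈ Icc 0 L) : y - S ≤ hgt w (κ s) := by
  by_contra! hlt
  have hκ : ContinuousOn κ (Icc 0 s) := h.continuousOn.mono (Icc_subset_Icc le_rfl hs.2)
  obtain ⟨X, hXb⟩ := isCompact_Icc.exists_bound_of_continuousOn ((wid w).continuous.comp_continuousOn hκ)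
  simp only [Real.norm_eq_abs, Function.comp] at hXb
  obtain ⟨a, b, hab, h1, h2⟩ := hX X
  have hm : ∀ t ∈ Icc (-s) 0, -t ∈ Icc 0 s := fun t ht => ⟨by linarith [ht.2], by linarith [ht.1]⟩
  obtain ⟨u, -, t, ht, hut⟩ := exists_crossing (ζ := fun t => κ (-t)) (c := -s) (d := 0)
    (hgt_wid_inj hw) hab (by linarith [hs.1]) hα.continuous.continuousOn
    (hκ.comp continuous_neg.continuousOn hm)
    (fun t ht => by linarith [(abs_le.1 (hXb _ (hm t ht))).1])
    (fun t ht => by linarith [(abs_le.1 (hXb _ (hm t ht))).2])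
    (fun u _ => by rw [neg_neg]; linarith [(hr u).1])
    (fun u _ => by rw [neg_zero, h.start]; linarith [(hr u).2])
  exact h.avoid _ (hm t ht).1 ((hm t ht).2.trans hs.2) (hut ▸ hO u)

/-- No geodesic has large bumps in any lattice direction. -/
def NB (M : TorusMetric) : Prop := ∀ w : ℤ × ℤ, w ≠ 0 → ∃ R : ℝ, ∀ c, M.UG c → ∀ t₁ t₂ t₃, t₁ ≤ t₂ →
  t₂ ≤ t₃ → ¬ (hgt w (c t₁) + R ≤ hgt w (c t₂) ∧ hgt w (c t₃) + R ≤ hgt w (c t₂))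

lemma exists_lp_seg_of {w : ℤ × ℤ} (h : ∀ y ∈ O, ∀ t ∈ Icc (0 : ℝ) 1,
    hgt w y = hgt w A + t * (hgt w B - hgt w A) → wid w y = wid w A + t * (wid w B - wid w A) → False) :
    ∃ κ, M.LP O (M.cu * ‖A - B‖) A B κ :=
  exists_lp_seg fun t ht hy => h _ hy t ht (by simp) (by simp)

lemma not_bounded_of_nb (hN : M.NB) {c : ℝ → ℝ × ℝ} (hc : M.UG c) (H : ℝ) (hH : ∀ t, ‖c t‖ ≤ H) : False := by
  have hw : ((0, 1) : ℤ × ℤ) ≠ 0 := by simp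
  generalize ((0, 1) : ℤ × ℤ) = w at hw
  obtain ⟨R, hR⟩ := hN w hw
  obtain ⟨S, hS, hfl⟩ := M.exists_floor hw
  have hW := ww_pos hw
  have hcl := M.cl_pos
  have hrho := M.rho_pos
  have htau := M.tau_pos
  set W := ww w
  have hH0 : 0 ≤ H := (norm_nonneg _).trans (hH 0)
  set f := W * H with hf
  have hf0 : 0 ≤ f := by positivity
  have hch : ∀ t, |hgt w (c t)| ≤ f := fun t =>
    (abs_hgt_le w _).trans (mul_le_mul_of_nonneg_left (hH t) hW.le)
  have hcw : ∀ t, |wid w (c t)| ≤ f := fun t =>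
    (abs_wid_le w _).trans (mul_le_mul_of_nonneg_left (hH t) hW.le)
  set y := -f - 2 * W - 2 - |R| with hy
  obtain ⟨α, hα, hαh, hαX⟩ := hfl y
  have hWr : 0 < W * M.rho := by positivity
  have hWt : 0 < W / M.cl * M.tau := by positivity
  set e := y - S - W * M.rho - W / M.cl * M.tau - 1 with he
  have hEc : pt w 0 e ≠ c 0 := by
    intro h
    have := (abs_le.1 (hch 0)).1
    rw [← h, hgt_pt hw] at this
    linarith [abs_nonneg R]
  obtain ⟨s₀, hs₀, -, D, hD, hD0, hD1⟩ := exists_shortest (M := M) hEc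
  obtain ⟨X, hX⟩ := isCompact_Icc.exists_bound_of_continuousOn
    (((wid w).continuous.comp hD.continuous).continuousOn (s := Icc 0 s₀))
  obtain ⟨Y, hY⟩ := isCompact_Icc.exists_bound_of_continuousOn
    (((hgt w).continuous.comp hD.continuous).continuousOn (s := Icc 0 s₀))
  simp only [Real.norm_eq_abs, Function.comp] at hX hY
  have hX0 : 0 ≤ X := (abs_nonneg _).trans (hX 0 ⟨le_rfl, hs₀.le⟩)
  have hY0 : 0 ≤ Y := (abs_nonneg _).trans (hY 0 ⟨le_rfl, hs₀.le⟩)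
  set O : Set (ℝ × ℝ) := range α ∪ range c ∪ D '' Icc 0 s₀ with hO
  have hαO : ∀ t, α t ∈ O := fun t => .inl (.inl ⟨t, rfl⟩)
  have hcO : ∀ t, c t ∈ O := fun t => .inl (.inr ⟨t, rfl⟩)
  have hDO : ∀ t ∈ Icc 0 s₀, D t ∈ O := fun t ht => .inr ⟨t, ht, rfl⟩
  set Z := X + f + 1 with hZ
  set A := pt w (-Z) (y + 1) with hA
  set B := pt w Z (y + 1) with hB
  have hOy : ∀ z ∈ O, hgt w z ≤ y ∨ (|wid w z| ≤ X + f ∧ hgt w z ≤ f + Y) := by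
    rintro z ((⟨t, rfl⟩ | ⟨t, rfl⟩) | ⟨t, ht, rfl⟩)
    · exact .inl (hαh t).2
    · exact .inr ⟨by linarith [hcw t], by linarith [le_abs_self (hgt w (c t)), hch t]⟩
    · exact .inr ⟨by linarith [hX t ht], by linarith [le_abs_self (hgt w (D t)), hY t ht]⟩
  set T := f + Y + 1 with hT
  have hyT : y + 1 ≤ T := by linarith [abs_nonneg R]
  obtain ⟨κ₁, k1⟩ := exists_lp_seg_of (M := M) (O := O) (A := A) (B := pt w (-Z) T) (w := w) (by
    intro z hz t ht h1 h2
    simp only [hA, hgt_pt hw, wid_pt hw, sub_self, mul_zero, add_zero] at h1 h2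
    rcases hOy z hz with h3 | ⟨h3, -⟩
    · nlinarith [ht.1]
    · rw [h2, abs_neg, abs_of_nonneg (by linarith)] at h3; linarith)
  obtain ⟨κ₂, k2⟩ := exists_lp_seg_of (M := M) (O := O) (A := pt w (-Z) T) (B := pt w Z T) (w := w) (by
    intro z hz t ht h1 h2
    simp only [hgt_pt hw, sub_self, mul_zero, add_zero] at h1
    rcases hOy z hz with h3 | ⟨-, h3⟩ <;> linarith)
  obtain ⟨κ₃, k3⟩ := exists_lp_seg_of (M := M) (O := O) (A := pt w Z T) (B := B) (w := w) (by
    intro z hz t ht h1 h2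
    simp only [hB, hgt_pt hw, wid_pt hw, sub_self, mul_zero, add_zero] at h1 h2
    rcases hOy z hz with h3 | ⟨h3, -⟩
    · nlinarith [ht.2]
    · rw [h2, abs_of_nonneg (by linarith)] at h3; linarith)
  obtain ⟨κ₄, k4⟩ := k1.trans k2
  obtain ⟨κ₅, k5⟩ := k4.trans k3
  have hAh : hgt w A = y + 1 := hgt_pt hw _ _
  have hBh : hgt w B = y + 1 := hgt_pt hw _ _
  have hfloor : ∀ {L B κ}, M.LP O L A B κ → ∀ s ∈ Icc 0 L, y - S ≤ hgt w (κ s) := fun h s hs =>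
    h.floor hw hα hαh hαX hαO (by rw [hAh]; linarith) hs
  have hcc : M.CC O A := by
    refine cc_of_chord fun L B κ hκ s hs x hx hd => ?_
    rcases hx with (⟨t, rfl⟩ | ⟨t, rfl⟩) | ⟨t, ht, rfl⟩
    · exact .inl ⟨α, t, hα, rfl, fun s _ => hαO s⟩
    · exact .inl ⟨c, t, hc, rfl, fun s _ => hcO s⟩
    · refine .inr ⟨D, t, s₀, c, 0, hD, hc, rfl, ht.2, fun r hr hrt => hDO r ⟨?_, hr⟩, hcO, hD1.symm⟩
      by_contra! hr0
      have h1 := hfloor hκ s hs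
      have h2 := norm_le_rho (M := M) (x := κ s) (y := D t) (by linarith [M.rc_pos])
      have h3 := (abs_hgt_le w (κ s - D t)).trans (mul_le_mul_of_nonneg_left h2 hW.le)
      rw [map_sub] at h3
      have h4 := hD.abs_hgt_sub_le w 0 t
      rw [hD0, hgt_pt hw, sub_zero, abs_of_nonneg ht.1] at h4
      have h5 : t ≤ M.tau := by
        rw [abs_le] at hrt; linarith [hrt.1]
      have h6 : W / M.cl * t ≤ W / M.cl * M.tau := by gcongr
      linarith [(abs_le.1 h3).2, (abs_le.1 h4).2]
  have hAB : A ≠ B := by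
    intro h
    have := congrArg (wid w) h
    rw [hA, hB, wid_pt hw, wid_pt hw] at this
    linarith
  obtain ⟨L₀, hL₀, -, hmin⟩ := exists_min hcc ⟨_, _, k5⟩ hAB
  obtain ⟨σ, hσ, hσ0, hσ1, hσκ⟩ := hmin 1 one_pos
  obtain ⟨L, κ, hκ, hL, hκσ⟩ := hσκ M.cl hcl
  have hq := qq_pos hw
  have hDX : ∀ t ∈ Icc 0 s₀, -Z ≤ wid w (D t) ∧ wid w (D t) ≤ Z := fun t ht => by
    have := abs_le.1 (hX t ht)
    constructor <;> linarith
  obtain ⟨s, hs, hcr⟩ := exists_barrier_crossing (ξ := wid w) (h := hgt w) (e := lat (rot w)) (u := lat w)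
    (hgt_wid_inj hw) (by rw [wid_rot]; exact hq) (hgt_rot w) (wid_self w) (by rw [hgt_self]; exact hq)
    hκ.len hs₀.le hκ.continuousOn hD.continuous.continuousOn
    (fun s hs => by rw [hD0, hgt_pt hw]; linarith [hfloor hκ s hs])
    (by rw [hκ.start, wid_pt hw]; exact (hDX s₀ ⟨hs₀.le, le_rfl⟩).1)
    (by rw [hκ.finish, wid_pt hw]; exact (hDX s₀ ⟨hs₀.le, le_rfl⟩).2)
    (fun t ht _ => by rw [hκ.start, wid_pt hw]; exact (hDX t ht).1)
    (fun t ht _ => by rw [hκ.finish, wid_pt hw]; exact (hDX t ht).2)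
  rcases hcr with ⟨t, ht, hst⟩ | ⟨-, hcr⟩
  · exact hκ.avoid s hs.1 hs.2 (hst ▸ hDO t ht)
  rw [hD1] at hcr
  have hc0 := (abs_le.1 (hch 0)).1
  have hclose : ∀ x z : ℝ × ℝ, ∀ r, ‖x - z‖ ≤ r → hgt w x ≤ hgt w z + W * r := fun x z r hr => by
    have := (abs_hgt_le w (x - z)).trans (mul_le_mul_of_nonneg_left hr hW.le)
    rw [map_sub] at this
    linarith [(abs_le.1 this).2]
  rcases le_or_gt s L₀ with hsL | hsL
  · have h1 := hclose _ _ _ (hκσ s ⟨hs.1, hsL⟩)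
    refine hR σ hσ 0 s L₀ hs.1 hsL ⟨?_, ?_⟩
    · rw [hσ0, hAh]; linarith [le_abs_self R]
    · rw [hσ1, hBh]; linarith [le_abs_self R]
  · have h1 := hclose _ _ _ (hκσ L₀ ⟨hL₀.le, le_rfl⟩)
    have h2 := hκ.norm_le hs ⟨hL₀.le, hsL.le.trans hs.2⟩
    have h3 : 1 / M.cl * |s - L₀| ≤ 1 := by
      rw [abs_of_pos (by linarith), div_mul_eq_mul_div, one_mul, div_le_one hcl]; linarith [hs.2]
    have h4 := hclose _ _ _ (h2.trans h3)
    rw [hσ1, hBh] at h1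
    linarith [abs_nonneg R]

end TorusMetric

lemma continuous_norm2 : Continuous norm2 := by unfold norm2; fun_prop
lemma norm2_smul (a : ℝ) (x : ℝ × ℝ) : norm2 (a • x) = |a| * norm2 x := by
  simp only [norm2, Prod.smul_fst, Prod.smul_snd, smul_eq_mul]
  rw [← Real.sqrt_sq_eq_abs, ← Real.sqrt_mul (sq_nonneg a)]; ring_nf
lemma norm_le_norm2 (x : ℝ × ℝ) : ‖x‖ ≤ norm2 x := by
  rw [Prod.norm_def]
  refine max_le ?_ ?_ <;> refine Real.abs_le_sqrt ?_ <;> nlinarith [sq_nonneg x.1, sq_nonneg x.2]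
lemma norm2_nonneg (x : ℝ × ℝ) : 0 ≤ norm2 x := Real.sqrt_nonneg _
lemma norm2_sq (x : ℝ × ℝ) : norm2 x ^ 2 = x.1 ^ 2 + x.2 ^ 2 := Real.sq_sqrt (by positivity)

/-- Normalization to a unit vector. -/
def nrm (x : ℝ × ℝ) : ℝ × ℝ := (norm2 x)⁻¹ • x

lemma nrm_smul {a : ℝ} (ha : 0 < a) (x : ℝ × ℝ) : nrm (a • x) = nrm x := by
  rw [nrm, norm2_smul, abs_of_pos ha, smul_smul, mul_inv, mul_right_comm, inv_mul_cancel₀ ha.ne', one_mul, nrm]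
lemma norm2_nrm {x : ℝ × ℝ} (hx : 0 < norm2 x) : norm2 (nrm x) = 1 := by
  rw [nrm, norm2_smul, abs_of_pos (inv_pos.2 hx), inv_mul_cancel₀ hx.ne']
lemma nrm_of_norm2_eq_one {x : ℝ × ℝ} (hx : norm2 x = 1) : nrm x = x := by simp [nrm, hx]
lemma continuousAt_nrm {x : ℝ × ℝ} (hx : norm2 x = 1) : ContinuousAt nrm x :=
  (continuous_norm2.continuousAt.inv₀ (by rw [hx]; exact one_ne_zero)).smul continuousAt_id

lemma isCompact_unit_circle : IsCompact {z : ℝ × ℝ | norm2 z = 1} := by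
  refine (isCompact_closedBall (0 : ℝ × ℝ) 1).of_isClosed_subset
    (isClosed_eq continuous_norm2 continuous_const) fun z hz => ?_
  rw [mem_closedBall_zero_iff, ← (hz : norm2 z = 1)]; exact norm_le_norm2 z

lemma exists_lat_approx (z : ℝ × ℝ) :
    ∃ k : ℕ → ℤ × ℤ, Tendsto (fun n : ℕ => ((n : ℝ) + 1)⁻¹ • lat (k n)) atTop (𝓝 z) := by
  have key : ∀ x : ℝ, Tendsto (fun n : ℕ => ((n : ℝ) + 1)⁻¹ * (⌊((n : ℝ) + 1) * x⌋ : ℝ)) atTop (𝓝 x) := by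
    intro x
    have h0 : Tendsto (fun n : ℕ => x - 1 / ((n : ℝ) + 1)) atTop (𝓝 x) := by
      simpa using tendsto_const_nhds.sub (tendsto_one_div_add_atTop_nhds_zero_nat (𝕜 := ℝ))
    refine tendsto_of_tendsto_of_tendsto_of_le_of_le h0 tendsto_const_nhds (fun n => ?_) fun n => ?_
    · have hn : (0 : ℝ) < n + 1 := by positivity
      have := Int.lt_floor_add_one (((n : ℝ) + 1) * x)
      simp only [one_div]
      rw [← mul_le_mul_iff_right₀ hn, mul_sub, mul_inv_cancel₀ hn.ne', mul_inv_cancel_left₀ hn.ne']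
      linarith
    · have hn : (0 : ℝ) < n + 1 := by positivity
      have := Int.floor_le (((n : ℝ) + 1) * x)
      simp only
      rw [← mul_le_mul_iff_right₀ hn, mul_inv_cancel_left₀ hn.ne']
      exact this
  exact ⟨fun n => (⌊((n : ℝ) + 1) * z.1⌋, ⌊((n : ℝ) + 1) * z.2⌋), (key z.1).prodMk_nhds (key z.2)⟩

lemma exists_separating {z z' : ℝ × ℝ} (hz : norm2 z = 1) (hz' : norm2 z' = 1) (hne : z ≠ z') :
    ∃ w : ℤ × ℤ, w ≠ 0 ∧ 0 < hgt w z ∧ hgt w z' < 0 := by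
  obtain ⟨k, hk⟩ := exists_lat_approx (z - z')
  have h1 : z.1 ^ 2 + z.2 ^ 2 = 1 := by rw [← norm2_sq, hz, one_pow]
  have h2 : z'.1 ^ 2 + z'.2 ^ 2 = 1 := by rw [← norm2_sq, hz', one_pow]
  have h3 : 0 < (z.1 - z'.1) ^ 2 + (z.2 - z'.2) ^ 2 := by
    by_contra! h
    have a1 : z.1 - z'.1 = 0 := by nlinarith [sq_nonneg (z.1 - z'.1), sq_nonneg (z.2 - z'.2)]
    have a2 : z.2 - z'.2 = 0 := by nlinarith [sq_nonneg (z.1 - z'.1), sq_nonneg (z.2 - z'.2)]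
    exact hne (Prod.ext (by linarith) (by linarith))
  have hlim : ∀ y : ℝ × ℝ, Tendsto (fun n : ℕ => ((n : ℝ) + 1)⁻¹ * hgt (k n) y) atTop
      (𝓝 ((z - z').1 * y.1 + (z - z').2 * y.2)) := fun y => by
    have := ((continuous_fst.tendsto _).comp hk).mul_const y.1 |>.add
      (((continuous_snd.tendsto _).comp hk).mul_const y.2)
    refine this.congr fun n => ?_
    simp only [hgt_apply, Function.comp, lat, Prod.smul_fst, Prod.smul_snd, smul_eq_mul]; ring
  have e1 := (hlim z).eventually_const_lt (u := 0) (by simp only [Prod.fst_sub, Prod.snd_sub]; nlinarith)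
  have e2 := (hlim z').eventually_lt_const (u := 0) (by simp only [Prod.fst_sub, Prod.snd_sub]; nlinarith)
  obtain ⟨n, g1, g2⟩ := (e1.and e2).exists
  have hn : (0 : ℝ) < ((n : ℝ) + 1)⁻¹ := by positivity
  have g1' : 0 < hgt (k n) z := pos_of_mul_pos_right g1 hn.le
  refine ⟨k n, fun h => ?_, g1', ?_⟩
  · rw [h, hgt_apply] at g1'; simp at g1'
  · by_contra! h; nlinarith [mul_nonneg hn.le h]

lemma exists_latDir_approx {z : ℝ × ℝ} (hz : norm2 z = 1) :
    ∃ k : ℕ → ℤ × ℤ, (∀ᶠ n in atTop, k n ≠ 0) ∧ Tendsto (fun n => nrm (lat (k n))) atTop (𝓝 z) := by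
  obtain ⟨k, hk⟩ := exists_lat_approx z
  refine ⟨k, ?_, ?_⟩
  · have hz0 : z ≠ 0 := by
      rintro rfl; simp [norm2] at hz
    filter_upwards [hk.eventually_ne hz0] with n hn h
    rw [h] at hn; simp [lat] at hn
  · have := (continuousAt_nrm hz).tendsto.comp hk
    rw [nrm_of_norm2_eq_one hz] at this
    refine this.congr fun n => ?_
    exact nrm_smul (by positivity) _

lemma continuousAt_projPt {z : ℝ × ℝ} (hz : norm2 z = 1) : ContinuousAt projPt z := by
  by_cases h1 : z.1 = 0
  · have h2 : z.2 ≠ 0 := by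
      intro h2; rw [show z = 0 from Prod.ext h1 h2] at hz; simp [norm2] at hz
    have hval : projPt z = OnePoint.infty := by simp [projPt, h1]
    unfold ContinuousAt
    rw [hval, OnePoint.hasBasis_nhds_infty.tendsto_right_iff]
    rintro s ⟨-, hs⟩
    obtain ⟨C, hC⟩ := hs.isBounded.exists_norm_le
    have hev : ∀ᶠ y : ℝ × ℝ in 𝓝 z, |C| * |y.1| < |y.2| := by
      refine Continuous.tendsto' (f := fun y : ℝ × ℝ => |y.2| - |C| * |y.1|) (by fun_prop) z |z.2|
        (by simp [h1]) |>.eventually_const_lt (abs_pos.2 h2) |>.mono fun y hy => by linarith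
    filter_upwards [hev] with y hy
    by_cases hy1 : y.1 = 0
    · right; simp [projPt, hy1]
    · left
      refine ⟨y.2 / y.1, fun hmem => ?_, by simp [projPt, hy1]⟩
      have := hC _ hmem
      rw [Real.norm_eq_abs, abs_div, div_le_iff₀ (abs_pos.2 hy1)] at this
      nlinarith [le_abs_self C, abs_nonneg y.1]
  · have : projPt =ᶠ[𝓝 z] fun y => ((y.2 / y.1 : ℝ) : OnePoint ℝ) := by
      filter_upwards [continuous_fst.continuousAt.eventually_ne h1] with y hy
      simp [projPt, hy]
    refine ContinuousAt.congr ?_ this.symm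
    exact OnePoint.continuous_coe.continuousAt.comp
      (continuous_snd.continuousAt.div continuous_fst.continuousAt h1)

lemma exists_projPt (r : OnePoint ℝ) : ∃ z, norm2 z = 1 ∧ projPt z = r := by
  induction r with
  | infty => exact ⟨(0, 1), by simp [norm2], by simp [projPt]⟩
  | coe r =>
    have h : 0 < norm2 (1, r) := Real.sqrt_pos.2 (by positivity)
    refine ⟨nrm (1, r), norm2_nrm h, ?_⟩
    have h1 : (nrm (1, r)).1 = (norm2 (1, r))⁻¹ := by simp [nrm]
    have h2 : (nrm (1, r)).2 = (norm2 (1, r))⁻¹ * r := by simp [nrm]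
    rw [projPt, if_neg (by rw [h1]; exact (inv_pos.2 h).ne'), h1, h2, mul_div_cancel_left₀ _ (inv_pos.2 h).ne']

namespace TorusMetric
variable {M : TorusMetric}

lemma unbounded_of_nb (hN : M.NB) {c : ℝ → ℝ × ℝ} (hc : M.UG c) (H : ℝ) : ∃ t, 0 ≤ t ∧ H < ‖c t‖ := by
  by_contra! h
  have hK := isCompact_unit (M := M) (isCompact_closedBall (0 : ℝ × ℝ) H)
  obtain ⟨z, hz, φ, hφ, hlim⟩ := hK.tendsto_subseq (x := fun n : ℕ => M.ph c n) fun n =>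
    ⟨hc.en_ph n, by rw [mem_closedBall_zero_iff]; exact h n (Nat.cast_nonneg n)⟩
  refine not_bounded_of_nb hN (ug_flow hz.1) H fun t => ?_
  have h1 := tendsto_flow (M := M) hlim t
  have h2 : Tendsto (fun n => ‖(M.flow (M.ph c (φ n)) t).1‖) atTop (𝓝 ‖(M.flow z t).1‖) :=
    ((continuous_norm.comp continuous_fst).tendsto _).comp h1
  refine le_of_tendsto h2 ?_
  have h3 : Tendsto (fun n => ((φ n : ℕ) : ℝ)) atTop atTop :=
    tendsto_natCast_atTop_atTop.comp hφ.tendsto_atTop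
  filter_upwards [h3.eventually_ge_atTop (-t)] with n hn
  rw [← hc.ph_add]
  exact h _ (by linarith)

lemma tendsto_of_unbounded (hN : M.NB) {c : ℝ → ℝ × ℝ} (hc : M.UG c) {w : ℤ × ℤ} (hw : w ≠ 0)
    (h : ∀ K, ∃ t, 0 ≤ t ∧ K ≤ hgt w (c t)) : Tendsto (fun t => hgt w (c t)) atTop atTop := by
  obtain ⟨R, hR⟩ := hN w hw
  refine tendsto_atTop.2 fun K => ?_
  obtain ⟨t, ht, htK⟩ := h (max (hgt w (c 0) + R) (K + R))
  filter_upwards [eventually_ge_atTop t] with s hs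
  by_contra! hlt
  exact hR c hc 0 t s ht hs ⟨(le_max_left _ _).trans htK, by linarith [(le_max_right _ _).trans htK]⟩

lemma tendsto_norm2_of_hgt {c : ℝ → ℝ × ℝ} {w : ℤ × ℤ} (hw : w ≠ 0)
    (h : Tendsto (fun t => hgt w (c t)) atTop atTop) : EscapesForward c := by
  have hW := ww_pos hw
  refine tendsto_atTop_mono (fun t => ?_) (h.atTop_div_const hW)
  rw [div_le_iff₀ hW, mul_comm]
  exact (le_abs_self _).trans ((abs_hgt_le w _).trans (mul_le_mul_of_nonneg_left (norm_le_norm2 _) hW.le))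

lemma escapes_of_nb (hN : M.NB) {c : ℝ → ℝ × ℝ} (hc : M.UG c) : EscapesForward c := by
  by_contra hne
  have key : ∀ w : ℤ × ℤ, w ≠ 0 → ∃ K, ∀ t, 0 ≤ t → hgt w (c t) < K := by
    intro w hw
    by_contra! h
    exact hne (tendsto_norm2_of_hgt hw (tendsto_of_unbounded hN hc hw h))
  obtain ⟨K₁, h1⟩ := key (1, 0) (by simp)
  obtain ⟨K₂, h2⟩ := key (0, 1) (by simp)
  obtain ⟨K₃, h3⟩ := key (-1, 0) (by simp)
  obtain ⟨K₄, h4⟩ := key (0, -1) (by simp)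
  simp only [hgt_apply, Int.cast_one, Int.cast_zero, Int.cast_neg, one_mul, zero_mul, zero_add, add_zero,
    neg_mul] at h1 h2 h3 h4
  obtain ⟨t, ht, hlt⟩ := unbounded_of_nb hN hc (max (max K₁ K₂) (max K₃ K₄))
  refine hlt.not_ge ?_
  rw [Prod.norm_def, Real.norm_eq_abs, Real.norm_eq_abs]
  have m1 := le_max_left K₁ K₂
  have m2 := le_max_right K₁ K₂
  have m3 := le_max_left K₃ K₄
  have m4 := le_max_right K₃ K₄
  have m5 := le_max_left (max K₁ K₂) (max K₃ K₄)
  have m6 := le_max_right (max K₁ K₂) (max K₃ K₄)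
  refine max_le (abs_le.2 ⟨?_, ?_⟩) (abs_le.2 ⟨?_, ?_⟩) <;> linarith [h1 t ht, h2 t ht, h3 t ht, h4 t ht]

lemma tendsto_hgt_of_cluster (hN : M.NB) {c : ℝ → ℝ × ℝ} (hc : M.UG c) {z : ℝ × ℝ}
    (hz : MapClusterPt z atTop fun t => nrm (c t)) {w : ℤ × ℤ} (hw : w ≠ 0) (hp : 0 < hgt w z) :
    Tendsto (fun t => hgt w (c t)) atTop atTop := by
  refine tendsto_of_unbounded hN hc hw fun K => ?_
  have h1 : ∃ᶠ t in atTop, nrm (c t) ∈ {y | hgt w z / 2 < hgt w y} :=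
    hz.frequently (((hgt w).continuous.tendsto z).eventually_const_lt (by linarith))
  have h2 : ∀ᶠ t in atTop, 0 ≤ t ∧ 0 < norm2 (c t) ∧ |K| / (hgt w z / 2) ≤ norm2 (c t) :=
    (eventually_ge_atTop 0).and (((escapes_of_nb hN hc).eventually_gt_atTop 0).and
      ((escapes_of_nb hN hc).eventually_ge_atTop _))
  obtain ⟨t, h3, h0, h4, h5⟩ := (h1.and_eventually h2).exists
  refine ⟨t, h0, ?_⟩
  rw [mem_ofPred_eq, nrm, map_smul, smul_eq_mul, ← div_eq_inv_mul, lt_div_iff₀ h4] at h3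
  rw [div_le_iff₀ (by linarith)] at h5
  linarith [le_abs_self K]

lemma exists_direction (hN : M.NB) {c : ℝ → ℝ × ℝ} (hc : M.UG c) : ∃ z, HasDirection c z := by
  have hm : ∀ᶠ t in atTop, nrm (c t) ∈ {z : ℝ × ℝ | norm2 z = 1} := by
    filter_upwards [(escapes_of_nb hN hc).eventually_gt_atTop 0] with t ht using norm2_nrm ht
  obtain ⟨z, hz, hzc⟩ := isCompact_unit_circle.exists_mapClusterPt_of_frequently hm.frequently
  refine ⟨z, hz, isCompact_unit_circle.tendsto_nhds_of_unique_mapClusterPt hm fun z' hz' hzc' => ?_⟩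
  by_contra hne
  obtain ⟨w, hw, h1, h2⟩ := exists_separating hz hz' (Ne.symm hne)
  have t1 := tendsto_hgt_of_cluster hN hc hzc hw h1
  have t2 := tendsto_hgt_of_cluster hN hc hzc' (neg_ne_zero.2 hw) (by rw [hgt_neg]; linarith)
  obtain ⟨t, a1, a2⟩ := ((t1.eventually_gt_atTop 0).and (t2.eventually_gt_atTop 0)).exists
  rw [hgt_neg] at a2
  linarith

lemma tendsto_hgt_of_direction (hN : M.NB) {c : ℝ → ℝ × ℝ} (hc : M.UG c) {z : ℝ × ℝ}
    (hz : HasDirection c z) {w : ℤ × ℤ} (hw : w ≠ 0) (hp : 0 < hgt w z) :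
    Tendsto (fun t => hgt w (c t)) atTop atTop :=
  tendsto_hgt_of_cluster hN hc hz.2.mapClusterPt hw hp

lemma hasDirection_trans {c : ℝ → ℝ × ℝ} {z : ℝ × ℝ} (he : EscapesForward c) (h : HasDirection c z)
    (y : ℝ × ℝ) : HasDirection (fun t => c t + y) z := by
  refine ⟨h.1, ?_⟩
  have h1 : Tendsto (fun t => (norm2 (c t))⁻¹ • c t + (norm2 (c t))⁻¹ • y) atTop (𝓝 z) := by
    simpa using h.2.add ((tendsto_inv_atTop_zero.comp he).smul_const y)
  have h2 := (continuousAt_nrm h.1).tendsto.comp h1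
  rw [nrm_of_norm2_eq_one h.1] at h2
  refine h2.congr' ?_
  filter_upwards [he.eventually_gt_atTop 0] with t ht
  rw [Function.comp, ← smul_add, nrm_smul (inv_pos.2 ht)]; rfl

lemma hasDirection_shift {c : ℝ → ℝ × ℝ} {z : ℝ × ℝ} (h : HasDirection c z) (s : ℝ) :
    HasDirection (fun t => c (s + t)) z :=
  ⟨h.1, h.2.comp (tendsto_atTop_add_const_left _ s tendsto_id)⟩

lemma hasDirection_unique {c : ℝ → ℝ × ℝ} {z z' : ℝ × ℝ} (h : HasDirection c z) (h' : HasDirection c z') :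
    z = z' := tendsto_nhds_unique h.2 h'.2

/-- `z` is the direction of a geodesic with the given initial vector. -/
def DirRel (M : TorusMetric) (p : (ℝ × ℝ) × (ℝ × ℝ)) (z : ℝ × ℝ) : Prop :=
  ∃ c, M.UG c ∧ c 0 = p.1 ∧ deriv c 0 = p.2 ∧ HasDirection c z

/-- The asymptotic direction as a function on the unit tangent bundle. -/
def dir (M : TorusMetric) (p : (ℝ × ℝ) × (ℝ × ℝ)) : ℝ × ℝ := Classical.epsilon (M.DirRel p)

lemma hasDirection_dir (hN : M.NB) {c : ℝ → ℝ × ℝ} (hc : M.UG c) :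
    HasDirection c (M.dir (c 0, deriv c 0)) := by
  obtain ⟨z, hz⟩ := exists_direction hN hc
  obtain ⟨c', hc', h0, hd, hz'⟩ := Classical.epsilon_spec (p := M.DirRel (c 0, deriv c 0)) ⟨z, c, hc, rfl, rfl, hz⟩
  have : c' = c := funext fun t => by
    have := hc'.eq_of hc h0 hd t
    rwa [zero_add] at this
  rw [this] at hz'
  exact hz'

lemma dir_eq (hN : M.NB) {c : ℝ → ℝ × ℝ} (hc : M.UG c) {z : ℝ × ℝ} (hz : HasDirection c z) :
    M.dir (c 0, deriv c 0) = z := hasDirection_unique (hasDirection_dir hN hc) hz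

lemma dir_shift (hN : M.NB) {c : ℝ → ℝ × ℝ} (hc : M.UG c) (s : ℝ) :
    M.dir (c s, deriv c s) = M.dir (c 0, deriv c 0) := by
  have h := dir_eq hN (hc.shift s) (hasDirection_shift (hasDirection_dir hN hc) s)
  have hd : deriv (fun t => c (s + t)) 0 = deriv c s := by
    rw [deriv_comp_const_add, add_zero]
  rwa [hd, add_zero] at h

lemma deriv_add_lat (c : ℝ → ℝ × ℝ) (k : ℤ × ℤ) (t : ℝ) : deriv (fun t => c t + lat k) t = deriv c t :=
  by simp

lemma dirRel_lat (hN : M.NB) (x v : ℝ × ℝ) (k : ℤ × ℤ) : M.DirRel (x + lat k, v) = M.DirRel (x, v) := by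
  have key : ∀ x k z, M.DirRel (x, v) z → M.DirRel (x + lat k, v) z := by
    rintro x k z ⟨c, hc, h0, hd, hz⟩
    exact ⟨_, hc.trans k, by simp only [h0], by rw [deriv_add_lat, hd], hasDirection_trans (escapes_of_nb hN hc) hz _⟩
  funext z
  refine propext ⟨fun h => ?_, key x k z⟩
  have := key _ (-k) z h
  rwa [lat_neg, add_neg_cancel_right] at this

lemma dir_lat (hN : M.NB) (x v : ℝ × ℝ) (k : ℤ × ℤ) : M.dir (x + lat k, v) = M.dir (x, v) := by
  rw [dir, dirRel_lat hN, dir]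

lemma continuous_mom_uncurry : Continuous fun p : (ℝ × ℝ) × (ℝ × ℝ) => M.mom p.1 p.2 := by
  have h1 := M.contDiff_ga.continuous
  have h2 := M.contDiff_gb.continuous
  have h3 := M.contDiff_gd.continuous
  unfold mom; fun_prop

lemma continuousOn_dir (hN : M.NB) : ContinuousOn M.dir {p | M.g p.1 p.2 p.2 = 1} := by
  intro p hp
  let e : (ℝ × ℝ) × (ℝ × ℝ) → ℝ → ℝ × ℝ := fun q t => (M.flow (q.1, M.mom q.1 q.2) t).1
  have he : ∀ q : (ℝ × ℝ) × (ℝ × ℝ), M.g q.1 q.2 q.2 = 1 → M.UG (e q) ∧ HasDirection (e q) (M.dir q) := by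
    intro q hq
    have h1 : M.en (q.1, M.mom q.1 q.2) = 1 := by rw [en_mom, hq]
    have h2 : M.UG (e q) := ug_flow h1
    have h3 := hasDirection_dir hN h2
    have h4 : e q 0 = q.1 := by simp [e]
    have h5 : deriv (e q) 0 = q.2 := by rw [← vel_ph (M := M), ph_flow h1, flow_zero, vel_mom]
    rw [h4, h5] at h3
    exact ⟨h2, h3⟩
  have hec : ∀ t, Continuous fun q => e q t := fun t =>
    continuous_fst.comp ((continuous_flow t).comp (continuous_fst.prodMk continuous_mom_uncurry))
  refine isCompact_unit_circle.tendsto_nhds_of_unique_mapClusterPt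
    (eventually_mem_nhdsWithin.mono fun q hq => (he q hq).2.1) fun z' hz' hcl => ?_
  by_contra hne
  obtain ⟨w, hw, h1, h2⟩ := exists_separating (he p hp).2.1 hz' (Ne.symm hne)
  obtain ⟨R, hR⟩ := hN w hw
  have t1 := tendsto_hgt_of_direction hN (he p hp).1 (he p hp).2 hw h1
  obtain ⟨T, hT0, hT⟩ := ((eventually_ge_atTop 0).and
    (t1.eventually_ge_atTop (hgt w (e p 0) + R + 2))).exists
  have e1 : ∀ᶠ q in 𝓝[{p | M.g p.1 p.2 p.2 = 1}] p, hgt w (e p T) - 1 < hgt w (e q T) :=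
    nhdsWithin_le_nhds ((((hgt w).continuous.comp (hec T)).tendsto p).eventually_const_lt (by simp))
  have e2 : ∀ᶠ q in 𝓝[{p | M.g p.1 p.2 p.2 = 1}] p, hgt w (e q 0) < hgt w (e p 0) + 1 :=
    nhdsWithin_le_nhds ((((hgt w).continuous.comp (hec 0)).tendsto p).eventually_lt_const (by simp))
  have e3 : ∃ᶠ q in 𝓝[{p | M.g p.1 p.2 p.2 = 1}] p, M.dir q ∈ {y | hgt w y < 0} :=
    hcl.frequently (((hgt w).continuous.tendsto z').eventually_lt_const h2)
  obtain ⟨q, ⟨h3, h4, h5⟩, hq⟩ := ((e3.and_eventually (e1.and e2)).and_eventually eventually_mem_nhdsWithin).exists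
  have t2 := tendsto_hgt_of_direction hN (he q hq).1 (he q hq).2 (neg_ne_zero.2 hw) (by
    rw [hgt_neg]; linarith [show hgt w (M.dir q) < 0 from h3])
  obtain ⟨s, hs, hs2⟩ := ((eventually_ge_atTop T).and
    (t2.eventually_ge_atTop (-(hgt w (e q T) - R)))).exists
  rw [hgt_neg] at hs2
  exact hR (e q) (he q hq).1 0 T s hT0 hs ⟨by linarith, by linarith⟩

lemma exists_dir (hN : M.NB) {z : ℝ × ℝ} (hz : norm2 z = 1) :
    ∃ c, M.UG c ∧ M.dir (c 0, deriv c 0) = z := by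
  set K := {p : (ℝ × ℝ) × (ℝ × ℝ) | M.en p = 1 ∧ p.1 ∈ Icc (0 : ℝ × ℝ) 1} with hK
  have hKc : IsCompact K := isCompact_unit isCompact_Icc
  let G : (ℝ × ℝ) × (ℝ × ℝ) → ℝ × ℝ := fun p => M.dir (p.1, M.vel p)
  have hG : ContinuousOn G K := (continuousOn_dir hN).comp
    (continuous_fst.prodMk M.contDiff_vel.continuous).continuousOn fun p hp => by
      have := hp.1
      rw [en_eq] at this
      exact this
  have himg : ∀ c, M.UG c → M.dir (c 0, deriv c 0) ∈ G '' K := by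
    intro c hc
    obtain ⟨k, y, hy, hxy⟩ := exists_lat_add (c 0)
    refine ⟨M.ph (fun t => c t + lat (-k)) 0, ⟨(hc.trans (-k)).en_ph 0, ?_⟩, ?_⟩
    · simp only [ph, hxy, lat_neg, add_neg_cancel_right]; exact hy
    · simp only [G, vel_ph, deriv_add_lat]
      exact dir_lat hN _ _ _
  have hlat : ∀ k : ℤ × ℤ, k ≠ 0 → nrm (lat k) ∈ G '' K := by
    intro k hk
    obtain ⟨α, hα, l, hl, hp⟩ := M.exists_closed hk
    have hd := hasDirection_dir hN hα
    have h1 := hasDirection_trans (escapes_of_nb hN hα) hd (-α 0)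
    have hper : ∀ n : ℕ, α (n * l) = α 0 + (n : ℝ) • lat k := by
      intro n
      induction n with
      | zero => simp
      | succ n ih =>
        rw [show ((n + 1 : ℕ) : ℝ) * l = n * l + l by push_cast; ring, hp, ih]
        push_cast; rw [add_smul, one_smul, add_assoc]
    have h2 : Tendsto (fun n : ℕ => (n : ℝ) * l) atTop atTop :=
      tendsto_natCast_atTop_atTop.atTop_mul_const hl
    have h3 := h1.2.comp h2
    have h4 : M.dir (α 0, deriv α 0) = nrm (lat k) := by
      refine tendsto_nhds_unique h3 (tendsto_const_nhds.congr' ?_)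
      filter_upwards [eventually_gt_atTop 0] with n hn
      simp only [Function.comp, hper, add_neg_cancel_comm]
      exact (nrm_smul (by exact_mod_cast hn) _).symm
    rw [← h4]
    exact himg α hα
  obtain ⟨k, hk0, hk⟩ := exists_latDir_approx hz
  obtain ⟨p, hp, hpz⟩ := (hKc.image_of_continuousOn hG).isClosed.mem_of_tendsto hk
    (hk0.mono fun n hn => hlat _ hn)
  refine ⟨_, ug_flow hp.1, ?_⟩
  have : deriv (fun t => (M.flow p t).1) 0 = M.vel p := by
    rw [← vel_ph (M := M), ph_flow hp.1, flow_zero]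
  rw [this, flow_zero]
  exact hpz

theorem direction_of_nb (hN : M.NB) :
    ∃ δfun : (ℝ × ℝ) × (ℝ × ℝ) → ℝ × ℝ,
      (∀ x v : ℝ × ℝ, M.g x v v = 1 → ∃ c, M.IsGeodesic c ∧ c 0 = x ∧ deriv c 0 = v) ∧
      (∀ c, M.IsGeodesic c → HasDirection c (δfun (c 0, deriv c 0))) ∧
      (∀ c, M.IsGeodesic c → ∀ s : ℝ, δfun (c s, deriv c s) = δfun (c 0, deriv c 0)) ∧
      (∀ (x v : ℝ × ℝ) (k : ℤ × ℤ), δfun (x + lat k, v) = δfun (x, v)) ∧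
      ContinuousOn δfun {p : (ℝ × ℝ) × (ℝ × ℝ) | M.g p.1 p.2 p.2 = 1} ∧
      ContinuousOn (fun p => projPt (δfun p)) {p : (ℝ × ℝ) × (ℝ × ℝ) | M.g p.1 p.2 p.2 = 1} ∧
      (∀ z : ℝ × ℝ, norm2 z = 1 → ∃ c, M.IsGeodesic c ∧ δfun (c 0, deriv c 0) = z) ∧
      (∀ r : OnePoint ℝ, ∃ c, M.IsGeodesic c ∧ projPt (δfun (c 0, deriv c 0)) = r) := by
  simp only [isGeodesic_iff]
  refine ⟨M.dir, fun x v h => exists_ug h, fun c hc => hasDirection_dir hN hc,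
    fun c hc s => dir_shift hN hc s, dir_lat hN, continuousOn_dir hN, fun p hp => ?_,
    fun z hz => exists_dir hN hz, fun r => ?_⟩
  · obtain ⟨c, hc, h0, hd⟩ := exists_ug (M := M) hp
    have hn : norm2 (M.dir p) = 1 := by
      have := (hasDirection_dir hN hc).1
      rwa [h0, hd] at this
    exact (continuousAt_projPt hn).comp_continuousWithinAt (continuousOn_dir hN p hp)
  · obtain ⟨z, hz, rfl⟩ := exists_projPt r
    obtain ⟨c, hc, h⟩ := exists_dir hN hz
    exact ⟨c, hc, by rw [h]⟩

end TorusMetric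

section Volume

lemma exists_quadratic_remainder {F : Type*} [NormedAddCommGroup F] [NormedSpace ℝ F] [ProperSpace F]
    {G : F → ℝ} (hsm : ContDiff ℝ 2 G) :
    ∃ C : ℝ, 0 ≤ C ∧ ∀ A, ‖A‖ ≤ 1 → |G A - G 0 - fderiv ℝ G 0 A| ≤ C * ‖A‖ ^ 2 := by
  have h1 : ContDiff ℝ 1 (fderiv ℝ G) := hsm.fderiv_right (m := 1) (by norm_num)
  obtain ⟨C, hC⟩ := (isCompact_closedBall (0 : F) 1).exists_bound_of_continuousOn
    (h1.continuous_fderiv (by simp)).continuousOn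
  have hC0 : 0 ≤ C := (norm_nonneg _).trans (hC 0 (by simp))
  refine ⟨C, hC0, fun A hA => ?_⟩
  have hlip : ∀ B ∈ Metric.closedBall (0 : F) ‖A‖, ‖fderiv ℝ G B - fderiv ℝ G 0‖ ≤ C * ‖A‖ := by
    intro B hB
    have hB' : ‖B‖ ≤ ‖A‖ := by simpa using hB
    have := (convex_closedBall (0 : F) 1).norm_image_sub_le_of_norm_fderiv_le (𝕜 := ℝ)
      (f := fderiv ℝ G) (x := 0) (y := B)
      (fun x _ => h1.differentiable (by simp) x) hC (by simp)
      (by simpa using hB'.trans hA)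
    rw [sub_zero] at this
    exact this.trans (mul_le_mul_of_nonneg_left hB' hC0)
  have h := (convex_closedBall (0 : F) ‖A‖).norm_image_sub_le_of_norm_hasFDerivWithin_le'
    (x := 0) (y := A) (fun B _ => (hsm.differentiable (by simp) B).hasFDerivAt.hasFDerivWithinAt) hlip
    (by simp) (by simp)
  rw [sub_zero, Real.norm_eq_abs] at h
  rwa [pow_two, ← mul_assoc]

lemma exists_det_bound (E : Type*) [NormedAddCommGroup E] [NormedSpace ℝ E] [FiniteDimensional ℝ E] :
    ∃ C : ℝ, 0 ≤ C ∧ ∀ A : E →L[ℝ] E, ‖A‖ ≤ 1 → LinearMap.trace ℝ E A = 0 →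
    1 - C * ‖A‖ ^ 2 ≤ (1 + A).det := by
  classical
  let b := Module.finBasis ℝ E
  let G : (E →L[ℝ] E) → ℝ := fun A => (1 + A).det
  have hG : ∀ A, G A = (1 + LinearMap.toMatrix b b (A : E →ₗ[ℝ] E)).det := by
    intro A
    simp only [G, ContinuousLinearMap.det]
    rw [← LinearMap.det_toMatrix b]
    congr 1
    have : ((1 + A : E →L[ℝ] E) : E →ₗ[ℝ] E) = LinearMap.id + (A : E →ₗ[ℝ] E) := rfl
    rw [this, map_add, LinearMap.toMatrix_id]
  have hsm : ContDiff ℝ 2 G := by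
    have : G = fun A : E →L[ℝ] E => (1 + LinearMap.toMatrix b b (A : E →ₗ[ℝ] E)).det := funext hG
    rw [this]
    simp only [Matrix.det_apply, Units.smul_def, zsmul_eq_mul]
    refine ContDiff.sum fun σ _ => contDiff_const.mul (contDiff_prod fun i _ => ?_)
    simp only [Matrix.add_apply, LinearMap.toMatrix_apply, ContinuousLinearMap.coe_coe]
    refine contDiff_const.add ?_
    exact ((b.coord (σ i)).toContinuousLinearMap.comp
      (ContinuousLinearMap.apply ℝ E (b i))).contDiff
  have hzero : ∀ A : E →L[ℝ] E, LinearMap.trace ℝ E A = 0 → fderiv ℝ G 0 A = 0 := by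
    intro A hA
    have h1 : HasDerivAt (fun t : ℝ => G (t • A)) (fderiv ℝ G 0 A) 0 := by
      have h2 : HasDerivAt (fun t : ℝ => t • A) A 0 := by simpa using (hasDerivAt_id (0 : ℝ)).smul_const A
      have h3 : HasFDerivAt G (fderiv ℝ G 0) ((0 : ℝ) • A) := by
        rw [zero_smul]; exact (hsm.differentiable (by simp) 0).hasFDerivAt
      exact h3.comp_hasDerivAt 0 h2
    obtain ⟨p, hp⟩ : ∃ p : Polynomial ℝ, ∀ t, G (t • A) = 1 + p.eval t * t ^ 2 := by
      refine ⟨(1 + (Polynomial.X : Polynomial ℝ) •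
        (LinearMap.toMatrix b b (A : E →ₗ[ℝ] E)).map Polynomial.C).det.divX.divX, fun t => ?_⟩
      rw [hG, ContinuousLinearMap.toLinearMap_smul, map_smul, Matrix.det_one_add_smul,
        ← LinearMap.trace_eq_matrix_trace, hA, zero_mul, add_zero]
    have h2 : HasDerivAt (fun t : ℝ => 1 + p.eval t * t ^ 2) 0 0 := by
      have := ((p.hasDerivAt 0).mul (hasDerivAt_pow 2 (0 : ℝ))).const_add 1
      simpa using this
    exact (h1.congr_of_eventuallyEq (Eventually.of_forall fun t => (hp t).symm)).unique h2
  obtain ⟨C, hC0, hC⟩ := exists_quadratic_remainder hsm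
  refine ⟨C, hC0, fun A hA htr => ?_⟩
  have h := hC A hA
  have h0 : G 0 = 1 := by simp [hG]
  rw [hzero A htr, sub_zero, h0] at h
  have := (abs_le.1 h).1
  change _ ≤ G A
  linarith
open MeasureTheory

variable {E : Type*} [NormedAddCommGroup E] [NormedSpace ℝ E] [FiniteDimensional ℝ E]
  [MeasurableSpace E] [BorelSpace E] (μ : Measure E) [μ.IsAddHaarMeasure]

lemma exists_euler_volume {X : E → E} {K : NNReal} (hX : ContDiff ℝ 1 X) (hL : LipschitzWith K X)
    (hdiv : ∀ z, LinearMap.trace ℝ E (fderiv ℝ X z) = 0) :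
    ∃ C : ℝ, 0 ≤ C ∧ ∀ h : ℝ, 0 ≤ h → h * K < 1 → ∀ S, IsCompact S →
      ENNReal.ofReal (1 - C * h ^ 2) * μ S ≤ μ ((fun z => z + h • X z) '' S) := by
  obtain ⟨C, hC0, hC⟩ := exists_det_bound E
  refine ⟨C * K ^ 2, by positivity, fun h h0 h1 S hS => ?_⟩
  have hd : ∀ z, HasFDerivAt (fun z => z + h • X z) (1 + h • fderiv ℝ X z : E →L[ℝ] E) z := fun z =>
    (hasFDerivAt_id z).add ((hX.differentiable (by simp) z).hasFDerivAt.const_smul h)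
  have hinj : InjOn (fun z => z + h • X z) S := by
    intro z _ z' _ he
    have he : z + h • X z = z' + h • X z' := he
    have e1 : z - z' = h • (X z' - X z) := by rw [smul_sub, sub_eq_sub_iff_add_eq_add, he, add_comm]
    have e2 : ‖z - z'‖ ≤ h * (K * ‖z - z'‖) := by
      conv_lhs => rw [e1, norm_smul, Real.norm_of_nonneg h0]
      refine mul_le_mul_of_nonneg_left ?_ h0
      rw [norm_sub_rev z z']
      exact hL.norm_sub_le _ _
    by_contra hne
    have : 0 < ‖z - z'‖ := norm_pos_iff.2 (sub_ne_zero.2 hne)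
    nlinarith
  rw [← lintegral_abs_det_fderiv_eq_addHaar_image μ hS.measurableSet
    (fun z _ => (hd z).hasFDerivWithinAt) hinj, ← setLIntegral_const]
  refine lintegral_mono fun z => ENNReal.ofReal_le_ofReal ?_
  have hn : ‖h • fderiv ℝ X z‖ ≤ h * K := by
    rw [norm_smul, Real.norm_of_nonneg h0]
    exact mul_le_mul_of_nonneg_left (norm_fderiv_le_of_lipschitz ℝ hL) h0
  have := hC (h • fderiv ℝ X z) (hn.trans h1.le) (by
    rw [ContinuousLinearMap.toLinearMap_smul, map_smul, hdiv, smul_zero])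
  refine le_trans ?_ (this.trans (le_abs_self _))
  have h2 : ‖h • fderiv ℝ X z‖ ^ 2 ≤ (h * K) ^ 2 := pow_le_pow_left₀ (norm_nonneg _) hn 2
  nlinarith [mul_le_mul_of_nonneg_left h2 hC0]

lemma norm_euler_sub_le {E : Type*} [NormedAddCommGroup E] [NormedSpace ℝ E] {X : E → E} {K B : NNReal}
    (hL : LipschitzWith K X) (hB : ∀ z, ‖X z‖ ≤ B)
    {γ : ℝ → E} (hγ : ∀ t, HasDerivAt γ (X (γ t)) t) {h : ℝ} (h0 : 0 ≤ h) (n : ℕ) :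
    ‖(fun z => z + h • X z)^[n] (γ 0) - γ (n * h)‖ ≤ n * Real.exp (K * h * n) * (K * B * h ^ 2) := by
  have hγl : ∀ s t, ‖γ t - γ s‖ ≤ B * |t - s| := fun s t =>
    Convex.norm_image_sub_le_of_norm_hasDerivWithin_le (fun x _ => (hγ x).hasDerivWithinAt)
      (fun x _ => hB _) convex_univ (mem_univ s) (mem_univ t)
  have hloc : ∀ s, ‖γ (s + h) - (γ s + h • X (γ s))‖ ≤ K * B * h ^ 2 := by
    intro s
    have := (convex_Icc s (s + h)).norm_image_sub_le_of_norm_hasDerivWithin_le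
      (f := fun u => γ u - (u - s) • X (γ s)) (f' := fun u => X (γ u) - X (γ s)) (C := K * B * h)
      (x := s) (y := s + h)
      (fun u _ => by
        have := (hγ u).sub (((hasDerivAt_id u).sub_const s).smul_const (X (γ s)))
        rw [one_smul] at this
        exact this.hasDerivWithinAt)
      (fun u hu => by
        refine (hL.norm_sub_le _ _).trans ?_
        rw [mul_assoc]
        refine mul_le_mul_of_nonneg_left ((hγl _ _).trans ?_) K.2
        refine mul_le_mul_of_nonneg_left ?_ B.2
        rw [abs_of_nonneg (by linarith [hu.1])]
        linarith [hu.2]) ⟨le_rfl, by linarith⟩ ⟨by linarith, le_rfl⟩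
    simp only [add_sub_cancel_left, sub_self, zero_smul, sub_zero, Real.norm_of_nonneg h0] at this
    rw [← sub_sub, sub_right_comm]
    refine this.trans (le_of_eq (by ring))
  induction n with
  | zero => simp
  | succ n ih =>
    rw [Function.iterate_succ_apply']
    set y := (fun z => z + h • X z)^[n] (γ 0)
    set e := Real.exp (K * h * n)
    have hKB : 0 ≤ K * B * h ^ 2 := by positivity
    have he : 1 ≤ e := Real.one_le_exp (by positivity)
    have h1 : γ ((n + 1 : ℕ) * h) = γ (n * h + h) := by push_cast; ring_nf
    have h2 : ‖(y + h • X y) - (γ (n * h) + h • X (γ (n * h)))‖ ≤ (1 + K * h) * ‖y - γ (n * h)‖ := by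
      rw [add_sub_add_comm, ← smul_sub]
      refine (norm_add_le _ _).trans ?_
      rw [norm_smul, Real.norm_of_nonneg h0]
      have := mul_le_mul_of_nonneg_left (hL.norm_sub_le y (γ (n * h))) h0
      linarith
    have h3 : 1 + K * h ≤ Real.exp (K * h) := by linarith [Real.add_one_le_exp (K * h : ℝ)]
    have h4 : Real.exp (K * h * (n + 1 : ℕ)) = Real.exp (K * h) * e := by
      rw [← Real.exp_add]; push_cast; ring_nf
    rw [h4, h1]
    have h5 : ‖(y + h • X y) - γ (n * h + h)‖ ≤ (1 + K * h) * ‖y - γ (n * h)‖ + K * B * h ^ 2 := by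
      have := hloc (n * h)
      rw [norm_sub_rev] at this
      refine (norm_sub_le_norm_sub_add_norm_sub _ (γ (n * h) + h • X (γ (n * h))) _).trans ?_
      linarith
    refine h5.trans ?_
    have h6 : (1 + K * h) * ‖y - γ (n * h)‖ ≤ Real.exp (K * h) * (n * e * (K * B * h ^ 2)) :=
      mul_le_mul h3 ih (norm_nonneg _) (Real.exp_pos _).le
    have h7 : 1 * (K * B * h ^ 2) ≤ Real.exp (K * h) * e * (K * B * h ^ 2) := by
      refine mul_le_mul_of_nonneg_right ?_ hKB
      exact one_le_mul_of_one_le_of_one_le (Real.one_le_exp (by positivity)) he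
    push_cast
    linarith

/-- A divergence free flow does not decrease volume. -/
lemma volume_le_volume_flow {X : E → E} {K B : NNReal} (hX : ContDiff ℝ 1 X) (hL : LipschitzWith K X)
    (hB : ∀ z, ‖X z‖ ≤ B) (hdiv : ∀ z, LinearMap.trace ℝ E (fderiv ℝ X z) = 0)
    {φ : E → ℝ → E} (h0 : ∀ z, φ z 0 = z) (hφ : ∀ z t, HasDerivAt (φ z) (X (φ z t)) t)
    {t : ℝ} (ht : 0 ≤ t) (hc : Continuous fun z => φ z t) {S : Set E} (hS : IsCompact S) :
    μ S ≤ μ ((fun z => φ z t) '' S) := by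
  obtain ⟨C, hC0, hC⟩ := exists_euler_volume μ hX hL hdiv
  have := hS.image hc
  have l1 : Tendsto (fun n : ℕ => t / (n : ℝ)) atTop (𝓝 0) := tendsto_const_div_atTop_nhds_zero_nat t
  have l2 : Tendsto (fun n : ℕ => ENNReal.ofReal (1 - C * t * (t / n)) * μ S) atTop (𝓝 (μ S)) := by
    have : Tendsto (fun n : ℕ => ENNReal.ofReal (1 - C * t * (t / n))) atTop (𝓝 1) := by
      have := ENNReal.tendsto_ofReal ((l1.const_mul (C * t)).const_sub 1)
      simpa using this
    simpa using ENNReal.Tendsto.mul_const this (Or.inl one_ne_zero)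
  have l3 : Tendsto (fun n : ℕ => Real.exp (K * t) * (K * B * t) * (t / n)) atTop (𝓝 0) := by
    simpa using l1.const_mul (Real.exp (K * t) * (K * B * t))
  have l4 := (tendsto_measure_cthickening_of_isCompact (μ := μ) this).comp l3
  refine le_of_tendsto_of_tendsto l2 l4 ?_
  have e1 : ∀ᶠ n : ℕ in atTop, t / n * K < 1 := by
    have := l1.mul_const (K : ℝ)
    rw [zero_mul] at this
    exact this.eventually_lt_const one_pos
  have e2 : ∀ᶠ n : ℕ in atTop, C * (t / n) ^ 2 < 1 := by
    have := (l1.pow 2).const_mul C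
    rw [zero_pow two_ne_zero, mul_zero] at this
    exact this.eventually_lt_const one_pos
  filter_upwards [e1, e2, eventually_gt_atTop 0] with n h1 h2 hn
  have hn' : (0 : ℝ) < n := Nat.cast_pos.2 hn
  set h := t / n with hh
  have hh0 : 0 ≤ h := by positivity
  have hnt : n * h = t := by rw [hh]; field_simp
  have hψ : Continuous fun z => z + h • X z := continuous_id.add (hX.continuous.const_smul h)
  have hit : ∀ m : ℕ, IsCompact ((fun z => z + h • X z)^[m] '' S) ∧
      ENNReal.ofReal ((1 - C * h ^ 2) ^ m) * μ S ≤ μ ((fun z => z + h • X z)^[m] '' S) := by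
    intro m
    induction m with
    | zero => simpa using hS
    | succ m ih =>
      rw [Function.iterate_succ', image_comp]
      refine ⟨ih.1.image hψ, le_trans ?_ (hC h hh0 h1 _ ih.1)⟩
      rw [pow_succ', ENNReal.ofReal_mul (by linarith), mul_assoc]
      gcongr
      exact ih.2
  refine le_trans ?_ ((hit n).2.trans (measure_mono ?_))
  · gcongr
    have := one_add_mul_le_pow (a := -(C * h ^ 2)) (by linarith) n
    rw [← hnt]
    calc 1 - C * (n * h) * h = 1 + n * -(C * h ^ 2) := by ring
      _ ≤ _ := this
      _ = _ := by ring
  · rintro _ ⟨z, hz, rfl⟩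
    refine Metric.mem_cthickening_of_dist_le _ (φ z t) _ _ ⟨z, hz, rfl⟩ ?_
    have := norm_euler_sub_le hL hB (hφ z) hh0 n
    rw [h0, hnt] at this
    rw [dist_eq_norm]
    refine this.trans (le_of_eq ?_)
    rw [show n * Real.exp (K * h * n) * (K * B * h ^ 2) =
      Real.exp (K * (n * h)) * (K * B * (n * h)) * h by ring_nf, hnt]

end Volume

namespace TorusMetric
variable {M : TorusMetric}

lemma hasDerivAt_line (z η : (ℝ × ℝ) × (ℝ × ℝ)) : HasDerivAt (fun t : ℝ => z + t • η) η 0 := by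
  simpa using ((hasDerivAt_id (0 : ℝ)).smul_const η).const_add z

lemma fderiv_en_apply (z η : (ℝ × ℝ) × (ℝ × ℝ)) : fderiv ℝ M.en z η =
    2 * (η.2.1 * (M.vel z).1 + η.2.2 * (M.vel z).2) -
      2 * ((M.force z).1 * η.1.1 + (M.force z).2 * η.1.2) := by
  have h1 := M.hasDerivAt_en (hasDerivAt_line z η)
  have h2 : HasFDerivAt M.en (fderiv ℝ M.en z) (z + (0 : ℝ) • η) := by
    rw [zero_smul, add_zero]; exact (M.contDiff_en.differentiable (by simp) z).hasFDerivAt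
  have h3 := h2.comp_hasDerivAt 0 (hasDerivAt_line z η)
  have := h3.unique h1
  simpa using this

lemma trace_eq (A : (ℝ × ℝ) × (ℝ × ℝ) →ₗ[ℝ] (ℝ × ℝ) × (ℝ × ℝ)) : LinearMap.trace ℝ _ A =
    (A ((1, 0), (0, 0))).1.1 + (A ((0, 1), (0, 0))).1.2 + (A ((0, 0), (1, 0))).2.1 +
      (A ((0, 0), (0, 1))).2.2 := by
  rw [LinearMap.trace_eq_matrix_trace ℝ ((Module.Basis.finTwoProd ℝ).prod (Module.Basis.finTwoProd ℝ))]
  simp [Matrix.trace, LinearMap.toMatrix_apply, Fin.sum_univ_two]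
  simp only [← Prod.mk_zero_zero]
  ring

lemma trace_fderiv_cham (z : (ℝ × ℝ) × (ℝ × ℝ)) :
    LinearMap.trace ℝ ((ℝ × ℝ) × (ℝ × ℝ)) (fderiv ℝ M.cham z) = 0 := by
  set D := fderiv ℝ (fderiv ℝ M.en) z with hD
  have hsym : ∀ a b, D a b = D b a :=
    (M.contDiff_en.contDiffAt (x := z)).isSymmSndFDerivAt (by
      simp only [minSmoothness_of_isRCLikeNormedField];
      exact WithTop.coe_le_coe.2 (le_top (a := (2 : ℕ∞))))
  have hDen : ContDiff ℝ (⊤ : ℕ∞) (fderiv ℝ M.en) := M.contDiff_en.fderiv_right (by simp)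
  have hpart : ∀ η b : (ℝ × ℝ) × (ℝ × ℝ),
      HasDerivAt (fun t : ℝ => fderiv ℝ M.en (z + t • η) b) (D η b) 0 := by
    intro η b
    have h2 : HasFDerivAt (fderiv ℝ M.en) D (z + (0 : ℝ) • η) := by
      rw [zero_smul, add_zero]; exact (hDen.differentiable (by simp) z).hasFDerivAt
    exact (ContinuousLinearMap.apply ℝ ℝ b).hasFDerivAt.comp_hasDerivAt 0
      (h2.comp_hasDerivAt 0 (hasDerivAt_line z η))
  obtain ⟨k, hk⟩ : ∃ k, ∀ η, HasDerivAt (fun t : ℝ => Real.smoothTransition (5 - M.en (z + t • η)))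
      (k * fderiv ℝ M.en z η) 0 := by
    refine ⟨-deriv Real.smoothTransition (5 - M.en z), fun η => ?_⟩
    have h2 : HasFDerivAt M.en (fderiv ℝ M.en z) (z + (0 : ℝ) • η) := by
      rw [zero_smul, add_zero]; exact (M.contDiff_en.differentiable (by simp) z).hasFDerivAt
    have h3 := (h2.comp_hasDerivAt 0 (hasDerivAt_line z η)).const_sub 5
    have h4 : HasDerivAt Real.smoothTransition (deriv Real.smoothTransition (5 - M.en z))
        (5 - M.en (z + (0 : ℝ) • η)) := by
      rw [zero_smul, add_zero]
      exact ((Real.smoothTransition.contDiff (n := 1)).differentiable (by simp) _).hasDerivAt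
    have h5 := h4.comp 0 h3
    rw [mul_neg, ← neg_mul] at h5
    exact h5
  set s := Real.smoothTransition (5 - M.en z) with hs
  have hcham : ∀ η, HasDerivAt (fun t : ℝ => M.cham (z + t • η)) (fderiv ℝ M.cham z η) 0 := by
    intro η
    have h2 : HasFDerivAt M.cham (fderiv ℝ M.cham z) (z + (0 : ℝ) • η) := by
      rw [zero_smul, add_zero]; exact (M.contDiff_cham.differentiable (by simp) z).hasFDerivAt
    exact h2.comp_hasDerivAt 0 (hasDerivAt_line z η)
  have key : ∀ (L : (ℝ × ℝ) × (ℝ × ℝ) →L[ℝ] ℝ) (a : ℝ) (b : (ℝ × ℝ) × (ℝ × ℝ)),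
      (∀ y, L (M.ham y) = a * fderiv ℝ M.en y b) → ∀ η, L (fderiv ℝ M.cham z η) =
      k * fderiv ℝ M.en z η * (a * fderiv ℝ M.en z b) + s * (a * D η b) := by
    intro L a b hLab η
    have h1 := L.hasFDerivAt.comp_hasDerivAt 0 (hcham η)
    have h2 := (hk η).mul ((hpart η b).const_mul a)
    refine h1.unique (h2.congr_of_eventuallyEq (Eventually.of_forall fun t => ?_) |>.congr_deriv ?_)
    · simp only [Function.comp, cham, map_smul, smul_eq_mul, hLab, Pi.mul_apply]
    · simp only [zero_smul, add_zero, hs]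
  let fs := ContinuousLinearMap.fst ℝ ℝ ℝ
  let sn := ContinuousLinearMap.snd ℝ ℝ ℝ
  let Fs := ContinuousLinearMap.fst ℝ (ℝ × ℝ) (ℝ × ℝ)
  let Sn := ContinuousLinearMap.snd ℝ (ℝ × ℝ) (ℝ × ℝ)
  have k1 := key (fs.comp Fs) (1 / 2) ((0, 0), (1, 0)) (fun y => by
    rw [fderiv_en_apply]; simp [fs, Fs, ham]) ((1, 0), (0, 0))
  have k2 := key (sn.comp Fs) (1 / 2) ((0, 0), (0, 1)) (fun y => by
    rw [fderiv_en_apply]; simp [sn, Fs, ham]) ((0, 1), (0, 0))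
  have k3 := key (fs.comp Sn) (-1 / 2) ((1, 0), (0, 0)) (fun y => by
    rw [fderiv_en_apply]; simp [fs, Sn, ham]; ring) ((0, 0), (1, 0))
  have k4 := key (sn.comp Sn) (-1 / 2) ((0, 1), (0, 0)) (fun y => by
    rw [fderiv_en_apply]; simp [sn, Sn, ham]; ring) ((0, 0), (0, 1))
  rw [trace_eq]
  simp only [ContinuousLinearMap.coe_coe]
  change (fs.comp Fs) _ + (sn.comp Fs) _ + (fs.comp Sn) _ + (sn.comp Sn) _ = 0
  rw [k1, k2, k3, k4, hsym ((0, 0), (1, 0)), hsym ((0, 0), (0, 1))]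
  ring

open MeasureTheory in
instance : (volume : Measure ((ℝ × ℝ) × (ℝ × ℝ))).IsAddHaarMeasure := by
  have : (volume : Measure (ℝ × ℝ)).IsAddHaarMeasure :=
    Measure.prod.instIsAddHaarMeasure (volume : Measure ℝ) volume
  exact Measure.prod.instIsAddHaarMeasure (volume : Measure (ℝ × ℝ)) volume

lemma volume_le_volume_flow_image {t : ℝ} (ht : 0 ≤ t) {S : Set ((ℝ × ℝ) × (ℝ × ℝ))} (hS : IsCompact S) :
    MeasureTheory.volume S ≤ MeasureTheory.volume ((fun z => M.flow z t) '' S) :=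
  volume_le_volume_flow _ (M.contDiff_cham.of_le (by simp)) M.lipschitz_cham M.cham_bounded.choose_spec
    trace_fderiv_cham (fun z => M.flow_zero z) (fun z t => M.hasDerivAt_flow z t) ht (continuous_flow t) hS

end TorusMetric

namespace TorusMetric
variable {M : TorusMetric}

lemma norm_flow_fst_le (M : TorusMetric) : ∃ B : ℝ, 0 ≤ B ∧ ∀ z t, ‖M.flow z t - z‖ ≤ B * |t| := by
  obtain ⟨B, hB⟩ := M.cham_bounded
  refine ⟨B, B.2, fun z t => ?_⟩
  have := Convex.norm_image_sub_le_of_norm_hasDerivWithin_le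
    (fun x _ => (M.hasDerivAt_flow z x).hasDerivWithinAt)
      (fun x _ => hB _) convex_univ (mem_univ 0) (mem_univ t)
  rwa [sub_zero, flow_zero] at this

lemma flow_cancel {z z' : (ℝ × ℝ) × (ℝ × ℝ)} {s s' : ℝ} {k k' : ℤ × ℤ}
    (h : M.flow z s + (lat k, 0) = M.flow z' s' + (lat k', 0)) :
    M.flow z' (s' - s) = z + (lat (k - k'), 0) := by
  have h1 := congrArg (fun y => M.flow y (-s)) h
  simp only [flow_per, ← flow_add, add_neg_cancel, flow_zero] at h1
  rw [sub_eq_add_neg, eq_sub_of_add_eq h1.symm, add_sub_assoc]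
  congr 1
  rw [sub_eq_add_neg k, lat_add, lat_neg]
  ext <;> simp [sub_eq_add_neg]

lemma eq_zero_of_norm_lat_lt {k : ℤ × ℤ} (h : ‖lat k‖ < 1) : k = 0 := by
  rw [lat, Prod.norm_def, max_lt_iff, Real.norm_eq_abs, Real.norm_eq_abs] at h
  dsimp only at h
  norm_cast at h
  exact Prod.ext (Int.abs_lt_one_iff.1 h.1) (Int.abs_lt_one_iff.1 h.2)

open MeasureTheory in
lemma exists_return (z₀ : (ℝ × ℝ) × (ℝ × ℝ)) {U : Set ((ℝ × ℝ) × (ℝ × ℝ))} (hU : U ∈ 𝓝 z₀)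
    {τ : ℝ} (hτ : 0 < τ) : ∃ z ∈ U, ∃ z' ∈ U, ∃ n : ℕ, 1 ≤ n ∧ ∃ k,
      M.flow z (n * τ) = z' + (lat k, 0) := by
  obtain ⟨r', hr', hKU'⟩ := Metric.nhds_basis_closedBall.mem_iff.1 hU
  obtain ⟨r, hr0, hr1, hKU⟩ : ∃ r > 0, r < 1 / 2 ∧ Metric.closedBall z₀ r ⊆ U :=
    ⟨min r' (1 / 4), by positivity, (min_le_right _ _).trans_lt (by norm_num),
      (Metric.closedBall_subset_closedBall (min_le_left _ _)).trans hKU'⟩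
  set K := Metric.closedBall z₀ r with hK
  have hKc : IsCompact K := isCompact_closedBall _ _
  set v := (volume K).toReal with hv
  have hvpos : 0 < v := ENNReal.toReal_pos (Metric.measure_closedBall_pos volume z₀ hr0).ne'
    hKc.measure_lt_top.ne
  have hvK : volume K = ENNReal.ofReal v := (ENNReal.ofReal_toReal hKc.measure_lt_top.ne).symm
  obtain ⟨B, hB0, hB⟩ := norm_flow_fst_le M
  obtain ⟨E, hE⟩ := hKc.exists_bound_of_continuousOn M.contDiff_en.continuous.continuousOn
  set P := Real.sqrt (M.cu ^ 2 * E / M.cl) with hP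
  have hPb : ∀ z ∈ K, ∀ t, ‖(M.flow z t).2‖ ≤ P := by
    intro z hz t
    refine Real.le_sqrt_of_sq_le ?_
    rw [le_div_iff₀ M.cl_pos, mul_comm]
    refine (M.norm_snd_sq_le _).trans ?_
    rw [en_flow]
    exact mul_le_mul_of_nonneg_left ((le_abs_self _).trans (hE z hz)) (by positivity)
  obtain ⟨N, hN⟩ := exists_nat_gt (16 * P ^ 2 / v)
  rw [div_lt_iff₀ hvpos] at hN
  obtain ⟨m, hm⟩ := exists_nat_ge (‖z₀.1‖ + 1 + B * (N * τ))
  set s : Finset (ℕ × (ℤ × ℤ)) :=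
    Finset.range N ×ˢ (Finset.Icc (-(m : ℤ)) m ×ˢ Finset.Icc (-(m : ℤ)) m) with hs
  let t : ℕ × (ℤ × ℤ) → Set ((ℝ × ℝ) × (ℝ × ℝ)) := fun i =>
    (fun y => y + (lat i.2, 0)) '' ((fun z => M.flow z (i.1 * τ)) '' K)
  have htc : ∀ i, IsCompact (t i) := fun i =>
    (hKc.image (continuous_flow _)).image (continuous_id.add continuous_const)
  have htv : ∀ i, volume K ≤ volume (t i) := fun i => by
    simp only [t, image_add_right, measure_preimage_add_right]
    exact volume_le_volume_flow_image (by positivity) hKc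
  set box : Set ((ℝ × ℝ) × (ℝ × ℝ)) := Metric.closedBall 0 (2 * m) ×ˢ Metric.closedBall 0 P with hbox
  have hboxv : volume box = ENNReal.ofReal ((4 * m) ^ 2 * (2 * P) ^ 2) := by
    have : ∀ r : ℝ, 0 ≤ r → volume (Metric.closedBall (0 : ℝ × ℝ) r) = ENNReal.ofReal ((2 * r) ^ 2) := by
      intro r hr
      rw [show (0 : ℝ × ℝ) = (0, 0) from rfl, ← closedBall_prod_same, Measure.volume_eq_prod,
        Measure.prod_prod, Real.volume_closedBall, ← ENNReal.ofReal_mul (by positivity), pow_two]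
    rw [hbox, Measure.volume_eq_prod, Measure.prod_prod, this _ (by positivity),
      this _ (Real.sqrt_nonneg _), ← ENNReal.ofReal_mul (by positivity)]
    congr 1
    ring
  have htb : ∀ i ∈ s, t i ⊆ box := by
    rintro ⟨n, k⟩ hi _ ⟨_, ⟨z, hz, rfl⟩, rfl⟩
    simp only [hs, Finset.mem_product, Finset.mem_range, Finset.mem_Icc] at hi
    simp only [hbox, mem_prod, mem_closedBall_zero_iff, Prod.fst_add, Prod.snd_add, add_zero]
    refine ⟨?_, hPb z hz _⟩
    have h1 : ‖lat k‖ ≤ m := by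
      rw [lat, Prod.norm_def, max_le_iff, Real.norm_eq_abs, Real.norm_eq_abs]
      constructor
      · have : |k.1| ≤ (m : ℤ) := abs_le.2 hi.2.1
        dsimp only
        exact_mod_cast this
      · have : |k.2| ≤ (m : ℤ) := abs_le.2 hi.2.2
        dsimp only
        exact_mod_cast this
    have h2 : ‖z.1 - z₀.1‖ ≤ 1 := by
      have : ‖z - z₀‖ ≤ r := by rw [← dist_eq_norm]; exact hz
      exact (norm_fst_le (z - z₀)).trans (by linarith)
    have h3 : ‖(M.flow z (n * τ)).1 - z.1‖ ≤ B * (N * τ) := by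
      refine (norm_fst_le (M.flow z (n * τ) - z)).trans ((hB _ _).trans ?_)
      rw [abs_of_nonneg (by positivity)]
      have : (n : ℝ) ≤ N := by exact_mod_cast hi.1.le
      gcongr
    have h4 := norm_add_le (M.flow z (n * τ)).1 (lat k)
    have h5 := norm_sub_norm_le (M.flow z (n * τ)).1 z.1
    have h6 := norm_sub_norm_le z.1 z₀.1
    linarith
  have hsum : (volume.restrict box) univ < ∑ i ∈ s, (volume.restrict box) (t i) := by
    have h1 : ∀ i ∈ s, volume K ≤ (volume.restrict box) (t i) := fun i hi => by
      rw [Measure.restrict_eq_self _ (htb i hi)]; exact htv i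
    refine lt_of_lt_of_le ?_ (Finset.card_nsmul_le_sum s _ _ h1)
    have hcard : s.card = N * ((2 * m + 1) * (2 * m + 1)) := by
      simp only [hs, Finset.card_product, Finset.card_range, Int.card_Icc]
      congr <;> omega
    rw [Measure.restrict_apply_univ, hboxv, hvK, hcard, nsmul_eq_mul, ← ENNReal.ofReal_natCast,
      ← ENNReal.ofReal_mul (by positivity), ENNReal.ofReal_lt_ofReal_iff_of_nonneg (by positivity)]
    push_cast
    have hm0 : (0 : ℝ) ≤ m := Nat.cast_nonneg m
    nlinarith [mul_nonneg hm0 hm0, mul_le_mul_of_nonneg_right hN.le (mul_nonneg hm0 hm0), sq_nonneg P,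
      mul_nonneg hm0 (sq_nonneg P)]
  obtain ⟨i, hi, j, hj, hij, y, hyi, hyj⟩ :=
    exists_nonempty_inter_of_measure_univ_lt_sum_measure (volume.restrict box)
      (fun i _ => (htc i).measurableSet.nullMeasurableSet) hsum
  obtain ⟨_, ⟨z1, hz1, rfl⟩, h1⟩ := hyi
  obtain ⟨_, ⟨z2, hz2, rfl⟩, h2⟩ := hyj
  have main : ∀ (i j : ℕ × (ℤ × ℤ)) z1 z2, z1 ∈ K → z2 ∈ K → i.1 < j.1 →
      M.flow z1 (i.1 * τ) + (lat i.2, 0) = M.flow z2 (j.1 * τ) + (lat j.2, 0) →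
      ∃ z ∈ U, ∃ z' ∈ U, ∃ n : ℕ, 1 ≤ n ∧ ∃ k, M.flow z (n * τ) = z' + (lat k, 0) := by
    intro i j z1 z2 h1 h2 hlt he
    refine ⟨z2, hKU h2, z1, hKU h1, j.1 - i.1, by omega, i.2 - j.2, ?_⟩
    rw [← flow_cancel he, Nat.cast_sub hlt.le, sub_mul]
  have he : M.flow z1 (i.1 * τ) + (lat i.2, 0) = M.flow z2 (j.1 * τ) + (lat j.2, 0) := h1.trans h2.symm
  rcases lt_trichotomy i.1 j.1 with hlt | heq | hlt
  · exact main i j z1 z2 hz1 hz2 hlt he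
  · exfalso
    have h3 := flow_cancel he
    rw [heq, sub_self, flow_zero] at h3
    have h4 : lat (i.2 - j.2) = z2.1 - z1.1 := by rw [h3]; simp
    have h5 : ‖lat (i.2 - j.2)‖ < 1 := by
      rw [h4]
      refine (norm_fst_le (z2 - z1)).trans_lt ?_
      rw [← dist_eq_norm]
      have := dist_triangle_right z2 z1 z₀
      have := Metric.mem_closedBall.1 hz1
      have := Metric.mem_closedBall.1 hz2
      linarith
    exact hij (Prod.ext heq (sub_eq_zero.1 (eq_zero_of_norm_lat_lt h5)))
  · exact main j i z2 z1 hz2 hz1 hlt he.symm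

/-- Volume recurrence turns a large bump into a large dip. -/
lemma exists_dip {w : ℤ × ℤ} {R : ℝ} {c : ℝ → ℝ × ℝ} (hc : M.UG c) {t₁ t₂ t₃ : ℝ} (h12 : t₁ ≤ t₂)
    (h23 : t₂ ≤ t₃) (hb1 : hgt w (c t₁) + R < hgt w (c t₂)) (hb3 : hgt w (c t₃) + R < hgt w (c t₂)) :
    ∃ c', M.UG c' ∧ ∃ s₁ s₂ s₃, s₁ ≤ s₂ ∧ s₂ ≤ s₃ ∧ hgt w (c' s₂) + R < hgt w (c' s₁) ∧
      hgt w (c' s₂) + R < hgt w (c' s₃) := by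
  set a := t₂ - t₁ with ha
  set b := t₃ - t₁ with hb
  have hf : ∀ t, Continuous fun z => hgt w (M.flow z t).1 := fun t =>
    (hgt w).continuous.comp (continuous_fst.comp (continuous_flow t))
  let U : Set ((ℝ × ℝ) × (ℝ × ℝ)) := {z | (0 < M.en z ∧ M.en z < 4) ∧
    hgt w (M.flow z 0).1 + R < hgt w (M.flow z a).1 ∧ hgt w (M.flow z b).1 + R < hgt w (M.flow z a).1}
  have hUo : IsOpen U := by
    have he := M.contDiff_en.continuous
    exact ((isOpen_lt continuous_const he).inter (isOpen_lt he continuous_const)).inter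
      ((isOpen_lt ((hf 0).add continuous_const) (hf a)).inter
        (isOpen_lt ((hf b).add continuous_const) (hf a)))
  have hz : M.ph c t₁ ∈ U := by
    refine ⟨⟨by rw [hc.en_ph]; norm_num, by rw [hc.en_ph]; norm_num⟩, ?_⟩
    rw [← hc.ph_add, ← hc.ph_add, ← hc.ph_add, ha, hb, add_zero, add_sub_cancel, add_sub_cancel]
    exact ⟨hb1, hb3⟩
  have hab : a ≤ b := by linarith
  have ha0 : 0 ≤ a := by linarith
  obtain ⟨z, ⟨⟨e0, e4⟩, -, z3⟩, z', ⟨-, z1', -⟩, n, hn, k, hret⟩ :=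
    exists_return (M := M) _ (hUo.mem_nhds hz) (τ := b + 1) (by linarith)
  have hret' : ∀ u, hgt w (M.flow z (n * (b + 1) + u)).1 = hgt w (M.flow z' u).1 + hgt w (lat k) := by
    intro u
    rw [flow_add, hret, flow_per, Prod.fst_add, map_add]
  have hn1 : (1 : ℝ) ≤ n := by exact_mod_cast hn
  have hτ : b + 1 ≤ n * (b + 1) := by nlinarith
  obtain ⟨u, hu1, hu2, hu3, hu4⟩ : ∃ u, a ≤ u ∧ u ≤ n * (b + 1) + a ∧
      hgt w (M.flow z u).1 + R < hgt w (M.flow z a).1 ∧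
      hgt w (M.flow z u).1 + R < hgt w (M.flow z (n * (b + 1) + a)).1 := by
    have e1 := hret' 0
    have e2 := hret' a
    rw [add_zero] at e1
    rcases le_total (hgt w (M.flow z b).1) (hgt w (M.flow z (n * (b + 1))).1) with hle | hle
    · exact ⟨b, hab, by linarith, z3, by linarith⟩
    · exact ⟨n * (b + 1), by linarith, by linarith, by linarith, by linarith⟩
  set s := (Real.sqrt (M.en z))⁻¹ with hs
  have hs0 : 0 < s := inv_pos.2 (Real.sqrt_pos.2 e0)
  have hug := ug_of_sol (sol_scale (fun t => hasDerivAt_flow_ham e4.le t) s) (by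
    rw [en_smul, show ∀ z : (ℝ × ℝ) × (ℝ × ℝ), (z.1, z.2) = z from fun _ => rfl, en_flow, hs, inv_pow,
      Real.sq_sqrt e0.le, inv_mul_cancel₀ e0.ne'])
  have hsc : ∀ u, s * (u / s) = u := fun u => by field_simp
  refine ⟨_, hug, a / s, u / s, (n * (b + 1) + a) / s, by gcongr, by gcongr, ?_, ?_⟩
  · simp only [hsc]; exact hu3
  · simp only [hsc]; exact hu4

end TorusMetric

namespace TorusMetric
variable {M : TorusMetric}

/-- A bump `β` and a dip `d` between a floor and a ceiling: the building blocks of a family of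
obstacles indexed by sets of natural numbers. -/
structure Switch (M : TorusMetric) (w : ℤ × ℤ) where
  hw : w ≠ 0
  (bot top β d : ℝ → ℝ × ℝ)
  (ug_bot : M.UG bot) (ug_top : M.UG top) (ug_β : M.UG β) (ug_d : M.UG d)
  (s₁ s₂ s₃ u₁ u₂ u₃ m₁ m₀ S D : ℝ)
  (K N : ℕ)
  (s12 : s₁ ≤ s₂) (s23 : s₂ ≤ s₃) (u12 : u₁ ≤ u₂) (u23 : u₂ ≤ u₃)
  hgt_bot : ∀ t, hgt w (bot t) ∈ Icc (m₀ - 2 - S) (m₀ - 2)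
  wid_bot : ∀ X, ∃ a b, a ≤ b ∧ wid w (bot a) ≤ -X ∧ X ≤ wid w (bot b)
  hgt_top : ∀ t, hgt (-w) (top t) ∈ Icc (-(m₁ + 2) - S) (-(m₁ + 2))
  wid_top : ∀ X, ∃ a b, a ≤ b ∧ wid (-w) (top a) ≤ -X ∧ X ≤ wid (-w) (top b)
  β_le : ∀ t ∈ Icc s₁ s₃, hgt w (β t) ≤ m₁
  β_eq : hgt w (β s₂) = m₁
  β_first : ∀ t ∈ Icc s₁ s₂, hgt w (β t) = m₁ → t = s₂
  le_d : ∀ t ∈ Icc u₁ u₃, m₀ ≤ hgt w (d t)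
  d_eq : hgt w (d u₂) = m₀
  β_left : hgt w (β s₁) + (ww w * M.rho + ww w / M.cl * M.tau + 1) ≤ m₀ - 2 - S
  β_right : hgt w (β s₃) + (ww w * M.rho + ww w / M.cl * M.tau + 1) ≤ m₀ - 2 - S
  d_left : m₁ + 2 + S + (ww w * M.rho + ww w / M.cl * M.tau + 1) ≤ hgt w (d u₁)
  d_right : m₁ + 2 + S + (ww w * M.rho + ww w / M.cl * M.tau + 1) ≤ hgt w (d u₃)
  β_wid : ∀ t ∈ Icc s₁ s₃, |wid w (β t)| ≤ D
  d_wid : ∀ t ∈ Icc u₁ u₃, |wid w (d t)| ≤ D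
  hK : 2 * D + 3 ≤ K * qq w
  hN : 2 * (K * qq w + 2 * D + 2) ≤ N * qq w
  gap : ww w * (M.cu * (2 + qq w) + 1) < 2 * M.cl * (m₁ - m₀ - 3)

namespace Switch
variable {w : ℤ × ℤ} (G : Switch M w)

/-- The lattice translate of a curve by `n` horizontal steps. -/
def sh (w : ℤ × ℤ) (c : ℝ → ℝ × ℝ) (n : ℤ) (t : ℝ) : ℝ × ℝ := c t + lat (n • rot w)

lemma ug_sh {c : ℝ → ℝ × ℝ} (hc : M.UG c) (n : ℤ) : M.UG (sh w c n) := hc.trans _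

lemma hgt_sh (c : ℝ → ℝ × ℝ) (n : ℤ) (t : ℝ) : hgt w (sh w c n t) = hgt w (c t) := by
  rw [sh, map_add, lat_zsmul, map_smul, hgt_rot, smul_zero, add_zero]

lemma wid_sh (c : ℝ → ℝ × ℝ) (n : ℤ) (t : ℝ) : wid w (sh w c n t) = wid w (c t) + n * qq w := by
  rw [sh, map_add, lat_zsmul, map_smul, wid_rot, smul_eq_mul]

/-- The length of a block. -/
def P : ℝ := G.N * qq w

/-- The obstacle attached to the word `σ`: bumps in the blocks of `σ`, dips in the other blocks. -/
def obst (σ : Finset ℕ) : Set (ℝ × ℝ) :=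
  range G.bot ∪ range G.top ∪
  {x | ∃ i ∈ σ, ∃ j : ℤ, |j| ≤ G.K ∧ ∃ t ∈ Icc G.s₁ G.s₃, sh w G.β (i * G.N + j) t = x} ∪
  {x | ∃ i ∉ σ, ∃ t ∈ Icc G.u₁ G.u₃, sh w G.d ((i : ℕ) * G.N) t = x}

/-- The common starting point. -/
def src : ℝ × ℝ := pt w (-(G.P / 2)) (G.m₁ + 1)

/-- The end point after `n` blocks. -/
def tgt (n : ℕ) : ℝ × ℝ := pt w (n * G.P - G.P / 2) (G.m₁ + 1)

variable {G} {σ : Finset ℕ}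

lemma bot_mem (t : ℝ) : G.bot t ∈ G.obst σ := .inl (.inl (.inl ⟨t, rfl⟩))

lemma top_mem (t : ℝ) : G.top t ∈ G.obst σ := .inl (.inl (.inr ⟨t, rfl⟩))

lemma β_mem {i : ℕ} (hi : i ∈ σ) {j : ℤ} (hj : |j| ≤ G.K) {t : ℝ} (ht : t ∈ Icc G.s₁ G.s₃) :
    sh w G.β (i * G.N + j) t ∈ G.obst σ := .inl (.inr ⟨i, hi, j, hj, t, ht, rfl⟩)

lemma d_mem {i : ℕ} (hi : i ∉ σ) {t : ℝ} (ht : t ∈ Icc G.u₁ G.u₃) :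
    sh w G.d (i * G.N) t ∈ G.obst σ := .inr ⟨i, hi, t, ht, rfl⟩

lemma D_nonneg : 0 ≤ G.D := (abs_nonneg _).trans (G.β_wid G.s₁ ⟨le_rfl, G.s12.trans G.s23⟩)

lemma K_nonneg : 0 ≤ G.K * qq w := mul_nonneg (Nat.cast_nonneg _) (qq_pos G.hw).le

lemma two_mul_le_P : 2 * (G.K * qq w + 2 * G.D + 2) ≤ G.P := G.hN

lemma P_pos : 0 < G.P := by linarith [G.two_mul_le_P, G.D_nonneg, G.K_nonneg]

lemma gap_pos : 0 < G.m₁ - G.m₀ - 3 := by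
  have h1 := ww_pos G.hw
  have h2 := qq_pos G.hw
  have h3 := M.cu_pos
  have h4 := M.cl_pos
  have h5 : 0 < ww w * (M.cu * (2 + qq w) + 1) := by positivity
  exact pos_of_mul_pos_right (h5.trans G.gap) (by positivity)

/-- The position of the points of the obstacle. -/
lemma obst_cases {x : ℝ × ℝ} (hx : x ∈ G.obst σ) : hgt w x ≤ G.m₀ - 2 ∨ G.m₁ + 2 ≤ hgt w x ∨
    (∃ i ∈ σ, |wid w x - i * G.P| ≤ G.K * qq w + G.D ∧ hgt w x ≤ G.m₁) ∨
    ∃ i ∉ σ, |wid w x - (i : ℕ) * G.P| ≤ G.D ∧ G.m₀ ≤ hgt w x := by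
  rcases hx with ((⟨t, rfl⟩ | ⟨t, rfl⟩) | ⟨i, hi, j, hj, t, ht, rfl⟩) | ⟨i, hi, t, ht, rfl⟩
  · exact .inl (G.hgt_bot t).2
  · have := (G.hgt_top t).2
    rw [hgt_neg] at this
    exact .inr (.inl (by linarith))
  · refine .inr (.inr (.inl ⟨i, hi, ?_, by rw [hgt_sh]; exact G.β_le t ht⟩))
    have h1 : |(j : ℝ)| ≤ G.K := by exact_mod_cast hj
    rw [wid_sh, P]
    push_cast
    have h2 : wid w (G.β t) + (i * G.N + j) * qq w - i * (G.N * qq w) = j * qq w + wid w (G.β t) := by ring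
    rw [h2]
    refine (abs_add_le _ _).trans (add_le_add ?_ (G.β_wid t ht))
    rw [abs_mul, abs_of_pos (qq_pos G.hw)]
    exact mul_le_mul_of_nonneg_right h1 (qq_pos G.hw).le
  · refine .inr (.inr (.inr ⟨i, hi, ?_, by rw [hgt_sh]; exact G.le_d t ht⟩))
    rw [wid_sh, P]
    push_cast
    have h2 : wid w (G.d t) + i * G.N * qq w - i * (G.N * qq w) = wid w (G.d t) := by ring
    rw [h2]
    exact G.d_wid t ht

variable {L : ℝ} {B : ℝ × ℝ} {κ : ℝ → ℝ × ℝ}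

lemma hgt_src : hgt w G.src = G.m₁ + 1 := hgt_pt G.hw _ _
lemma wid_src : wid w G.src = -(G.P / 2) := wid_pt G.hw _ _
lemma hgt_tgt (n : ℕ) : hgt w (G.tgt n) = G.m₁ + 1 := hgt_pt G.hw _ _
lemma wid_tgt (n : ℕ) : wid w (G.tgt n) = n * G.P - G.P / 2 := wid_pt G.hw _ _

lemma le_hgt (h : M.LP (G.obst σ) L G.src B κ) {s : ℝ} (hs : s ∈ Icc 0 L) :
    G.m₀ - 2 - G.S ≤ hgt w (κ s) :=
  h.floor G.hw G.ug_bot G.hgt_bot G.wid_bot bot_mem (by rw [hgt_src]; linarith [G.gap_pos]) hs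

lemma hgt_le (h : M.LP (G.obst σ) L G.src B κ) {s : ℝ} (hs : s ∈ Icc 0 L) :
    hgt w (κ s) ≤ G.m₁ + 2 + G.S := by
  have := h.floor (neg_ne_zero.2 G.hw) G.ug_top G.hgt_top G.wid_top top_mem
    (by rw [hgt_neg, hgt_src]; linarith) hs
  rw [hgt_neg] at this
  linarith

/-- A point of an arc which is close to the strip is far from the ends of the arc. -/
lemma mem_Icc_of_far (hw : w ≠ 0) {c : ℝ → ℝ × ℝ} (hc : M.UG c) {a b s₀ : ℝ} {x : ℝ × ℝ}
    (hs₀ : s₀ ∈ Icc a b) (hd : M.dist x (c s₀) ≤ M.rc / 4)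
    (ha : ww w * M.rho + ww w / M.cl * M.tau + 1 ≤ |hgt w x - hgt w (c a)|)
    (hb : ww w * M.rho + ww w / M.cl * M.tau + 1 ≤ |hgt w x - hgt w (c b)|) {s : ℝ}
    (hs : |s - s₀| ≤ M.tau) : s ∈ Icc a b := by
  have hW := ww_pos hw
  have hcl := M.cl_pos
  have h2 := norm_le_rho (M := M) (x := x) (y := c s₀) (by linarith [M.rc_pos])
  have h3 := (abs_hgt_le w (x - c s₀)).trans (mul_le_mul_of_nonneg_left h2 hW.le)
  rw [map_sub] at h3
  have key : ∀ r, |s₀ - r| ≤ M.tau →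
      |hgt w x - hgt w (c r)| ≤ ww w * M.rho + ww w / M.cl * M.tau := fun r hr => by
    have h4 := hc.abs_hgt_sub_le w r s₀
    have h5 : ww w / M.cl * |s₀ - r| ≤ ww w / M.cl * M.tau := by gcongr
    have h6 := abs_add_le (hgt w x - hgt w (c s₀)) (hgt w (c s₀) - hgt w (c r))
    rw [sub_add_sub_cancel] at h6
    linarith
  rw [abs_le] at hs
  constructor
  · by_contra! h
    have := key a (abs_le.2 ⟨by linarith [hs₀.1, M.tau_pos], by linarith⟩)
    linarith
  · by_contra! h
    have := key b (abs_le.2 ⟨by linarith, by linarith [hs₀.2, M.tau_pos]⟩)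
    linarith

lemma cc : M.CC (G.obst σ) G.src := by
  refine cc_of_chord fun L B κ hκ s hs x hx hd => ?_
  have h1 := le_hgt hκ hs
  have h2 := hgt_le hκ hs
  rcases hx with ((⟨t, rfl⟩ | ⟨t, rfl⟩) | ⟨i, hi, j, hj, t, ht, rfl⟩) | ⟨i, hi, t, ht, rfl⟩
  · exact .inl ⟨_, t, G.ug_bot, rfl, fun s _ => bot_mem s⟩
  · exact .inl ⟨_, t, G.ug_top, rfl, fun s _ => top_mem s⟩
  · refine .inl ⟨_, t, ug_sh G.ug_β _, rfl, fun r hr => β_mem hi hj ?_⟩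
    refine mem_Icc_of_far G.hw (ug_sh G.ug_β _) ht hd ?_ ?_ hr <;> rw [hgt_sh] <;>
      refine le_trans ?_ (le_abs_self _)
    · linarith [G.β_left]
    · linarith [G.β_right]
  · refine .inl ⟨_, t, ug_sh G.ug_d _, rfl, fun r hr => d_mem hi ?_⟩
    refine mem_Icc_of_far G.hw (ug_sh G.ug_d _) ht hd ?_ ?_ hr <;> rw [hgt_sh] <;>
      refine le_trans ?_ (neg_le_abs _)
    · linarith [G.d_left]
    · linarith [G.d_right]

end Switch
end TorusMetric

namespace TorusMetric
namespace Switch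
variable {M : TorusMetric} {w : ℤ × ℤ} {G : Switch M w} {σ : Finset ℕ} {L : ℝ} {B : ℝ × ℝ} {κ : ℝ → ℝ × ℝ}

lemma block_unique {i k : ℕ} {x a b : ℝ} (h1 : |x - i * G.P| ≤ a) (h2 : |x - k * G.P| ≤ b)
    (hab : a + b < G.P) : i = k := by
  have hP := G.P_pos
  rw [abs_le] at h1 h2
  have h3 : (i : ℝ) < k + 1 := by
    by_contra! h
    nlinarith
  have h4 : (k : ℝ) < i + 1 := by
    by_contra! h
    nlinarith
  have h5 : i < k + 1 := by exact_mod_cast h3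
  have h6 : k < i + 1 := by exact_mod_cast h4
  omega

lemma block_boundary {i k : ℕ} {a : ℝ} (h : |k * G.P - G.P / 2 - i * G.P| ≤ a) (ha : a < G.P / 2) : False := by
  have hP := G.P_pos
  rw [abs_le] at h
  have h3 : (i : ℝ) < k := by
    by_contra! h
    nlinarith
  have h4 : (k : ℝ) < i + 1 := by
    by_contra! h
    nlinarith
  have h5 : i < k := by exact_mod_cast h3
  have h6 : k < i + 1 := by exact_mod_cast h4
  omega

lemma exists_seg {x x' y y' l : ℝ} (hl : |y - y'| + |x - x'| ≤ l)
    (h : ∀ z ∈ G.obst σ, ∀ t ∈ Icc (0 : ℝ) 1, hgt w z = y + t * (y' - y) → wid w z = x + t * (x' - x) → False) :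
    ∃ L κ, M.LP (G.obst σ) L (pt w x y) (pt w x' y') κ ∧ L ≤ M.cu * l := by
  have hw := G.hw
  obtain ⟨κ, hκ⟩ := exists_lp_seg_of (M := M) (O := G.obst σ) (A := pt w x y) (B := pt w x' y') (w := w)
    (by simpa only [hgt_pt hw, wid_pt hw] using h)
  refine ⟨_, κ, hκ, mul_le_mul_of_nonneg_left ?_ M.cu_pos.le⟩
  refine (norm_le_hgt_wid hw _).trans ?_
  rwa [map_sub, map_sub, hgt_pt hw, hgt_pt hw, wid_pt hw, wid_pt hw]

/-- The cost of a block. -/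
def cost (G : Switch M w) : ℝ := M.cu * (G.P + 2 * (G.m₁ - G.m₀ + 2))

lemma cost_pos : 0 < G.cost := by
  have := G.P_pos
  have := G.gap_pos
  exact mul_pos M.cu_pos (by linarith)

lemma exists_path (σ : Finset ℕ) (n : ℕ) :
    ∃ L κ, M.LP (G.obst σ) L G.src (G.tgt n) κ ∧ L ≤ n * G.cost := by
  have hP := G.two_mul_le_P
  have hD := G.D_nonneg
  have hK := G.K_nonneg
  have hg := G.gap_pos
  have hcu := M.cu_pos
  have vert : ∀ k : ℕ, ∀ z ∈ G.obst σ, G.m₀ - 1 ≤ hgt w z → hgt w z ≤ G.m₁ + 1 →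
      wid w z = k * G.P - G.P / 2 → False := by
    intro k z hz h1 h2 h3
    rcases obst_cases hz with h | h | ⟨i, -, h, -⟩ | ⟨i, -, h, -⟩
    · linarith
    · linarith
    · rw [h3] at h; exact block_boundary h (by linarith)
    · rw [h3] at h; exact block_boundary h (by linarith)
  induction n with
  | zero =>
    obtain ⟨L, κ, h, hL⟩ := exists_seg (G := G) (σ := σ) (x := -(G.P / 2)) (x' := (0 : ℕ) * G.P - G.P / 2)
      (y := G.m₁ + 1) (y' := G.m₁ + 1) (l := 0) (by simp) (by
        intro z hz t _ h1 h2
        simp only [sub_self, mul_zero, add_zero, Nat.cast_zero, zero_mul, zero_sub] at h1 h2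
        exact vert 0 z hz (by linarith) h1.le (by rw [h2]; simp))
    exact ⟨L, κ, h, by simpa using hL⟩
  | succ k ih =>
    obtain ⟨L, κ, h, hL⟩ := ih
    have hk : ((k + 1 : ℕ) : ℝ) * G.P - G.P / 2 = k * G.P + G.P / 2 := by push_cast; ring
    have hc : ((k + 1 : ℕ) : ℝ) * G.cost = k * G.cost + G.cost := by push_cast; ring
    suffices h' : ∃ L κ, M.LP (G.obst σ) L (G.tgt k) (G.tgt (k + 1)) κ ∧ L ≤ G.cost by
      obtain ⟨L', κ', h', hL'⟩ := h'
      obtain ⟨κ'', h''⟩ := h.trans h'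
      exact ⟨_, _, h'', by rw [hc]; linarith⟩
    have across : ∀ z : ℝ × ℝ, ∀ t ∈ Icc (0 : ℝ) 1,
        wid w z = k * G.P - G.P / 2 + t * ((k + 1 : ℕ) * G.P - G.P / 2 - (k * G.P - G.P / 2)) →
        |wid w z - k * G.P| ≤ G.P / 2 := by
      intro z t ht hz
      rw [hk] at hz
      rw [hz, abs_le]
      constructor <;> nlinarith [ht.1, ht.2, G.P_pos]
    have hwid : |(k : ℝ) * G.P - G.P / 2 - ((k + 1 : ℕ) * G.P - G.P / 2)| = G.P := by
      rw [hk, show (k : ℝ) * G.P - G.P / 2 - (k * G.P + G.P / 2) = -G.P by ring, abs_neg, abs_of_pos G.P_pos]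
    by_cases hkσ : k ∈ σ
    · obtain ⟨L, κ, h, hL⟩ := exists_seg (G := G) (σ := σ) (x := k * G.P - G.P / 2)
        (x' := (k + 1 : ℕ) * G.P - G.P / 2) (y := G.m₁ + 1) (y' := G.m₁ + 1) (l := G.P) (by rw [hwid, sub_self, abs_zero, zero_add]) (by
          intro z hz t ht h1 h2
          simp only [sub_self, mul_zero, add_zero] at h1
          have h3 := across z t ht h2
          rcases obst_cases hz with h | h | ⟨i, -, -, h⟩ | ⟨i, hi, h, -⟩
          · linarith
          · linarith
          · linarith
          · exact hi (block_unique h h3 (by linarith) ▸ hkσ))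
      exact ⟨L, κ, h, hL.trans (mul_le_mul_of_nonneg_left (by linarith) hcu.le)⟩
    · have hv : |G.m₁ + 1 - (G.m₀ - 1)| + 0 = G.m₁ - G.m₀ + 2 := by
        rw [abs_of_pos (by linarith)]; ring
      obtain ⟨L₁, κ₁, h₁, hL₁⟩ := exists_seg (G := G) (σ := σ) (x := k * G.P - G.P / 2)
        (x' := k * G.P - G.P / 2) (y := G.m₁ + 1) (y' := G.m₀ - 1) (l := G.m₁ - G.m₀ + 2)
        (by rw [sub_self, abs_zero, hv]) (by
          intro z hz t ht h1 h2
          simp only [sub_self, mul_zero, add_zero] at h2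
          exact vert k z hz (by nlinarith [ht.1, ht.2]) (by nlinarith [ht.1, ht.2]) h2)
      obtain ⟨L₂, κ₂, h₂, hL₂⟩ := exists_seg (G := G) (σ := σ) (x := k * G.P - G.P / 2)
        (x' := (k + 1 : ℕ) * G.P - G.P / 2) (y := G.m₀ - 1) (y' := G.m₀ - 1) (l := G.P) (by rw [hwid, sub_self, abs_zero, zero_add]) (by
          intro z hz t ht h1 h2
          simp only [sub_self, mul_zero, add_zero] at h1
          have h3 := across z t ht h2
          rcases obst_cases hz with h | h | ⟨i, hi, h, -⟩ | ⟨i, -, -, h⟩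
          · linarith
          · linarith
          · exact hkσ (block_unique h h3 (by linarith) ▸ hi)
          · linarith)
      obtain ⟨L₃, κ₃, h₃, hL₃⟩ := exists_seg (G := G) (σ := σ) (x := (k + 1 : ℕ) * G.P - G.P / 2)
        (x' := (k + 1 : ℕ) * G.P - G.P / 2) (y := G.m₀ - 1) (y' := G.m₁ + 1) (l := G.m₁ - G.m₀ + 2)
        (by rw [sub_self, abs_zero, abs_sub_comm, hv]) (by
          intro z hz t ht h1 h2
          simp only [sub_self, mul_zero, add_zero] at h2
          exact vert (k + 1) z hz (by nlinarith [ht.1, ht.2]) (by nlinarith [ht.1, ht.2]) h2)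
      obtain ⟨κ₄, h₄⟩ := h₁.trans h₂
      obtain ⟨κ₅, h₅⟩ := h₄.trans h₃
      refine ⟨_, _, h₅, ?_⟩
      rw [cost]
      linarith

lemma src_ne_tgt {n : ℕ} (hn : 0 < n) : G.src ≠ G.tgt n := by
  intro h
  have := congrArg (wid w) h
  rw [wid_src, wid_tgt] at this
  have h1 : (0 : ℝ) < n := by exact_mod_cast hn
  nlinarith [G.P_pos]

lemma hgt_le_add (hw : w ≠ 0) {x y : ℝ × ℝ} {r : ℝ} (h : ‖x - y‖ ≤ r) :
    |hgt w x - hgt w y| ≤ ww w * r ∧ |wid w x - wid w y| ≤ ww w * r := by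
  have hW := ww_pos hw
  rw [← map_sub, ← map_sub]
  exact ⟨(abs_hgt_le w _).trans (by gcongr), (abs_wid_le w _).trans (by gcongr)⟩

/-- A path which comes close to the target may be closed up by a segment. -/
lemma le_of_near {n : ℕ} {L₀ : ℝ} (hmin : ∀ L κ, M.LP (G.obst σ) L G.src (G.tgt n) κ → L₀ ≤ L)
    (h : M.LP (G.obst σ) L G.src B κ) {δ : ℝ} (hB : ‖B - G.tgt n‖ ≤ δ) (hδ : ww w * δ ≤ 1 / 2) :
    L₀ ≤ L + M.cu * δ := by
  obtain ⟨h1, h2⟩ := hgt_le_add G.hw hB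
  rw [hgt_tgt] at h1
  rw [wid_tgt] at h2
  rw [abs_le] at h1 h2
  obtain ⟨κ', hκ'⟩ := exists_lp_seg_of (M := M) (O := G.obst σ) (A := B) (B := G.tgt n) (w := w) (by
    intro z hz t ht e1 e2
    rw [hgt_tgt] at e1
    rw [wid_tgt] at e2
    have f1 : |hgt w z - (G.m₁ + 1)| ≤ 1 / 2 := by
      rw [e1, abs_le]; constructor <;> nlinarith [ht.1, ht.2]
    have f2 : |wid w z - (n * G.P - G.P / 2)| ≤ 1 / 2 := by
      rw [e2, abs_le]; constructor <;> nlinarith [ht.1, ht.2]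
    rw [abs_le] at f1 f2
    have hP := G.two_mul_le_P
    have hK := G.K_nonneg
    have hD := G.D_nonneg
    have hg := G.gap_pos
    rcases obst_cases hz with h | h | ⟨i, -, -, h⟩ | ⟨i, -, h, -⟩
    · linarith
    · linarith
    · linarith
    · refine block_boundary (G := G) (i := i) (k := n) (a := G.D + 1 / 2) ?_ (by linarith)
      rw [abs_le] at h ⊢
      constructor <;> linarith)
  obtain ⟨κ'', h''⟩ := h.trans hκ'
  refine (hmin _ _ h'').trans ?_
  have := mul_le_mul_of_nonneg_left hB M.cu_pos.le
  linarith

/-- In a block without bumps the path has to pass below the dip. -/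
lemma exists_low {n : ℕ} (h : M.LP (G.obst σ) L G.src (G.tgt n) κ) {i : ℕ} (hi : i < n) (hiσ : i ∉ σ) :
    ∃ s ∈ Icc 0 L, |wid w (κ s) - i * G.P| ≤ G.D ∧ hgt w (κ s) ≤ G.m₀ := by
  have hw := G.hw
  have hP := G.two_mul_le_P
  have hD := G.D_nonneg
  have hK := G.K_nonneg
  have hq := qq_pos hw
  have hin : (i : ℝ) + 1 ≤ n := by exact_mod_cast hi
  have hi0 : (0 : ℝ) ≤ i := Nat.cast_nonneg i
  have hiP : 0 ≤ i * G.P := mul_nonneg hi0 G.P_pos.le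
  have hnP : (i + 1) * G.P ≤ n * G.P := mul_le_mul_of_nonneg_right hin G.P_pos.le
  have hwid : ∀ t, wid w (sh w G.d (i * G.N) t) = wid w (G.d t) + i * G.P := fun t => by
    rw [wid_sh, P]; push_cast; ring
  have hsub : Icc G.u₁ G.u₂ ⊆ Icc G.u₁ G.u₃ := Icc_subset_Icc le_rfl G.u23
  have hlr : ∀ t ∈ Icc G.u₁ G.u₂, wid w (κ 0) ≤ wid w (sh w G.d (i * G.N) t) ∧
      wid w (sh w G.d (i * G.N) t) ≤ wid w (κ L) := fun t ht => by
    have := abs_le.1 (G.d_wid t (hsub ht))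
    rw [h.start, h.finish, wid_src, wid_tgt, hwid]
    constructor <;> linarith
  have hu2 : G.u₂ ∈ Icc G.u₁ G.u₂ := ⟨G.u12, le_rfl⟩
  obtain ⟨s, hs, hcr⟩ := exists_barrier_crossing (ξ := wid w) (h := -hgt w) (e := lat (rot w)) (u := -lat w)
    (fun x h1 h2 => hgt_wid_inj hw x h1 (by simpa using h2)) (by rw [wid_rot]; exact hq)
    (by simp [hgt_rot]) (by rw [map_neg, wid_self, neg_zero])
    (by rw [neg_apply, map_neg, neg_neg, hgt_self]; exact hq)
    (β := sh w G.d (i * G.N)) h.len G.u12 h.continuousOn (ug_sh G.ug_d _).continuous.continuousOn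
    (fun s hs => by
      rw [neg_apply, neg_apply, hgt_sh]
      have h1 := ww_pos hw
      have h2 := M.rho_pos
      have h3 := M.tau_pos
      have h4 := M.cl_pos
      have h5 : 0 < ww w * M.rho + ww w / M.cl * M.tau := by positivity
      linarith [hgt_le h hs, G.d_left])
    (hlr _ hu2).1 (hlr _ hu2).2 (fun t ht _ => (hlr t ht).1) (fun t ht _ => (hlr t ht).2)
  refine ⟨s, hs, ?_⟩
  rcases hcr with ⟨t, ht, hst⟩ | ⟨h1, h2⟩
  · exact absurd (hst ▸ d_mem hiσ (hsub ht)) (h.avoid s hs.1 hs.2)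
  · rw [neg_apply, neg_apply, hgt_sh, G.d_eq] at h2
    rw [h1, hwid, add_sub_cancel_right]
    exact ⟨G.d_wid _ (hsub hu2), by linarith⟩

end Switch
end TorusMetric

/-- The last time before `t` at which a function has the value `y`. -/
lemma exists_last_eq {f : ℝ → ℝ} {x t y : ℝ} (hxt : x ≤ t) (hf : ContinuousOn f (Icc x t)) (hx : y ≤ f x)
    (ht : f t ≤ y) : ∃ a ∈ Icc x t, f a = y ∧ ∀ s ∈ Icc a t, f s ≤ y := by
  have hK : IsCompact (Icc x t ∩ f ⁻¹' Ici y) :=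
    isCompact_Icc.of_isClosed_subset (hf.preimage_isClosed_of_isClosed isClosed_Icc isClosed_Ici) inter_subset_left
  obtain ⟨a, ⟨ha, hay⟩, hmax⟩ := hK.exists_isGreatest ⟨x, ⟨le_rfl, hxt⟩, hx⟩
  obtain ⟨b, hb, hby⟩ := intermediate_value_Icc' ha.2 (hf.mono (Icc_subset_Icc ha.1 le_rfl)) ⟨ht, hay⟩
  have hba : b = a := le_antisymm (hmax ⟨⟨ha.1.trans hb.1, hb.2⟩, hby.ge⟩) hb.1
  subst hba
  refine ⟨b, ha, hby, fun s hs => ?_⟩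
  rcases hs.1.eq_or_lt with rfl | h
  · exact hby.le
  · by_contra! hlt
    exact absurd (hmax ⟨⟨ha.1.trans hs.1, hs.2⟩, hlt.le⟩) (not_le.2 h)

/-- The first time after `t` at which a function has the value `y`. -/
lemma exists_first_eq {f : ℝ → ℝ} {x t y : ℝ} (htx : t ≤ x) (hf : ContinuousOn f (Icc t x)) (hx : y ≤ f x)
    (ht : f t ≤ y) : ∃ b ∈ Icc t x, f b = y ∧ ∀ s ∈ Icc t b, f s ≤ y := by
  obtain ⟨a, ha, h1, h2⟩ := exists_last_eq (f := fun s => f (-s)) (x := -x) (t := -t) (by linarith)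
    (hf.comp continuous_neg.continuousOn fun s hs => ⟨by linarith [hs.2], by linarith [hs.1]⟩)
    (by simpa using hx) (by simpa using ht)
  refine ⟨-a, ⟨by linarith [ha.2], by linarith [ha.1]⟩, h1, fun s hs => ?_⟩
  simpa using h2 (-s) ⟨by linarith [hs.2], by linarith [hs.1]⟩

namespace TorusMetric
namespace Switch
variable {M : TorusMetric} {w : ℤ × ℤ} {G : Switch M w} {σ : Finset ℕ} {L : ℝ} {B : ℝ × ℝ} {κ : ℝ → ℝ × ℝ}

/-- A point to the left of the first leg of a bump. -/
def IsLeft (G : Switch M w) (n : ℤ) (y : ℝ × ℝ) : Prop :=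
  wid w y ≤ wid w (sh w G.β n G.s₂) ∧
    ∀ t ∈ Icc G.s₁ G.s₂, hgt w (sh w G.β n t) = hgt w y → wid w y ≤ wid w (sh w G.β n t)

/-- A point to the right of the first leg of a bump. -/
def IsRight (G : Switch M w) (n : ℤ) (y : ℝ × ℝ) : Prop :=
  wid w (sh w G.β n G.s₂) ≤ wid w y ∧
    ∀ t ∈ Icc G.s₁ G.s₂, hgt w (sh w G.β n t) = hgt w y → wid w (sh w G.β n t) ≤ wid w y

lemma isLeft_of_hgt {n : ℤ} {y : ℝ × ℝ} (h : hgt w y = G.m₁) (h' : wid w y ≤ wid w (sh w G.β n G.s₂)) :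
    G.IsLeft n y :=
  ⟨h', fun t ht e => by rwa [G.β_first t ht (by rw [← hgt_sh G.β n, e, h])]⟩

lemma isRight_of_hgt {n : ℤ} {y : ℝ × ℝ} (h : hgt w y = G.m₁) (h' : wid w (sh w G.β n G.s₂) ≤ wid w y) :
    G.IsRight n y :=
  ⟨h', fun t ht e => by rwa [G.β_first t ht (by rw [← hgt_sh G.β n, e, h])]⟩

lemma not_crossing {π : ℝ → ℝ × ℝ} {a b : ℝ} (hab : a ≤ b) (hπ : ContinuousOn π (Icc a b)) {n : ℤ}
    (hlow : ∀ s ∈ Icc a b, hgt w (G.β G.s₁) ≤ hgt w (π s)) (hup : ∀ s ∈ Icc a b, hgt w (π s) ≤ G.m₁)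
    (hav : ∀ s ∈ Icc a b, ∀ t ∈ Icc G.s₁ G.s₃, π s ≠ sh w G.β n t) (hl : G.IsLeft n (π a))
    (hr : G.IsRight n (π b)) : False := by
  have hw := G.hw
  have hq := qq_pos hw
  obtain ⟨s, hs, hcr⟩ := exists_barrier_crossing (ξ := wid w) (h := hgt w) (e := lat (rot w)) (u := lat w)
    (hgt_wid_inj hw) (by rw [wid_rot]; exact hq) (hgt_rot w) (wid_self w) (by rw [hgt_self]; exact hq)
    hab G.s12 hπ (ug_sh G.ug_β n).continuous.continuousOn (fun s hs => by rw [hgt_sh]; exact hlow s hs)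
    hl.1 hr.1 hl.2 hr.2
  rcases hcr with ⟨t, ht, hst⟩ | ⟨h1, h2⟩
  · exact hav s hs t ⟨ht.1, ht.2.trans G.s23⟩ hst
  · refine hav s hs G.s₂ ⟨G.s12, G.s23⟩ (sub_eq_zero.1 (hgt_wid_inj hw _ ?_ ?_))
    · rw [map_sub, h1, sub_self]
    · rw [map_sub, sub_eq_zero]
      refine le_antisymm ?_ h2
      rw [hgt_sh, G.β_eq]
      exact hup s hs

lemma not_crossing' {π : ℝ → ℝ × ℝ} {a b : ℝ} (hab : a ≤ b) (hπ : ContinuousOn π (Icc a b)) {n : ℤ}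
    (hlow : ∀ s ∈ Icc a b, hgt w (G.β G.s₁) ≤ hgt w (π s)) (hup : ∀ s ∈ Icc a b, hgt w (π s) ≤ G.m₁)
    (hav : ∀ s ∈ Icc a b, ∀ t ∈ Icc G.s₁ G.s₃, π s ≠ sh w G.β n t) (hl : G.IsLeft n (π b))
    (hr : G.IsRight n (π a)) : False := by
  have hm : ∀ t ∈ Icc (-b) (-a), -t ∈ Icc a b := fun t ht => ⟨by linarith [ht.2], by linarith [ht.1]⟩
  exact not_crossing (π := fun s => π (-s)) (neg_le_neg hab) (hπ.comp continuous_neg.continuousOn hm)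
    (fun s hs => hlow _ (hm s hs)) (fun s hs => hup _ (hm s hs)) (fun s hs => hav _ (hm s hs))
    (by simpa using hl) (by simpa using hr)

lemma abs_sub_le_of_no_translate {x y p q : ℝ} {K : ℕ} (hq : 0 < q) (hx : |x - p| ≤ K * q) (hy : |y - p| ≤ K * q)
    (h : ∀ j : ℤ, |j| ≤ K → ¬(x ≤ p + j * q ∧ p + j * q ≤ y)) : y - x ≤ q := by
  by_contra! hlt
  rw [abs_le] at hx hy
  have h1 := Int.le_ceil ((x - p) / q)
  have h2 := Int.ceil_lt_add_one ((x - p) / q)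
  rw [div_le_iff₀ hq] at h1
  rw [← sub_lt_iff_lt_add, lt_div_iff₀ hq] at h2
  set j := ⌈(x - p) / q⌉
  have h3 : (j : ℝ) * q ≤ y - p := by linarith
  refine h j (abs_le.2 ⟨?_, ?_⟩) ⟨by linarith, by linarith⟩
  · have : -(K : ℝ) ≤ j := by
      by_contra! hh
      nlinarith
    exact_mod_cast this
  · have : (j : ℝ) ≤ K := by
      by_contra! hh
      nlinarith
    exact_mod_cast this

/-- In a block with bumps, a nearly shortest path stays above the low level. -/
lemma not_low {n : ℕ} {L₀ : ℝ} (hmin : ∀ L κ, M.LP (G.obst σ) L G.src (G.tgt n) κ → L₀ ≤ L)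
    (h : M.LP (G.obst σ) L G.src (G.tgt n) κ) (hL : L ≤ L₀ + 1) {i : ℕ} (hi : i ∈ σ) {t : ℝ} (ht : t ∈ Icc 0 L)
    (htw : |wid w (κ t) - i * G.P| ≤ G.D + 3) (hth : hgt w (κ t) ≤ G.m₀ + 3) : False := by
  have hw := G.hw
  have hq := qq_pos hw
  have hg := G.gap_pos
  have hD := G.D_nonneg
  have hP := G.two_mul_le_P
  have hKD := G.hK
  have hcont : ContinuousOn (fun s => hgt w (κ s)) (Icc 0 L) := (hgt w).continuous.comp_continuousOn h.continuousOn
  obtain ⟨a, ha, ha1, ha2⟩ := exists_last_eq (y := G.m₁) ht.1 (hcont.mono (Icc_subset_Icc le_rfl ht.2))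
    (by rw [h.start, hgt_src]; linarith) (by linarith)
  obtain ⟨b, hb, hb1, hb2⟩ := exists_first_eq (y := G.m₁) ht.2 (hcont.mono (Icc_subset_Icc ht.1 le_rfl))
    (by rw [h.finish, hgt_tgt]; linarith) (by linarith)
  have hsub : Icc a b ⊆ Icc 0 L := Icc_subset_Icc ha.1 hb.2
  have hup : ∀ s ∈ Icc a b, hgt w (κ s) ≤ G.m₁ := fun s hs => by
    rcases le_total s t with hst | hst
    · exact ha2 s ⟨hs.1, hst⟩
    · exact hb2 s ⟨hst, hs.2⟩
  have hlow : ∀ s ∈ Icc a b, hgt w (G.β G.s₁) ≤ hgt w (κ s) := fun s hs => by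
    have h1 := ww_pos hw
    have h2 := M.rho_pos
    have h3 := M.tau_pos
    have h4 := M.cl_pos
    have h5 : 0 < ww w * M.rho + ww w / M.cl * M.tau := by positivity
    linarith [le_hgt h (hsub hs), G.β_left]
  have hav : ∀ j : ℤ, |j| ≤ G.K → ∀ s ∈ Icc a b, ∀ r ∈ Icc G.s₁ G.s₃, κ s ≠ sh w G.β (i * G.N + j) r :=
    fun j hj s hs r hr e => h.avoid s (hsub hs).1 (hsub hs).2 (e ▸ β_mem hi hj hr)
  have hκc := h.continuousOn.mono hsub
  have hab : a ≤ b := ha.2.trans hb.1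
  have s1 : Icc a t ⊆ Icc a b := Icc_subset_Icc le_rfl hb.1
  have s2 : Icc t b ⊆ Icc a b := Icc_subset_Icc ha.2 le_rfl
  have hwid : ∀ (j : ℤ) r, wid w (sh w G.β (i * G.N + j) r) = wid w (G.β r) + i * G.P + j * qq w := fun j r => by
    rw [wid_sh, P]; push_cast; ring
  have hβw : ∀ r ∈ Icc G.s₁ G.s₂, |wid w (G.β r)| ≤ G.D := fun r hr => G.β_wid r ⟨hr.1, hr.2.trans G.s23⟩
  have m2 : G.s₂ ∈ Icc G.s₁ G.s₂ := ⟨G.s12, le_rfl⟩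
  rw [abs_le] at htw
  have hKm : |(-(G.K : ℤ))| ≤ G.K := by rw [abs_neg, Nat.abs_cast]
  have hKp : |(G.K : ℤ)| ≤ G.K := by rw [Nat.abs_cast]
  have tR : G.IsRight (i * G.N + -(G.K : ℤ)) (κ t) := by
    have : ∀ r ∈ Icc G.s₁ G.s₂, wid w (sh w G.β (i * G.N + -(G.K : ℤ)) r) ≤ wid w (κ t) := fun r hr => by
      rw [hwid]
      push_cast
      linarith [(abs_le.1 (hβw r hr)).2]
    exact ⟨this _ m2, fun r hr _ => this r hr⟩
  have tL : G.IsLeft (i * G.N + (G.K : ℤ)) (κ t) := by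
    have : ∀ r ∈ Icc G.s₁ G.s₂, wid w (κ t) ≤ wid w (sh w G.β (i * G.N + (G.K : ℤ)) r) := fun r hr => by
      rw [hwid]
      push_cast
      linarith [(abs_le.1 (hβw r hr)).1]
    exact ⟨this _ m2, fun r hr _ => this r hr⟩
  set p := wid w (G.β G.s₂) + i * G.P with hp
  have ea : |wid w (κ a) - p| ≤ G.K * qq w := by
    rw [abs_le]
    constructor <;> by_contra! hlt
    · exact not_crossing ha.2 (hκc.mono s1) (fun s hs => hlow s (s1 hs)) (fun s hs => hup s (s1 hs))
        (fun s hs => hav _ hKm s (s1 hs)) (isLeft_of_hgt ha1 (by rw [hwid]; push_cast; linarith)) tR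
    · exact not_crossing' ha.2 (hκc.mono s1) (fun s hs => hlow s (s1 hs)) (fun s hs => hup s (s1 hs))
        (fun s hs => hav _ hKp s (s1 hs)) tL (isRight_of_hgt ha1 (by rw [hwid]; push_cast; linarith))
  have eb : |wid w (κ b) - p| ≤ G.K * qq w := by
    rw [abs_le]
    constructor <;> by_contra! hlt
    · exact not_crossing' hb.1 (hκc.mono s2) (fun s hs => hlow s (s2 hs)) (fun s hs => hup s (s2 hs))
        (fun s hs => hav _ hKm s (s2 hs)) (isLeft_of_hgt hb1 (by rw [hwid]; push_cast; linarith)) tR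
    · exact not_crossing hb.1 (hκc.mono s2) (fun s hs => hlow s (s2 hs)) (fun s hs => hup s (s2 hs))
        (fun s hs => hav _ hKp s (s2 hs)) tL (isRight_of_hgt hb1 (by rw [hwid]; push_cast; linarith))
  have hdist : |wid w (κ a) - wid w (κ b)| ≤ qq w := by
    rw [abs_sub_le_iff]
    constructor
    · refine abs_sub_le_of_no_translate hq eb ea fun j hj hh => ?_
      exact not_crossing' hab hκc hlow hup (hav j hj) (isLeft_of_hgt hb1 (by rw [hwid]; exact hh.1))
        (isRight_of_hgt ha1 (by rw [hwid]; exact hh.2))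
    · refine abs_sub_le_of_no_translate hq ea eb fun j hj hh => ?_
      exact not_crossing hab hκc hlow hup (hav j hj) (isLeft_of_hgt ha1 (by rw [hwid]; exact hh.1))
        (isRight_of_hgt hb1 (by rw [hwid]; exact hh.2))
  have hpD := abs_le.1 (hβw _ m2)
  have hfar : ∀ x, |x - p| ≤ G.K * qq w → |x - i * G.P| ≤ G.K * qq w + G.D := fun x hx => by
    rw [abs_le] at hx ⊢
    constructor <;> linarith
  have free : ∀ z ∈ G.obst σ, G.m₁ ≤ hgt w z → hgt w z ≤ G.m₁ + 1 → |wid w z - p| ≤ G.K * qq w →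
      hgt w z = G.m₁ := by
    intro z hz h1 h2 h3
    rcases obst_cases hz with h | h | ⟨k, -, -, h⟩ | ⟨k, hk, h, -⟩
    · linarith
    · linarith
    · exact le_antisymm h h1
    · exact absurd (block_unique (hfar _ h3) h (by linarith) ▸ hi) hk
  have vert : ∀ s ∈ Icc 0 L, hgt w (κ s) = G.m₁ → |wid w (κ s) - p| ≤ G.K * qq w →
      ∀ z ∈ G.obst σ, ∀ r ∈ Icc (0 : ℝ) 1, hgt w z = G.m₁ + r → wid w z = wid w (κ s) → False := by
    intro s hs h1 h2 z hz r hr h3 h4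
    have h5 := free z hz (by linarith [hr.1]) (by linarith [hr.2]) (by rwa [h4])
    have : z = κ s := sub_eq_zero.1 (hgt_wid_inj hw _ (by rw [map_sub, h4, sub_self])
      (by rw [map_sub, h5, h1, sub_self]))
    exact h.avoid s hs.1 hs.2 (this ▸ hz)
  have hpt : ∀ s, hgt w (κ s) = G.m₁ → pt w (wid w (κ s)) G.m₁ = κ s := fun s hs =>
    sub_eq_zero.1 (hgt_wid_inj hw _ (by rw [map_sub, wid_pt hw, sub_self])
      (by rw [map_sub, hgt_pt hw, hs, sub_self]))
  have haL : a ∈ Icc 0 L := hsub ⟨le_rfl, hab⟩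
  have hbL : b ∈ Icc 0 L := hsub ⟨hab, le_rfl⟩
  obtain ⟨L₁, κ₁, h₁, hL₁⟩ := exists_seg (G := G) (σ := σ) (x := wid w (κ a)) (x' := wid w (κ a))
    (y := G.m₁) (y' := G.m₁ + 1) (l := 1) (by simp) (by
      intro z hz r hr e1 e2
      exact vert a haL ha1 ea z hz r hr (by rw [e1]; ring) (by rw [e2]; ring))
  obtain ⟨L₂, κ₂, h₂, hL₂⟩ := exists_seg (G := G) (σ := σ) (x := wid w (κ a)) (x' := wid w (κ b))
    (y := G.m₁ + 1) (y' := G.m₁ + 1) (l := qq w) (by rwa [sub_self, abs_zero, zero_add]) (by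
      intro z hz r hr e1 e2
      have := free z hz (by linarith) (by linarith) (by
        rw [abs_le] at ea eb ⊢
        rw [e2]
        constructor <;> nlinarith [hr.1, hr.2])
      linarith)
  obtain ⟨L₃, κ₃, h₃, hL₃⟩ := exists_seg (G := G) (σ := σ) (x := wid w (κ b)) (x' := wid w (κ b))
    (y := G.m₁ + 1) (y' := G.m₁) (l := 1) (by simp) (by
      intro z hz r hr e1 e2
      exact vert b hbL hb1 eb z hz (1 - r) ⟨by linarith [hr.2], by linarith [hr.1]⟩ (by rw [e1]; ring)
        (by rw [e2]; ring))
  rw [hpt a ha1] at h₁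
  rw [hpt b hb1] at h₃
  have hA := h.restrict le_rfl haL.1 haL.2
  have hB := h.restrict hbL.1 hbL.2 le_rfl
  rw [h.start] at hA
  rw [h.finish] at hB
  obtain ⟨κ₄, h₄⟩ := hA.trans h₁
  obtain ⟨κ₅, h₅⟩ := h₄.trans h₂
  obtain ⟨κ₆, h₆⟩ := h₅.trans h₃
  obtain ⟨κ₇, h₇⟩ := h₆.trans hB
  have hle := hmin _ _ h₇
  have hcl := M.cl_pos
  have hW := ww_pos hw
  have speed : ∀ s ∈ Icc 0 L, hgt w (κ s) = G.m₁ → M.cl * (G.m₁ - G.m₀ - 3) ≤ ww w * |s - t| := fun s hs e => by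
    have h1 := (hgt_le_add hw (h.norm_le hs ht)).1
    rw [e] at h1
    have h2 := (le_abs_self _).trans h1
    have h3 : ww w * (1 / M.cl * |s - t|) = ww w * |s - t| / M.cl := by ring
    rw [h3, le_div_iff₀ hcl] at h2
    nlinarith
  have v1 := speed a haL ha1
  have v2 := speed b hbL hb1
  rw [abs_of_nonpos (by linarith [ha.2])] at v1
  rw [abs_of_nonneg (by linarith [hb.1])] at v2
  have hgap := G.gap
  have hba : b - a ≤ M.cu * (2 + qq w) + 1 := by linarith
  nlinarith [mul_le_mul_of_nonneg_left hba hW.le]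

end Switch
end TorusMetric

namespace TorusMetric
namespace Switch
variable {M : TorusMetric} {w : ℤ × ℤ} {G : Switch M w} {σ σ' : Finset ℕ} {δ : ℝ} {n : ℕ}

/-- The geodesic of a word: it visits the low region exactly in the blocks outside the word. -/
structure Codes (G : Switch M w) (δ : ℝ) (n : ℕ) (σ : Finset ℕ) (L₀ : ℝ) (c : ℝ → ℝ × ℝ) : Prop where
  ug : M.UG c
  pos : 0 < L₀
  start : c 0 = G.src
  finish : c L₀ = G.tgt n
  le : L₀ ≤ n * G.cost
  low : ∀ i < n, i ∉ σ → ∃ t ∈ Icc 0 L₀, |wid w (c t) - i * G.P| ≤ G.D + 1 ∧ hgt w (c t) ≤ G.m₀ + 1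
  not_low : ∀ i ∈ σ, ∀ t ∈ Icc 0 L₀, |wid w (c t) - i * G.P| ≤ G.D + 2 → ¬hgt w (c t) ≤ G.m₀ + 2
  tail : ∀ t ∈ Icc 0 L₀, ‖c t - G.tgt n‖ ≤ δ → L₀ ≤ t + M.cu * (2 * δ)

lemma exists_codes (G : Switch M w) (hn : 0 < n) (σ : Finset ℕ) (hδ : 0 < δ) (hδw : ww w * (2 * δ) ≤ 1 / 2) :
    ∃ L₀ c, G.Codes δ n σ L₀ c := by
  have hw := G.hw
  have hW := ww_pos hw
  have hcl := M.cl_pos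
  obtain ⟨l, π, hπ, hl⟩ := G.exists_path σ n
  obtain ⟨L₀, hL₀, hmin, hex⟩ := exists_min G.cc ⟨_, _, hπ⟩ (src_ne_tgt hn)
  obtain ⟨c, hc, hc0, hc1, hκ⟩ := hex δ hδ
  refine ⟨L₀, c, hc, hL₀, hc0, hc1, (hmin _ _ hπ).trans hl, fun i hi hiσ => ?_, fun i hi t ht h1 h2 => ?_,
    fun t ht hd => ?_⟩
  · obtain ⟨L, κ, h, hL, hcl'⟩ := hκ (M.cl * δ) (by positivity)
    obtain ⟨s, hs, h1, h2⟩ := exists_low h hi hiσ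
    refine ⟨min s L₀, ⟨le_min hs.1 hL₀.le, min_le_right _ _⟩, ?_⟩
    have hm : min s L₀ ∈ Icc 0 L := ⟨le_min hs.1 hL₀.le, (min_le_left _ _).trans hs.2⟩
    have h3 : |min s L₀ - s| ≤ M.cl * δ := by
      rw [abs_le]
      constructor
      · rw [le_sub_iff_add_le, le_min_iff]
        constructor
        · nlinarith
        · linarith [hs.2]
      · have : 0 < M.cl * δ := by positivity
        linarith [min_le_left s L₀]
    have h4 : ‖c (min s L₀) - κ s‖ ≤ 2 * δ := by
      have h5 := h.norm_le hm hs
      have h6 := hcl' (min s L₀) ⟨le_min hs.1 hL₀.le, min_le_right _ _⟩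
      rw [norm_sub_rev] at h6
      have h7 := norm_sub_le_norm_sub_add_norm_sub (c (min s L₀)) (κ (min s L₀)) (κ s)
      have h8 : 1 / M.cl * |min s L₀ - s| ≤ δ := by
        rw [div_mul_eq_mul_div, one_mul, div_le_iff₀ hcl]; linarith
      linarith
    obtain ⟨e1, e2⟩ := hgt_le_add hw h4
    rw [abs_le] at e1 e2 h1 ⊢
    exact ⟨⟨by linarith, by linarith⟩, by linarith⟩
  · obtain ⟨L, κ, h, hL, hcl'⟩ := hκ 1 one_pos
    obtain ⟨e1, e2⟩ := hgt_le_add hw (hcl' t ht)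
    have hL' := hmin _ _ h
    rw [abs_le] at e1 e2 h1
    refine not_low hmin h hL hi ⟨ht.1, ht.2.trans hL'⟩ ?_ ?_
    · rw [abs_le]; constructor <;> linarith
    · linarith
  · obtain ⟨L, κ, h, hL, hcl'⟩ := hκ 1 one_pos
    have hL' := hmin _ _ h
    have h1 := h.restrict le_rfl ht.1 (ht.2.trans hL')
    rw [h.start, sub_zero] at h1
    refine le_of_near hmin h1 ?_ hδw
    have := norm_sub_le_norm_sub_add_norm_sub (κ t) (c t) (G.tgt n)
    linarith [hcl' t ht]

/-- Geodesics of different words are separated. -/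
lemma Codes.not_close {L L' : ℝ} {c c' : ℝ → ℝ × ℝ} (h : G.Codes δ n σ L c) (h' : G.Codes δ n σ' L' c')
    (hδw : ww w * (2 * δ) ≤ 1 / 2) (hδc : ww w / M.cl * (M.cu * (2 * δ)) ≤ 1)
    (hcl : ∀ t ∈ Icc 0 (n * G.cost), ‖c t - c' t‖ ≤ δ) {i : ℕ} (hi : i < n) (hiσ : i ∈ σ) : i ∈ σ' := by
  by_contra hiσ'
  have hW := ww_pos G.hw
  have hg := G.gap_pos
  obtain ⟨t, ht, h1, h2⟩ := h'.low i hi hiσ'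
  rcases le_or_gt t L with htL | htL
  · obtain ⟨e1, e2⟩ := hgt_le_add G.hw (hcl t ⟨ht.1, htL.trans h.le⟩)
    rw [abs_le] at e1 e2 h1
    refine h.not_low i hiσ t ⟨ht.1, htL⟩ ?_ ?_
    · rw [abs_le]; constructor <;> linarith
    · linarith
  · have h3 := hcl L ⟨h.pos.le, h.le⟩
    rw [h.finish, norm_sub_rev] at h3
    have h4 := h'.tail L ⟨h.pos.le, htL.le.trans ht.2⟩ h3
    have h5 := h'.ug.abs_hgt_sub_le w t L'
    rw [h'.finish, hgt_tgt, abs_of_nonneg (by linarith [ht.2] : 0 ≤ L' - t)] at h5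
    have h6 : ww w / M.cl * (L' - t) ≤ ww w / M.cl * (M.cu * (2 * δ)) := by
      have := M.cl_pos
      gcongr
      linarith
    linarith [le_abs_self (G.m₁ + 1 - hgt w (c' t))]

end Switch

/-- Closeness of orbits in phase space lifts to closeness of curves with a common starting point. -/
lemma norm_sub_lt_of_phaseDist {c c' : ℝ → ℝ × ℝ} (hc : Continuous c) (hc' : Continuous c') (h0 : c 0 = c' 0)
    {ε T : ℝ} (hε : 0 < ε) (hε' : ε ≤ 1 / 8)
    (h : ∀ t ∈ Icc 0 T, phaseDist (c t, deriv c t) (c' t, deriv c' t) ≤ ε) :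
    ∀ t ∈ Icc 0 T, ‖c t - c' t‖ < 2 * ε := by
  have key : ∀ t ∈ Icc 0 T, ∃ k, ‖c t - (c' t + lat k)‖ < 2 * ε := fun t ht => by
    have h1 : phaseDist (c t, deriv c t) (c' t, deriv c' t) < 2 * ε := by linarith [h t ht]
    unfold phaseDist at h1
    obtain ⟨r, ⟨k, rfl⟩, hr⟩ := exists_lt_of_csInf_lt (by exact ⟨_, 0, rfl⟩) h1
    refine ⟨k, (norm_le_norm2 _).trans_lt ?_⟩
    have := norm2_nonneg (deriv c t - deriv c' t)
    dsimp only at hr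
    linarith
  have small : ∀ t ∈ Icc 0 T, ‖c t - c' t‖ < 1 / 2 → ‖c t - c' t‖ < 2 * ε := fun t ht hlt => by
    obtain ⟨k, hk⟩ := key t ht
    have h1 : ‖lat k‖ < 1 := by
      have := norm_sub_le (c t - c' t) (c t - (c' t + lat k))
      rw [show c t - c' t - (c t - (c' t + lat k)) = lat k by abel] at this
      linarith
    rwa [eq_zero_of_norm_lat_lt h1, lat_zero, add_zero] at hk
  intro t ht
  refine small t ht ?_
  by_contra! hge
  have hf : ContinuousOn (fun s => ‖c s - c' s‖) (Icc 0 t) := (hc.sub hc').norm.continuousOn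
  obtain ⟨s, hs, e⟩ := intermediate_value_Icc ht.1 hf (show (3 / 8 : ℝ) ∈ _ from
    ⟨by simp only [h0, sub_self, norm_zero]; norm_num, by linarith⟩)
  have := small s ⟨hs.1, hs.2.trans ht.2⟩ (by simp only [e]; norm_num)
  simp only [e] at this
  linarith

end TorusMetric

namespace TorusMetric

lemma le_elog {x : ℝ≥0∞} {n : ℕ} (h : ((2 ^ n : ℕ) : ℝ≥0∞) ≤ x) : ((n * Real.log 2 : ℝ) : EReal) ≤ elog x := by
  rw [elog]
  split_ifs with h0 h1
  · rw [h0, nonpos_iff_eq_zero, Nat.cast_eq_zero] at h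
    exact absurd h (by positivity)
  · exact le_top
  · rw [EReal.coe_le_coe_iff, ← Real.log_pow]
    refine Real.log_le_log (by positivity) ?_
    have := ENNReal.toReal_mono h1 h
    rw [ENNReal.toReal_natCast] at this
    exact_mod_cast this

variable {M : TorusMetric}

/-- Exponentially many separated geodesics force positive entropy. -/
lemma topEnt_ne_zero_of_pow_le {ε C : ℝ} (hε : 0 < ε) (hC : 0 < C)
    (h : ∀ n : ℕ, 0 < n → ((2 ^ n : ℕ) : ℝ≥0∞) ≤ sepCount M ε (n * C)) : topEnt M ≠ 0 := by
  have h1 : ((Real.log 2 / C : ℝ) : EReal) ≤ topEnt M := by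
    refine le_trans ?_ (le_iSup₂ (f := fun (ε : ℝ) (_ : 0 < ε) =>
      Filter.limsup (fun T : ℝ => ((T⁻¹ : ℝ) : EReal) * elog (sepCount M ε T)) Filter.atTop) ε hε)
    refine Filter.le_limsup_of_frequently_le ?_ (by isBoundedDefault)
    rw [Filter.frequently_atTop]
    intro a
    obtain ⟨n, hn⟩ := exists_nat_gt (max a 0 / C)
    have hn0 : (0 : ℝ) < n := lt_of_le_of_lt (by positivity) hn
    rw [div_lt_iff₀ hC] at hn
    refine ⟨n * C, (le_max_left _ _).trans hn.le, ?_⟩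
    have h2 := le_elog (h n (by exact_mod_cast hn0))
    have h3 : Real.log 2 / C = (n * C)⁻¹ * (n * Real.log 2) := by field_simp
    rw [h3, EReal.coe_mul]
    exact mul_le_mul_of_nonneg_left h2 (by rw [EReal.coe_nonneg]; positivity)
  intro h0
  rw [h0, ← EReal.coe_zero, EReal.coe_le_coe_iff] at h1
  have : 0 < Real.log 2 / C := div_pos (Real.log_pos one_lt_two) hC
  linarith

lemma Switch.topEnt_ne_zero {w : ℤ × ℤ} (G : Switch M w) : topEnt M ≠ 0 := by
  have hW := ww_pos G.hw
  have hcl := M.cl_pos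
  have hcu := M.cu_pos
  obtain ⟨δ, hδ, h1, h2, h3⟩ : ∃ δ > 0, ww w * (2 * δ) ≤ 1 / 2 ∧ ww w / M.cl * (M.cu * (2 * δ)) ≤ 1 ∧ δ ≤ 1 / 4 := by
    refine ⟨min (1 / 4) (min (1 / (4 * ww w)) (1 / (2 * (ww w / M.cl * M.cu)))), by positivity, ?_, ?_,
      min_le_left _ _⟩
    · have := (min_le_right (1 / 4 : ℝ) _).trans
        (min_le_left (1 / (4 * ww w)) (1 / (2 * (ww w / M.cl * M.cu))))
      rw [le_div_iff₀ (by positivity)] at this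
      linarith
    · have := (min_le_right (1 / 4 : ℝ) _).trans
        (min_le_right (1 / (4 * ww w)) (1 / (2 * (ww w / M.cl * M.cu))))
      rw [le_div_iff₀ (by positivity)] at this
      linarith
  refine topEnt_ne_zero_of_pow_le (ε := δ / 2) (C := G.cost) (by positivity) G.cost_pos fun n hn => ?_
  choose l f hf using fun σ => G.exists_codes hn σ hδ h1
  have inj : ∀ σ ∈ (Finset.range n).powerset, ∀ σ' ∈ (Finset.range n).powerset,
      (∀ t ∈ Icc 0 (n * G.cost), ‖f σ t - f σ' t‖ ≤ δ) → σ = σ' := by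
    intro σ hσ σ' hσ' h
    rw [Finset.mem_powerset] at hσ hσ'
    refine Finset.Subset.antisymm (fun i hi => ?_) (fun i hi => ?_)
    · exact (hf σ).not_close (hf σ') h1 h2 h (Finset.mem_range.1 (hσ hi)) hi
    · exact (hf σ').not_close (hf σ) h1 h2 (fun t ht => by rw [norm_sub_rev]; exact h t ht)
        (Finset.mem_range.1 (hσ' hi)) hi
  classical
  have hcard : ((Finset.range n).powerset.image f).card = 2 ^ n := by
    rw [Finset.card_image_of_injOn, Finset.card_powerset, Finset.card_range]
    intro σ hσ σ' hσ' e
    exact inj σ hσ σ' hσ' fun t _ => by rw [e, sub_self, norm_zero]; exact hδ.le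
  rw [← hcard]
  refine le_iSup₂ (f := fun (F : Finset (ℝ → ℝ × ℝ)) (_ : IsSeparated M (δ / 2) (n * G.cost) F) =>
    (F.card : ℝ≥0∞)) _ ⟨fun c hc => ?_, fun c hc c' hc' hne => ?_⟩
  · obtain ⟨σ, -, rfl⟩ := Finset.mem_image.1 hc
    exact isGeodesic_iff.2 (hf σ).ug
  · obtain ⟨σ, hσ, rfl⟩ := Finset.mem_image.1 hc
    obtain ⟨σ', hσ', rfl⟩ := Finset.mem_image.1 hc'
    by_contra! hle
    refine hne (congrArg f (inj σ hσ σ' hσ' fun t ht => ?_))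
    have := norm_sub_lt_of_phaseDist (hf σ).ug.continuous (hf σ').ug.continuous
      ((hf σ).start.trans (hf σ').start.symm) (by positivity) (by linarith) hle t ht
    linarith

end TorusMetric

namespace TorusMetric
variable {M : TorusMetric}

lemma exists_switch {w : ℤ × ℤ} (hw : w ≠ 0) (hbig : ∀ R : ℝ, ∃ c, M.UG c ∧ ∃ t₁ t₂ t₃, t₁ ≤ t₂ ∧ t₂ ≤ t₃ ∧
    hgt w (c t₁) + R ≤ hgt w (c t₂) ∧ hgt w (c t₃) + R ≤ hgt w (c t₂)) : Nonempty (Switch M w) := by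
  have hq := qq_pos hw
  have hcl := M.cl_pos
  obtain ⟨S₀, -, hfl⟩ := M.exists_floor hw
  obtain ⟨S₁, -, hce⟩ := M.exists_floor (neg_ne_zero.2 hw)
  set S := max S₀ S₁ with hS
  set mar := ww w * M.rho + ww w / M.cl * M.tau + 1 with hmar
  set r := 4 + ww w * (M.cu * (2 + qq w) + 1) / (2 * M.cl) with hr
  obtain ⟨β, hβ, t₁, t₂, t₃, h12, h23, hb1, hb3⟩ := hbig (r + qq w + 2 + S + mar + 1)
  obtain ⟨d, hd, u₁, u₂, u₃, k12, k23, hd1, hd3⟩ := exists_dip (R := r + qq w + 2 + S + mar) hβ h12 h23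
    (by linarith) (by linarith)
  have cβ : Continuous fun t => hgt w (β t) := (hgt w).continuous.comp hβ.continuous
  have cd : Continuous fun t => hgt w (d t) := (hgt w).continuous.comp hd.continuous
  obtain ⟨x, hx, hxmax⟩ := isCompact_Icc.exists_isMaxOn (nonempty_Icc.2 (h12.trans h23)) cβ.continuousOn
  obtain ⟨v, hv, hvmin⟩ := isCompact_Icc.exists_isMinOn (nonempty_Icc.2 (k12.trans k23)) cd.continuousOn
  obtain ⟨s₂, ⟨hs₂, hs₂e⟩, hleast⟩ := (isCompact_Icc.inter_right (isClosed_singleton.preimage cβ)).exists_isLeast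
    (s := Icc t₁ t₃ ∩ (fun t => hgt w (β t)) ⁻¹' {hgt w (β x)}) ⟨x, hx, rfl⟩
  simp only [mem_preimage, mem_singleton_iff] at hs₂e
  set m₁ := hgt w (β x) with hm₁
  have hm2 : hgt w (β t₂) ≤ m₁ := hxmax ⟨h12, h23⟩
  have hv2 : hgt w (d v) ≤ hgt w (d u₂) := hvmin ⟨k12, k23⟩
  set j := ⌊(m₁ - r - hgt w (d v)) / qq w⌋ with hj
  have j1 := Int.floor_le ((m₁ - r - hgt w (d v)) / qq w)
  have j2 := Int.lt_floor_add_one ((m₁ - r - hgt w (d v)) / qq w)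
  rw [le_div_iff₀ hq] at j1
  rw [div_lt_iff₀ hq] at j2
  set m₀ := hgt w (d v) + j * qq w with hm₀
  have hdt : ∀ t, hgt w (d t + lat (j • w)) = hgt w (d t) + j * qq w := fun t => by
    rw [map_add, lat_zsmul, map_smul, hgt_self, smul_eq_mul]
  obtain ⟨D₁, hD₁⟩ := (isCompact_Icc (a := t₁) (b := t₃)).exists_bound_of_continuousOn
    ((wid w).continuous.comp hβ.continuous).continuousOn
  obtain ⟨D₂, hD₂⟩ := (isCompact_Icc (a := u₁) (b := u₃)).exists_bound_of_continuousOn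
    ((wid w).continuous.comp (hd.trans (j • w)).continuous).continuousOn
  set D := max D₁ D₂ with hD
  obtain ⟨K, hK⟩ := exists_nat_ge ((2 * D + 3) / qq w)
  obtain ⟨N, hN⟩ := exists_nat_ge (2 * (K * qq w + 2 * D + 2) / qq w)
  rw [div_le_iff₀ hq] at hK hN
  obtain ⟨bot, hbot, hbot1, hbot2⟩ := hfl (m₀ - 2)
  obtain ⟨top, htop, htop1, htop2⟩ := hce (-(m₁ + 2))
  have hS0 : S₀ ≤ S := le_max_left _ _
  have hS1 : S₁ ≤ S := le_max_right _ _
  exact ⟨{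
    hw := hw
    bot := bot
    top := top
    β := β
    d := fun t => d t + lat (j • w)
    ug_bot := hbot
    ug_top := htop
    ug_β := hβ
    ug_d := hd.trans _
    s₁ := t₁
    s₂ := s₂
    s₃ := t₃
    u₁ := u₁
    u₂ := v
    u₃ := u₃
    m₁ := m₁
    m₀ := m₀
    S := S
    D := D
    K := K
    N := N
    s12 := hs₂.1
    s23 := hs₂.2
    u12 := hv.1
    u23 := hv.2
    hgt_bot := fun t => ⟨by linarith [(hbot1 t).1], (hbot1 t).2⟩
    wid_bot := hbot2
    hgt_top := fun t => ⟨by linarith [(htop1 t).1], (htop1 t).2⟩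
    wid_top := htop2
    β_le := fun t ht => hxmax ht
    β_eq := hs₂e
    β_first := fun t ht e => le_antisymm ht.2 (hleast ⟨⟨ht.1, ht.2.trans hs₂.2⟩, e⟩)
    le_d := fun t ht => by
      have : hgt w (d v) ≤ hgt w (d t) := hvmin ht
      rw [hdt]
      linarith
    d_eq := hdt v
    β_left := by linarith
    β_right := by linarith
    d_left := by rw [hdt]; linarith
    d_right := by rw [hdt]; linarith
    β_wid := fun t ht => (hD₁ t ht).trans (le_max_left _ _)
    d_wid := fun t ht => (hD₂ t ht).trans (le_max_right _ _)
    hK := hK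
    hN := hN
    gap := by
      have h1 : ww w * (M.cu * (2 + qq w) + 1) = 2 * M.cl * (r - 4) := by
        rw [hr]; field_simp; ring
      have h2 : r ≤ m₁ - m₀ := by linarith
      rw [h1]
      exact mul_lt_mul_of_pos_left (by linarith) (by linarith) }⟩

/-- Zero entropy excludes large bumps. -/
lemma nb_of_topEnt (h : topEnt M = 0) : M.NB := by
  by_contra hN
  simp only [NB, not_forall, not_exists, not_not] at hN
  obtain ⟨w, hw, hbig⟩ := hN
  obtain ⟨G⟩ := exists_switch (M := M) hw fun R => by
    obtain ⟨c, hc, t₁, t₂, t₃, h12, h23, h⟩ := hbig R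
    exact ⟨c, hc, t₁, t₂, t₃, h12, h23, h⟩
  exact G.topEnt_ne_zero h

end TorusMetric

/-- **Theorem II.** If the geodesic flow of the Riemannian metric `g` on `T²` has zero
topological entropy, then the asymptotic direction `δ : ST² → S¹` and the rotation number
`ρ = π ∘ δ : ST² → ℝ ∪ {∞}` are well-defined, surjective, continuous functions invariant
under the geodesic flow.  A point of `ST²` is represented by a phase point
`p = (x, v) ∈ ℝ² × ℝ²` with `g_x(v,v) = 1`; a function on the unit tangent bundle of `ℝ²`
which is invariant under the deck transformations descends to `ST²`, and its continuity
(resp. surjectivity) is equivalent to that of the descended function. -/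
theorem stmt1 (M : TorusMetric) (h : topEnt M = 0) :
    ∃ δfun : (ℝ × ℝ) × (ℝ × ℝ) → ℝ × ℝ,
      -- every unit tangent vector carries a geodesic, so `δ` is defined on all of `ST²`
      (∀ x v : ℝ × ℝ, M.g x v v = 1 → ∃ c, M.IsGeodesic c ∧ c 0 = x ∧ deriv c 0 = v) ∧
      -- `δ` is well defined: for every geodesic `c`, the direction of the forward ray
      -- exists and equals the value of `δfun` at the initial phase point of `c`
      (∀ c, M.IsGeodesic c → HasDirection c (δfun (c 0, deriv c 0))) ∧
      -- invariance under the geodesic flow `φᵗ`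
      (∀ c, M.IsGeodesic c → ∀ s : ℝ, δfun (c s, deriv c s) = δfun (c 0, deriv c 0)) ∧
      -- invariance under the deck transformations (so `δfun` descends to `ST²`)
      (∀ (x v : ℝ × ℝ) (k : ℤ × ℤ), δfun (x + lat k, v) = δfun (x, v)) ∧
      -- continuity of `δ` on the unit tangent bundle
      ContinuousOn δfun {p : (ℝ × ℝ) × (ℝ × ℝ) | M.g p.1 p.2 p.2 = 1} ∧
      -- continuity of `ρ = π ∘ δ` into the one-point compactification `ℝ ∪ {∞}`
      ContinuousOn (fun p => projPt (δfun p)) {p : (ℝ × ℝ) × (ℝ × ℝ) | M.g p.1 p.2 p.2 = 1} ∧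
      -- surjectivity of `δ` onto `S¹`
      (∀ z : ℝ × ℝ, norm2 z = 1 → ∃ c, M.IsGeodesic c ∧ δfun (c 0, deriv c 0) = z) ∧
      -- surjectivity of `ρ` onto `ℝ ∪ {∞}`
      (∀ r : OnePoint ℝ, ∃ c, M.IsGeodesic c ∧ projPt (δfun (c 0, deriv c 0)) = r) := by
  exact TorusMetric.direction_of_nb (TorusMetric.nb_of_topEnt h)
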